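/- Let φ : (0,∞) × (0,∞) → (0,∞) be C¹-smooth with ∂₁φ ≥ 0 and ∂₂φ ≥ 0, at least one of these inequalities being strict. If Mⁿ ⊂ ℝ^{n+1} is a closed, smooth, strictly convex hypersurface with support function h > 0 and Gauss curvature 𝒦 satisfying φ(h, |Dh|) 𝒦 = 1 on 𝕊ⁿ, then Mⁿ is a rescaling of 𝕊ⁿ (an origin-centred sphere). -/

import Mathlib

/-!
We work with the unit sphere `𝕊ⁿ = sphere 0 1 ⊆ ℝ^{n+1}`.  A `C²` function `u` on `𝕊ⁿ` is
represented by its positively 1-homogeneous extension `u : ℝ^{n+1} → ℝ` (which is `C²` away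
from the origin).  For such an extension, the ambient Euclidean Hessian `D²u(x)` at a point
`x ∈ 𝕊ⁿ` annihilates the radial direction `x` and its restriction to the tangent space
`x^⊥ = T_x𝕊ⁿ` coincides with the spherical bilinear form `∇̄²u + ḡ u`.  Consequently:

* the eigenvalues of `∇̄²u + ḡ u` w.r.t. `ḡ` are the eigenvalues of the ambient Hessian
  matrix other than the trivial zero radial one, so for `0 ≤ k ≤ n` the elementary symmetric
  function `σ_k(∇̄²u + ḡ u, ḡ)` equals the `k`-th elementary symmetric function of all the
  eigenvalues of the ambient Hessian matrix, which is `(-1)^k` times the coefficient of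
  `t^{n+1-k}` in its characteristic polynomial (`sigmaElem` below);
* the spherical gradient `Du(x)` is the tangential part `∇u(x) - u(x)x` of the ambient
  gradient (`sphGrad` below);
* `u` is convex (resp. the hypersurface with support function `u` is strictly convex) iff the
  Hessian form is positive semidefinite (resp. positive definite on `x^⊥`) at every `x ∈ 𝕊ⁿ`.

The spherical Lebesgue measure `μ` is the `n`-dimensional Hausdorff measure `μH[n]`.
-/

open MeasureTheory Metric
open scoped RealInnerProductSpace

noncomputable section

/-- The ambient Euclidean space `ℝ^{n+1}`. -/
abbrev Esp (n : ℕ) := EuclideanSpace ℝ (Fin (n + 1))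

/-- The ambient Hessian bilinear form `D²u(x)(v,w)` of `u : ℝ^{n+1} → ℝ`. -/
def hessForm (n : ℕ) (u : Esp n → ℝ) (x v w : Esp n) : ℝ :=
  fderiv ℝ (fun y => fderiv ℝ u y w) x v

/-- The ambient Hessian matrix of `u` at `x` in the standard orthonormal coordinates. -/
def hessMatrix (n : ℕ) (u : Esp n → ℝ) (x : Esp n) : Matrix (Fin (n + 1)) (Fin (n + 1)) ℝ :=
  Matrix.of fun i j => hessForm n u x (EuclideanSpace.single i 1) (EuclideanSpace.single j 1)

/-- For a positively 1-homogeneous `u` and `x ∈ 𝕊ⁿ`, `k ≤ n`, this is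
`σ_k(∇̄²u + ḡ u, ḡ)(x)`, the `k`-th elementary symmetric function of the eigenvalues of
`∇̄²u + ḡ u` w.r.t. `ḡ`, computed from the characteristic polynomial of the ambient Hessian. -/
def sigmaElem (n k : ℕ) (u : Esp n → ℝ) (x : Esp n) : ℝ :=
  (-1 : ℝ) ^ k * ((hessMatrix n u x).charpoly.coeff (n + 1 - k))

/-- The spherical gradient `Du(x)` at `x ∈ 𝕊ⁿ`: the tangential part of the ambient gradient. -/
def sphGrad (n : ℕ) (u : Esp n → ℝ) (x : Esp n) : Esp n :=
  gradient u x - u x • x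

/-- `u` is positively 1-homogeneous (i.e. it is the canonical extension of `u|_{𝕊ⁿ}`). -/
def PosHom (n : ℕ) (u : Esp n → ℝ) : Prop :=
  ∀ r : ℝ, 0 < r → ∀ x : Esp n, u (r • x) = r * u x

/-- The spherical Lebesgue measure on `ℝ^{n+1}` (to be restricted to `𝕊ⁿ`):
the `n`-dimensional Hausdorff measure. -/
def sphMeasure (n : ℕ) : Measure (Esp n) := μH[(n : ℝ)]

/-! ### Linear algebra -/

lemma coeff_one_charpoly_aux (n : ℕ) (H : Matrix (Fin (n + 1)) (Fin (n + 1)) ℝ)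
    (x : Fin (n + 1) → ℝ) (hx : x ⬝ᵥ x = 1) (h1 : H.mulVec x = 0) :
    (-1 : ℝ) ^ n * H.charpoly.coeff 1 = (H + Matrix.vecMulVec x x).det := by
  set Q := Matrix.vecMulVec x x with hQ
  have hHQ : H * Q = 0 := by
    rw [hQ, Matrix.mul_vecMulVec, h1]; ext i j; simp [Matrix.vecMulVec_apply]
  have key : H.charpoly * Q.charpoly = Polynomial.X ^ (n + 1) * (H + Q).charpoly := by
    unfold Matrix.charpoly
    rw [← Matrix.det_mul]
    have : H.charmatrix * Q.charmatrix = (Polynomial.X : Polynomial ℝ) • (H + Q).charmatrix := by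
      have hz : (Polynomial.C.mapMatrix H : Matrix _ _ (Polynomial ℝ)) * Polynomial.C.mapMatrix Q = 0 := by
        rw [← map_mul, hHQ, map_zero]
      unfold Matrix.charmatrix
      rw [sub_mul, mul_sub, mul_sub, hz, map_add]
      simp only [Matrix.scalar_apply, ← Matrix.smul_one_eq_diagonal]
      simp only [smul_mul_assoc, one_mul, mul_smul_comm, mul_one, smul_sub, smul_add]
      abel
    rw [this, Matrix.det_smul, Fintype.card_fin]
  have hQc : Q.charpoly = Polynomial.X ^ n * (Polynomial.X - 1) := by
    rw [hQ, Matrix.charpoly_vecMulVec, Fintype.card_fin, hx]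
    simp [pow_succ, mul_sub]
  rw [hQc] at key
  have key2 : H.charpoly * (Polynomial.X - 1) = Polynomial.X * (H + Q).charpoly := by
    have hX : (Polynomial.X : Polynomial ℝ) ^ n ≠ 0 := pow_ne_zero _ Polynomial.X_ne_zero
    apply mul_left_cancel₀ hX
    linear_combination key
  have c0 := congrArg (fun p => Polynomial.coeff p 0) key2
  have c1 := congrArg (fun p => Polynomial.coeff p 1) key2
  simp only [mul_sub, mul_one, Polynomial.coeff_sub, Polynomial.mul_coeff_zero,
    Polynomial.coeff_X_zero, mul_zero, zero_mul] at c0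
  rw [mul_sub, mul_one, Polynomial.coeff_sub, Polynomial.coeff_mul_X, Polynomial.coeff_X_mul] at c1
  rw [Matrix.det_eq_sign_charpoly_coeff, Fintype.card_fin]
  rw [← c1, pow_succ]
  linear_combination -(-1:ℝ)^n * c0

lemma det_le_exp_trace {ι : Type*} [Fintype ι] [DecidableEq ι] (M : Matrix ι ι ℝ)
    (hM : M.PosDef) : M.det ≤ Real.exp (M.trace - Fintype.card ι) := by
  have h1 := hM.isHermitian.det_eq_prod_eigenvalues
  have h2 := hM.isHermitian.trace_eq_sum_eigenvalues
  simp only [RCLike.ofReal_real_eq_id, id] at h1 h2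
  rw [h1, h2]
  have : (∑ i, hM.isHermitian.eigenvalues i) - (Fintype.card ι : ℝ)
      = ∑ i, (hM.isHermitian.eigenvalues i - 1) := by
    simp [Finset.sum_sub_distrib]
  rw [this, Real.exp_sum]
  apply Finset.prod_le_prod
  · intro i _; exact (hM.eigenvalues_pos i).le
  · intro i _
    have := Real.add_one_le_exp (hM.isHermitian.eigenvalues i - 1)
    linarith

/-- Determinant comparison. -/
lemma det_compare {E : Type*} [NormedAddCommGroup E] [InnerProductSpace ℝ E]
    [FiniteDimensional ℝ E] (m : ℕ) (hm : Module.finrank ℝ E = m) (f g : E →ₗ[ℝ] E)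
    (hf : f.IsSymmetric) (hg : g.IsSymmetric) (hfp : ∀ v, v ≠ 0 → 0 < ⟪f v, v⟫)
    (hgp : ∀ v, v ≠ 0 → 0 < ⟪g v, v⟫) (R : E ≃ₗᵢ[ℝ] E) :
    ∃ b : OrthonormalBasis (Fin m) ℝ E,
      LinearMap.det f ≤ LinearMap.det g * Real.exp (∑ i,
        (⟪f (b i), b i⟫ - ⟪g (R (b i)), R (b i)⟫) / ⟪g (R (b i)), R (b i)⟫) ∧
      0 < LinearMap.det g := by
  set c := hg.eigenvectorBasis hm with hc
  set β := hg.eigenvalues hm with hβ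
  have hgc : ∀ i, g (c i) = β i • c i := fun i => hg.apply_eigenvectorBasis hm i
  have hgcc : ∀ i, ⟪g (c i), c i⟫ = β i := by
    intro i
    rw [hgc, inner_smul_left, real_inner_self_eq_norm_sq, c.norm_eq_one]; simp
  have hβp : ∀ i, 0 < β i := by
    intro i
    rw [← hgcc i]
    exact hgp _ (c.orthonormal.ne_zero i)
  have hdetg : LinearMap.det g = ∏ i, β i := by
    have := hg.det_eq_prod_eigenvalues hm
    simpa using this
  set b := c.map R.symm with hb
  have hRb : ∀ i, R (b i) = c i := by intro i; simp [hb]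
  refine ⟨b, ?_, by rw [hdetg]; exact Finset.prod_pos fun i _ => hβp i⟩
  simp only [hRb, hgcc]
  set N : Matrix (Fin m) (Fin m) ℝ := LinearMap.toMatrix b.toBasis b.toBasis f with hN
  have hNij : ∀ i j, N i j = ⟪b i, f (b j)⟫ := by
    intro i j
    rw [hN, LinearMap.toMatrix_apply]
    simp [OrthonormalBasis.repr_apply_apply]
  have hdetN : N.det = LinearMap.det f := LinearMap.det_toMatrix _ _
  set d : Fin m → ℝ := fun i => (Real.sqrt (β i))⁻¹ with hd
  have hdp : ∀ i, 0 < d i := fun i => inv_pos.2 (Real.sqrt_pos.2 (hβp i))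
  have hd2 : ∀ i, d i * d i = (β i)⁻¹ := by
    intro i; simp only [hd]; rw [← mul_inv, Real.mul_self_sqrt (hβp i).le]
  set M : Matrix (Fin m) (Fin m) ℝ := Matrix.diagonal d * N * Matrix.diagonal d with hM
  have hMij : ∀ i j, M i j = d i * ⟪b i, f (b j)⟫ * d j := by
    intro i j
    rw [hM, Matrix.mul_diagonal, Matrix.diagonal_mul, hNij]
  have hMpd : M.PosDef := by
    refine Matrix.PosDef.of_dotProduct_mulVec_pos ?_ ?_
    · ext i j
      simp only [Matrix.conjTranspose_apply, hMij, star_trivial]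
      rw [real_inner_comm, hf]; ring
    · intro x hx
      set v : E := ∑ i, (x i * d i) • b i with hv
      have hv0 : v ≠ 0 := by
        intro h0
        apply hx
        ext i
        have := congrArg (fun u => ⟪b i, u⟫) h0
        simp only [hv] at this
        rw [b.orthonormal.inner_right_fintype] at this
        simp only [inner_zero_right, mul_eq_zero] at this
        rcases this with h | h
        · exact h
        · exact absurd h (hdp i).ne'
      have := hfp v hv0
      have e : star x ⬝ᵥ M.mulVec x = ⟪f v, v⟫ := by
        rw [hf]
        simp only [hv, map_sum, map_smul, sum_inner, inner_sum, inner_smul_left, inner_smul_right,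
          dotProduct, Matrix.mulVec, hMij, star_trivial, Pi.star_apply, Finset.mul_sum]
        refine Finset.sum_congr rfl fun i _ => Finset.sum_congr rfl fun j _ => ?_
        simp only [RCLike.conj_to_real]
        rw [← hf (b j) (b i), real_inner_comm (b i) (f (b j))]; ring
      rw [e]; exact this
  have hdetM : M.det = LinearMap.det f * (∏ i, β i)⁻¹ := by
    rw [hM, Matrix.det_mul, Matrix.det_mul, Matrix.det_diagonal, hdetN, mul_comm, ← mul_assoc,
      ← Finset.prod_mul_distrib, ← Finset.prod_inv_distrib, mul_comm]
    congr 1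
    exact Finset.prod_congr rfl fun i _ => hd2 i
  have htr : M.trace - Fintype.card (Fin m) = ∑ i, (⟪f (b i), b i⟫ - β i) / β i := by
    rw [Matrix.trace]
    have : (Fintype.card (Fin m) : ℝ) = ∑ i : Fin m, (1:ℝ) := by simp
    rw [this, ← Finset.sum_sub_distrib]
    refine Finset.sum_congr rfl fun i _ => ?_
    rw [Matrix.diag_apply, hMij, sub_div, div_self (hβp i).ne', hf, div_eq_mul_inv, ← hd2]; ring
  have := det_le_exp_trace M hMpd
  rw [htr, hdetM] at this
  have hP : 0 < ∏ i, β i := Finset.prod_pos fun i _ => hβp i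
  rw [hdetg]
  rw [← div_eq_mul_inv, div_le_iff₀ hP] at this
  linarith

/-! ### Basic facts on the support function -/

/-- The standing assumptions on the support function. -/
structure HData (n : ℕ) (h : Esp n → ℝ) : Prop where
  sm : ContDiffOn ℝ (⊤ : ℕ∞) h {(0 : Esp n)}ᶜ
  hom : PosHom n h
  conv : ∀ x ∈ sphere (0 : Esp n) 1, ∀ v : Esp n,
      ⟪v, x⟫ = 0 → v ≠ 0 → 0 < hessForm n h x v v
  pos : ∀ x ∈ sphere (0 : Esp n) 1, 0 < h x

/-- The second derivative as a continuous bilinear map. -/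
def D2 (n : ℕ) (h : Esp n → ℝ) (x : Esp n) : Esp n →L[ℝ] Esp n →L[ℝ] ℝ :=
  fderiv ℝ (fderiv ℝ h) x

lemma ne_zero_of_unit {n : ℕ} {x : Esp n} (hx : ‖x‖ = 1) : x ≠ 0 := by
  rintro rfl; simp at hx

namespace HData

variable {n : ℕ} {h : Esp n → ℝ}

lemma cda (H : HData n h) {x : Esp n} (hx : x ≠ 0) : ContDiffAt ℝ (⊤ : ℕ∞) h x :=
  H.sm.contDiffAt (isOpen_compl_singleton.mem_nhds hx)

lemma diff (H : HData n h) {x : Esp n} (hx : x ≠ 0) : HasFDerivAt h (fderiv ℝ h x) x :=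
  ((H.cda hx).differentiableAt (by simp)).hasFDerivAt

lemma cdaf (H : HData n h) {x : Esp n} (hx : x ≠ 0) : ContDiffAt ℝ 1 (fderiv ℝ h) x :=
  (H.cda hx).fderiv_right (m := 1) (by norm_cast)

lemma difff (H : HData n h) {x : Esp n} (hx : x ≠ 0) :
    HasFDerivAt (fderiv ℝ h) (D2 n h x) x :=
  ((H.cdaf hx).differentiableAt (by simp)).hasFDerivAt

lemma contAt (H : HData n h) {x : Esp n} (hx : x ≠ 0) : ContinuousAt h x :=
  (H.diff hx).continuousAt

lemma contAtf (H : HData n h) {x : Esp n} (hx : x ≠ 0) : ContinuousAt (fderiv ℝ h) x :=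
  (H.difff hx).continuousAt

lemma contAt2 (H : HData n h) {x : Esp n} (hx : x ≠ 0) : ContinuousAt (D2 n h) x :=
  ((H.cdaf hx).fderiv_right (m := 0) (by norm_num)).continuousAt

lemma hess_eq (H : HData n h) {x : Esp n} (hx : x ≠ 0) (v w : Esp n) :
    hessForm n h x v w = D2 n h x v w := by
  unfold hessForm
  have := ((H.difff hx).clm_apply (hasFDerivAt_const w x)).fderiv
  rw [this]; simp

lemma symm2 (H : HData n h) {x : Esp n} (hx : x ≠ 0) (v w : Esp n) :
    D2 n h x v w = D2 n h x w v := by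
  have := (H.cda hx).isSymmSndFDerivAt (by simp [minSmoothness]; norm_cast)
  exact this v w

lemma euler (H : HData n h) {x : Esp n} (hx : x ≠ 0) : fderiv ℝ h x x = h x := by
  have h1 : HasDerivAt (fun r : ℝ => r • x) x 1 := by
    simpa using (hasDerivAt_id (1:ℝ)).smul_const x
  have h2 : HasDerivAt (fun r : ℝ => h (r • x)) (fderiv ℝ h x x) 1 := by
    have := (H.diff (x := (1:ℝ) • x) (by simpa using hx)).comp_hasDerivAt (1:ℝ) h1
    simpa [Function.comp_def] using this
  have h3 : HasDerivAt (fun r : ℝ => r * h x) (h x) 1 := by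
    simpa using (hasDerivAt_id (1:ℝ)).mul_const (h x)
  have h4 : (fun r : ℝ => h (r • x)) =ᶠ[nhds 1] (fun r : ℝ => r * h x) := by
    filter_upwards [lt_mem_nhds (zero_lt_one' ℝ)] with r hr using H.hom r hr x
  exact h2.unique (h3.congr_of_eventuallyEq h4)

lemma radial (H : HData n h) {x : Esp n} (hx : x ≠ 0) (v : Esp n) : D2 n h x v x = 0 := by
  have h1 := (H.difff hx).clm_apply (hasFDerivAt_id x)
  have h2 : (fun y => fderiv ℝ h y (id y)) =ᶠ[nhds x] h := by
    filter_upwards [isOpen_compl_singleton.mem_nhds hx] with y hy using H.euler hy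
  have h3 := (H.diff hx).congr_of_eventuallyEq h2
  have := congrArg (fun L => L v) (h1.unique h3)
  simpa using this

lemma radial' (H : HData n h) {x : Esp n} (hx : x ≠ 0) (v : Esp n) : D2 n h x x v = 0 := by
  rw [H.symm2 hx, H.radial hx]

lemma inner_sphGrad (H : HData n h) {x : Esp n} (v : Esp n) :
    ⟪sphGrad n h x, v⟫ = fderiv ℝ h x v - h x * ⟪x, v⟫ := by
  unfold sphGrad gradient
  rw [inner_sub_left, inner_smul_left, InnerProductSpace.toDual_symm_apply]; simp

lemma sphGrad_perp (H : HData n h) {x : Esp n} (hx : ‖x‖ = 1) : ⟪sphGrad n h x, x⟫ = 0 := by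
  rw [H.inner_sphGrad, H.euler (ne_zero_of_unit hx), real_inner_self_eq_norm_sq, hx]; ring

lemma contAt_sphGrad (H : HData n h) {x : Esp n} (hx : x ≠ 0) : ContinuousAt (sphGrad n h) x := by
  unfold sphGrad gradient
  have h1 := (InnerProductSpace.toDual ℝ (Esp n)).symm.continuous.continuousAt.comp (H.contAtf hx)
  exact h1.sub ((H.contAt hx).smul continuousAt_id)

/-- First-order norm lemma. -/
lemma norm_grad (H : HData n h) {x y : Esp n} (hx : ‖x‖ = 1) (hy : ‖y‖ = 1) (κ : ℝ)
    (hD : ∀ v, ‖v‖ = 1 → ⟪v, x⟫ = 0 → fderiv ℝ h x v = κ * ⟪v, y⟫) :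
    ‖sphGrad n h x‖ = |κ| * Real.sqrt (1 - ⟪x, y⟫ ^ 2) := by
  have hD' : ∀ v, ⟪v, x⟫ = 0 → fderiv ℝ h x v = κ * ⟪v, y⟫ := by
    intro v hv
    by_cases h0 : v = 0
    · simp [h0]
    have hn : ‖v‖ ≠ 0 := norm_ne_zero_iff.2 h0
    have := hD (‖v‖⁻¹ • v) (by rw [norm_smul, norm_inv, norm_norm, inv_mul_cancel₀ hn])
      (by rw [inner_smul_left, hv]; simp)
    rw [map_smul, inner_smul_left] at this
    simp only [smul_eq_mul, RCLike.conj_to_real] at this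
    have h3 : ‖v‖⁻¹ ≠ 0 := inv_ne_zero hn
    apply mul_left_cancel₀ h3
    linarith
  have hxx : ⟪x, x⟫ = 1 := by rw [real_inner_self_eq_norm_sq, hx]; norm_num
  have hyy : ⟪y, y⟫ = 1 := by rw [real_inner_self_eq_norm_sq, hy]; norm_num
  have e : sphGrad n h x = κ • (y - ⟪x, y⟫ • x) := by
    apply ext_inner_right ℝ
    intro v
    rw [H.inner_sphGrad]
    have h1 : ⟪v - ⟪x, v⟫ • x, x⟫ = 0 := by
      rw [inner_sub_left, inner_smul_left, hxx, real_inner_comm]; simp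
    have h2 := hD' _ h1
    rw [map_sub, map_smul, H.euler (ne_zero_of_unit hx), inner_sub_left, inner_smul_left] at h2
    rw [inner_smul_left, inner_sub_left, inner_smul_left]
    simp only [smul_eq_mul, RCLike.conj_to_real] at h2 ⊢
    rw [real_inner_comm y v] at h2
    linarith
  have e2 : ‖y - ⟪x, y⟫ • x‖ ^ 2 = 1 - ⟪x, y⟫ ^ 2 := by
    rw [← real_inner_self_eq_norm_sq, inner_sub_left, inner_sub_right, inner_sub_right,
      inner_smul_left, inner_smul_right, inner_smul_left, inner_smul_right, hxx, hyy,
      real_inner_comm x y]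
    simp; ring
  rw [e, norm_smul, Real.norm_eq_abs, ← e2, Real.sqrt_sq (norm_nonneg _)]

end HData

/-! ### Determinant comparison for the Hessians -/

/-- The full-rank quadratic form attached to the Hessian. -/
def qf (n : ℕ) (h : Esp n → ℝ) (x v : Esp n) : ℝ := D2 n h x v v + ⟪v, x⟫ ^ 2

namespace HData

variable {n : ℕ} {h : Esp n → ℝ}

lemma D2_proj (H : HData n h) {x : Esp n} (hx : x ≠ 0) (v : Esp n) (a : ℝ) :
    D2 n h x (v - a • x) (v - a • x) = D2 n h x v v := by
  simp [H.radial hx, H.radial' hx]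

lemma qf_pos (H : HData n h) {x : Esp n} (hx : ‖x‖ = 1) {v : Esp n} (hv : v ≠ 0) :
    0 < qf n h x v := by
  have hx0 := ne_zero_of_unit hx
  unfold qf
  have hxx : ⟪x, x⟫ = 1 := by rw [real_inner_self_eq_norm_sq, hx]; norm_num
  rw [← H.D2_proj hx0 v ⟪v, x⟫]
  by_cases h0 : v - ⟪v, x⟫ • x = 0
  · rw [h0]
    have : ⟪v, x⟫ ≠ 0 := by
      intro h1; rw [h1] at h0; apply hv; simpa using h0
    simp only [map_zero, zero_add]
    positivity
  · have h1 : ⟪v - ⟪v, x⟫ • x, x⟫ = 0 := by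
      rw [inner_sub_left, inner_smul_left, hxx]; simp
    have := H.conv x (by simpa using hx) _ h1 h0
    rw [H.hess_eq hx0] at this
    positivity

lemma qf_smul (x v : Esp n) (a : ℝ) : qf n h x (a • v) = a ^ 2 * qf n h x v := by
  unfold qf
  rw [map_smul, map_smul, inner_smul_left]
  simp; ring

lemma cont_qf (H : HData n h) :
    ContinuousOn (fun p : Esp n × Esp n => qf n h p.1 p.2)
      (sphere (0 : Esp n) 1 ×ˢ sphere (0 : Esp n) 1) := by
  intro p hp
  have hx : p.1 ≠ 0 := ne_zero_of_unit (by simpa using hp.1)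
  apply ContinuousAt.continuousWithinAt
  have h1 : ContinuousAt (fun p : Esp n × Esp n => D2 n h p.1) p :=
    (H.contAt2 hx).comp (f := Prod.fst) continuousAt_fst
  unfold qf
  have h2 : ContinuousAt (fun p : Esp n × Esp n => p.2) p := continuousAt_snd
  exact ((h1.clm_apply h2).clm_apply h2).add ((continuousAt_snd.inner continuousAt_fst).pow 2)

lemma exists_unit (n : ℕ) : ∃ x : Esp n, ‖x‖ = 1 := by
  exact ⟨EuclideanSpace.single 0 1, by simp⟩

lemma exists_bounds (H : HData n h) : ∃ l L : ℝ, 0 < l ∧ 0 < L ∧ ∀ x v : Esp n, ‖x‖ = 1 → ‖v‖ = 1 →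
    l ≤ qf n h x v ∧ qf n h x v ≤ L := by
  have hK : IsCompact (sphere (0 : Esp n) 1 ×ˢ sphere (0 : Esp n) 1) :=
    (isCompact_sphere 0 1).prod (isCompact_sphere 0 1)
  obtain ⟨x0, hx0⟩ := exists_unit n
  have hne : (sphere (0 : Esp n) 1 ×ˢ sphere (0 : Esp n) 1).Nonempty :=
    ⟨(x0, x0), by simp [hx0], by simp [hx0]⟩
  obtain ⟨p, hp, hpm⟩ := hK.exists_isMinOn hne H.cont_qf
  obtain ⟨q, hq, hqm⟩ := hK.exists_isMaxOn hne H.cont_qf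
  have hposi : ∀ x v : Esp n, ‖x‖ = 1 → ‖v‖ = 1 → 0 < qf n h x v :=
    fun x v hx hv => H.qf_pos hx (ne_zero_of_unit hv)
  refine ⟨qf n h p.1 p.2, qf n h q.1 q.2, hposi _ _ (by simpa using hp.1) (by simpa using hp.2),
    hposi _ _ (by simpa using hq.1) (by simpa using hq.2), ?_⟩
  intro x v hx hv
  have hm : (x, v) ∈ sphere (0 : Esp n) 1 ×ˢ sphere (0 : Esp n) 1 :=
    ⟨by simpa using hx, by simpa using hv⟩
  exact ⟨hpm hm, hqm hm⟩

/-- The operator `D²h(x) + x xᵀ`. -/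
def opP (n : ℕ) (h : Esp n → ℝ) (x : Esp n) : Esp n →ₗ[ℝ] Esp n :=
  Matrix.toEuclideanLin (hessMatrix n h x + Matrix.vecMulVec (fun i => x i) (fun i => x i))

lemma inner_opP (H : HData n h) {x : Esp n} (hx : x ≠ 0) (v w : Esp n) :
    ⟪opP n h x v, w⟫ = D2 n h x v w + ⟪v, x⟫ * ⟪w, x⟫ := by
  have hv : ∀ v : Esp n, v = ∑ i, v i • EuclideanSpace.single i (1:ℝ) := by
    intro v
    have := (EuclideanSpace.basisFun (Fin (n+1)) ℝ).sum_repr v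
    simpa using this.symm
  have h1 : D2 n h x v w = ∑ i, ∑ j, v i * w j * hessMatrix n h x i j := by
    conv_lhs => rw [hv v, hv w]
    simp only [map_sum, map_smul, _root_.sum_apply, _root_.smul_apply,
      smul_eq_mul, hessMatrix, Matrix.of_apply, H.hess_eq hx, Finset.mul_sum]
    rw [Finset.sum_comm]
    refine Finset.sum_congr rfl fun i _ => Finset.sum_congr rfl fun j _ => ?_
    ring
  have hs : ∀ i j, hessMatrix n h x i j = hessMatrix n h x j i := by
    intro i j
    simp only [hessMatrix, Matrix.of_apply, H.hess_eq hx]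
    exact H.symm2 hx _ _
  rw [h1]
  simp only [opP, PiLp.inner_apply, Matrix.toLpLin_apply, Matrix.mulVec, dotProduct, Matrix.add_apply,
    Matrix.vecMulVec_apply, add_mul, Finset.sum_add_distrib]
  simp only [RCLike.inner_apply, conj_trivial, Finset.mul_sum, mul_add, Finset.sum_add_distrib, Finset.sum_mul]
  congr 1
  · rw [Finset.sum_comm]
    refine Finset.sum_congr rfl fun i _ => Finset.sum_congr rfl fun j _ => ?_
    rw [hs j i]; ring
  · refine Finset.sum_congr rfl fun i _ => Finset.sum_congr rfl fun j _ => ?_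
    ring

lemma det_opP (H : HData n h) {x : Esp n} (hx : ‖x‖ = 1) :
    LinearMap.det (opP n h x) = sigmaElem n n h x := by
  have hx0 := ne_zero_of_unit hx
  have e : LinearMap.det (opP n h x) =
      (hessMatrix n h x + Matrix.vecMulVec (fun i => x i) (fun i => x i)).det := by
    unfold opP Matrix.toEuclideanLin
    rw [Matrix.toLpLin_eq_toLin, LinearMap.det_toLin]
  rw [e, ← coeff_one_charpoly_aux]
  · unfold sigmaElem
    congr 2
    omega
  · have : ⟪x, x⟫ = 1 := by rw [real_inner_self_eq_norm_sq, hx]; norm_num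
    rw [PiLp.inner_apply] at this
    simpa [dotProduct, sq] using this
  · have h0 : ∀ w, ⟪opP n h x x, w⟫ = ⟪x, w⟫ := by
      intro w
      rw [H.inner_opP hx0, H.radial' hx0, real_inner_self_eq_norm_sq, hx, real_inner_comm]; simp
    have h1 : opP n h x x = x := ext_inner_right ℝ h0
    ext i
    have h2 := congrArg (fun v : Esp n => v i) h1
    have h3 : ∑ j, x j * x j = 1 := by
      have : ⟪x, x⟫ = 1 := by rw [real_inner_self_eq_norm_sq, hx]; norm_num
      rw [PiLp.inner_apply] at this
      simpa [sq] using this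
    simp only [opP, Matrix.toLpLin_apply, Matrix.add_mulVec, Matrix.mulVec, dotProduct,
      Matrix.vecMulVec_apply, Pi.add_apply] at h2
    simp only [mul_assoc, ← Finset.mul_sum, h3] at h2
    simp only [Matrix.mulVec, dotProduct, Pi.zero_apply]
    linarith

lemma compare (H : HData n h) {x y : Esp n} (hx : ‖x‖ = 1) (hy : ‖y‖ = 1)
    (R : Esp n ≃ₗᵢ[ℝ] Esp n) (hR : R x = y) (w : Esp n) {l L : ℝ} (hl : 0 < l)
    (hL : 0 < L) (hb : ∀ x v : Esp n, ‖x‖ = 1 → ‖v‖ = 1 → l ≤ qf n h x v ∧ qf n h x v ≤ L)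
    {K1 K2 : ℝ} (hK1 : 0 ≤ K1) (hK2 : 0 ≤ K2)
    (hAB : ∀ v, ‖v‖ = 1 → ⟪v, x⟫ = 0 →
      D2 n h x v v - D2 n h y (R v) (R v) ≤ K2 - K1 * ⟪v, w⟫ ^ 2) :
    sigmaElem n n h x ≤ sigmaElem n n h y *
      Real.exp (n * K2 / l - K1 * ‖w - ⟪w, x⟫ • x‖ ^ 2 / L) ∧ 0 < sigmaElem n n h y := by
  have hx0 := ne_zero_of_unit hx
  have hy0 := ne_zero_of_unit hy
  have hxx : ⟪x, x⟫ = 1 := by rw [real_inner_self_eq_norm_sq, hx]; norm_num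
  have hAB' : ∀ v, ⟪v, x⟫ = 0 →
      D2 n h x v v - D2 n h y (R v) (R v) ≤ K2 * ‖v‖ ^ 2 - K1 * ⟪v, w⟫ ^ 2 := by
    intro v hv
    by_cases h0 : v = 0
    · simp [h0]
    have hn : ‖v‖ ≠ 0 := norm_ne_zero_iff.2 h0
    have := hAB (‖v‖⁻¹ • v) (by rw [norm_smul, norm_inv, norm_norm, inv_mul_cancel₀ hn])
      (by rw [inner_smul_left, hv]; simp)
    simp only [map_smul, inner_smul_left, smul_eq_mul, RCLike.conj_to_real,
      _root_.smul_apply] at this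
    have h2 := mul_le_mul_of_nonneg_left this (sq_nonneg ‖v‖)
    have h3 : ‖v‖ * ‖v‖⁻¹ = 1 := mul_inv_cancel₀ hn
    have e1 : ‖v‖ ^ 2 * (‖v‖⁻¹ * (‖v‖⁻¹ * D2 n h x v v) - ‖v‖⁻¹ * (‖v‖⁻¹ * D2 n h y (R v) (R v)))
      = (‖v‖ * ‖v‖⁻¹) ^ 2 * (D2 n h x v v - D2 n h y (R v) (R v)) := by ring
    have e2 : ‖v‖ ^ 2 * (K2 - K1 * (‖v‖⁻¹ * ⟪v, w⟫) ^ 2)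
      = K2 * ‖v‖ ^ 2 - (‖v‖ * ‖v‖⁻¹) ^ 2 * (K1 * ⟪v, w⟫ ^ 2) := by ring
    rw [e1, e2, h3] at h2
    linarith
  have sym : ∀ {z : Esp n}, z ≠ 0 → (opP n h z).IsSymmetric := by
    intro z hz v u
    rw [H.inner_opP hz, real_inner_comm (opP n h z u) v, H.inner_opP hz, H.symm2 hz]; ring
  have hq : ∀ {z : Esp n}, z ≠ 0 → ∀ v, ⟪opP n h z v, v⟫ = qf n h z v := by
    intro z hz v
    rw [H.inner_opP hz, qf]; ring
  obtain ⟨b, hb1, hb2⟩ := det_compare (n + 1) (by simp) (opP n h x) (opP n h y)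
    (sym hx0) (sym hy0) (fun v hv => by rw [hq hx0]; exact H.qf_pos hx hv)
    (fun v hv => by rw [hq hy0]; exact H.qf_pos hy hv) R
  rw [H.det_opP hx, H.det_opP hy] at hb1
  rw [H.det_opP hy] at hb2
  refine ⟨hb1.trans ?_, hb2⟩
  apply mul_le_mul_of_nonneg_left _ hb2.le
  apply Real.exp_le_exp.2
  simp only [hq hx0, hq hy0]
  set w' := w - ⟪w, x⟫ • x with hw'
  have term : ∀ i, (qf n h x (b i) - qf n h y (R (b i))) / qf n h y (R (b i)) ≤
      K2 * (1 - ⟪b i, x⟫ ^ 2) / l - K1 * ⟪b i, w'⟫ ^ 2 / L := by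
    intro i
    have hbi : ‖b i‖ = 1 := b.norm_eq_one i
    obtain ⟨h1, h2⟩ := hb y (R (b i)) hy (by simp [hbi])
    have hβ : 0 < qf n h y (R (b i)) := hl.trans_le h1
    have e1 : qf n h x (b i) - qf n h y (R (b i)) =
        D2 n h x (b i - ⟪b i, x⟫ • x) (b i - ⟪b i, x⟫ • x)
        - D2 n h y (R (b i - ⟪b i, x⟫ • x)) (R (b i - ⟪b i, x⟫ • x)) := by
      unfold qf
      rw [map_sub R, map_smul R, hR, H.D2_proj hx0, H.D2_proj hy0]
      have : ⟪R (b i), y⟫ = ⟪b i, x⟫ := by rw [← hR, LinearIsometryEquiv.inner_map_map]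
      rw [this]; ring
    have e2 := hAB' (b i - ⟪b i, x⟫ • x) (by rw [inner_sub_left, inner_smul_left, hxx]; simp)
    have e3 : ‖b i - ⟪b i, x⟫ • x‖ ^ 2 = 1 - ⟪b i, x⟫ ^ 2 := by
      rw [norm_sub_sq_real, norm_smul, hbi, inner_smul_right, hx, Real.norm_eq_abs, mul_one, sq_abs]
      ring
    have e4 : ⟪b i - ⟪b i, x⟫ • x, w⟫ = ⟪b i, w'⟫ := by
      rw [hw', inner_sub_left, inner_sub_right, inner_smul_left, inner_smul_right,
        real_inner_comm x w]; simp; ring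
    rw [e3, e4, ← e1] at e2
    have hs : 0 ≤ 1 - ⟪b i, x⟫ ^ 2 := by rw [← e3]; positivity
    calc (qf n h x (b i) - qf n h y (R (b i))) / qf n h y (R (b i))
        ≤ (K2 * (1 - ⟪b i, x⟫ ^ 2) - K1 * ⟪b i, w'⟫ ^ 2) / qf n h y (R (b i)) := by gcongr
      _ = K2 * (1 - ⟪b i, x⟫ ^ 2) / qf n h y (R (b i)) - K1 * ⟪b i, w'⟫ ^ 2 / qf n h y (R (b i)) := sub_div _ _ _
      _ ≤ _ := by gcongr
  refine (Finset.sum_le_sum fun i _ => term i).trans ?_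
  rw [Finset.sum_sub_distrib, ← Finset.sum_div, ← Finset.sum_div, ← Finset.mul_sum,
    ← Finset.mul_sum, Finset.sum_sub_distrib]
  have s1 : ∑ i, ⟪b i, x⟫ ^ 2 = 1 := by
    have := b.sum_sq_norm_inner_right x
    simpa [hx] using this
  have s2 : ∑ i, ⟪b i, w'⟫ ^ 2 = ‖w'‖ ^ 2 := by
    have := b.sum_sq_norm_inner_right w'
    simpa using this
  rw [s1, s2]
  simp only [Finset.sum_const, Finset.card_univ, Fintype.card_fin, nsmul_eq_mul]
  push_cast
  apply le_of_eq
  ring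

end HData

/-! ### Second order jets -/

/-- `f` has value `a`, first derivative `b` and second derivative `c` at `0`. -/
def Jet2 (f : ℝ → ℝ) (a b c : ℝ) : Prop :=
  f 0 = a ∧ ∃ f1 : ℝ → ℝ, (∀ᶠ s in nhds 0, HasDerivAt f (f1 s) s) ∧ f1 0 = b ∧ HasDerivAt f1 c 0

namespace Jet2

variable {f g : ℝ → ℝ} {a b c a' b' c' : ℝ}

lemma hasDerivAt (hf : Jet2 f a b c) : HasDerivAt f b 0 := by
  obtain ⟨-, f1, h1, h2, -⟩ := hf
  rw [← h2]; exact h1.self_of_nhds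

lemma const (k : ℝ) : Jet2 (fun _ => k) k 0 0 :=
  ⟨rfl, fun _ => 0, Filter.Eventually.of_forall fun s => hasDerivAt_const s k, rfl,
    hasDerivAt_const 0 0⟩

lemma sin : Jet2 Real.sin 0 1 0 :=
  ⟨Real.sin_zero, Real.cos, Filter.Eventually.of_forall fun s => Real.hasDerivAt_sin s,
    Real.cos_zero, by simpa using Real.hasDerivAt_cos 0⟩

lemma cos : Jet2 Real.cos 1 0 (-1) :=
  ⟨Real.cos_zero, fun s => -Real.sin s, Filter.Eventually.of_forall fun s => Real.hasDerivAt_cos s,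
    by simp, (Real.hasDerivAt_sin 0).fun_neg.congr_deriv (by simp)⟩

lemma add (hf : Jet2 f a b c) (hg : Jet2 g a' b' c') :
    Jet2 (fun s => f s + g s) (a + a') (b + b') (c + c') := by
  obtain ⟨h0, f1, h1, h2, h3⟩ := hf
  obtain ⟨k0, g1, k1, k2, k3⟩ := hg
  refine ⟨by simp [h0, k0], fun s => f1 s + g1 s, ?_, by simp [h2, k2], h3.add k3⟩
  filter_upwards [h1, k1] with s hs ks using hs.add ks

lemma mul (hf : Jet2 f a b c) (hg : Jet2 g a' b' c') :
    Jet2 (fun s => f s * g s) (a * a') (b * a' + a * b') (c * a' + 2 * (b * b') + a * c') := by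
  have df := hf.hasDerivAt
  have dg := hg.hasDerivAt
  obtain ⟨h0, f1, h1, h2, h3⟩ := hf
  obtain ⟨k0, g1, k1, k2, k3⟩ := hg
  refine ⟨by simp [h0, k0], fun s => f1 s * g s + f s * g1 s, ?_, by simp [h0, k0, h2, k2], ?_⟩
  · filter_upwards [h1, k1] with s hs ks using hs.mul ks
  · have := (h3.mul dg).add (df.mul k3)
    rw [h0, k0, h2, k2] at this
    exact this.congr_deriv (by ring)

lemma smul (k : ℝ) (hf : Jet2 f a b c) : Jet2 (fun s => k * f s) (k * a) (k * b) (k * c) := by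
  have := (const k).mul hf
  simpa using this

lemma sub (hf : Jet2 f a b c) (hg : Jet2 g a' b' c') :
    Jet2 (fun s => f s - g s) (a - a') (b - b') (c - c') := by
  have := hf.add (hg.smul (-1))
  simpa [← sub_eq_add_neg] using this

lemma exp (hf : Jet2 f a b c) :
    Jet2 (fun s => Real.exp (f s)) (Real.exp a) (Real.exp a * b)
      (Real.exp a * (b * b) + Real.exp a * c) := by
  have df := hf.hasDerivAt
  obtain ⟨h0, f1, h1, h2, h3⟩ := hf
  refine ⟨by simp [h0], fun s => Real.exp (f s) * f1 s, ?_, by simp [h0, h2], ?_⟩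
  · filter_upwards [h1] with s hs using hs.exp
  · have := df.exp.mul h3
    rw [h0, h2] at this
    exact this.congr_deriv (by ring)

lemma comp_mul (k : ℝ) (hf : Jet2 f a b c) :
    Jet2 (fun s => f (k * s)) a (k * b) (k ^ 2 * c) := by
  obtain ⟨h0, f1, h1, h2, h3⟩ := hf
  have hk : ∀ s : ℝ, HasDerivAt (fun s : ℝ => k * s) k s := fun s => by
    simpa using (hasDerivAt_id s).const_mul k
  refine ⟨by simp [h0], fun s => k * f1 (k * s), ?_, by simp [h2], ?_⟩
  · have ht : Filter.Tendsto (fun s : ℝ => k * s) (nhds 0) (nhds 0) := by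
      have := (hk 0).continuousAt.tendsto; simpa using this
    filter_upwards [ht.eventually h1] with s hs
    have := hs.comp s (hk s)
    simpa [mul_comm, Function.comp_def] using this
  · have h3' : HasDerivAt f1 c (k * 0) := by simpa using h3
    have := (h3'.comp 0 (hk 0)).const_mul k
    exact this.congr_deriv (by ring)

lemma congr (hf : Jet2 f a b c) (h : ∀ s, f s = g s) (ha : a = a') (hb : b = b') (hc : c = c') :
    Jet2 g a' b' c' := by
  have : f = g := funext h
  subst this ha hb hc
  exact hf

lemma id : Jet2 (fun s => s) 0 1 0 :=
  ⟨rfl, fun _ => 1, Filter.Eventually.of_forall fun s => hasDerivAt_id s, rfl,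
    hasDerivAt_const 0 1⟩

lemma gt (hf : Jet2 f a 0 c) (hc : 0 < c) : ∀ᶠ s in nhdsWithin 0 (Set.Ioi 0), a < f s := by
  obtain ⟨h0, f1, h1, h2, h3⟩ := hf
  rw [hasDerivAt_iff_tendsto_slope] at h3
  have h4 := h3.eventually (lt_mem_nhds hc)
  have h5 : ∀ᶠ s in nhdsWithin 0 (Set.Ioi 0), 0 < f1 s := by
    have : ∀ᶠ s in nhdsWithin (0:ℝ) (Set.Ioi 0), 0 < slope f1 0 s :=
      h4.filter_mono (nhdsWithin_mono _ (fun s (hs : 0 < s) => hs.ne'))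
    filter_upwards [this, self_mem_nhdsWithin] with s hs hs0
    rw [slope_def_field, h2, sub_zero, sub_zero] at hs
    have hs0' : (0:ℝ) < s := hs0
    have := mul_pos hs hs0'
    rwa [div_mul_cancel₀ _ hs0'.ne'] at this
  rw [Filter.Eventually, Metric.mem_nhdsWithin_iff] at h5
  rw [Metric.eventually_nhds_iff] at h1
  obtain ⟨δ, hδ, h5⟩ := h5
  obtain ⟨δ', hδ', h1⟩ := h1
  have : Set.Ioo (0:ℝ) (min δ δ') ∈ nhdsWithin 0 (Set.Ioi 0) :=
    Ioo_mem_nhdsGT (lt_min hδ hδ')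
  filter_upwards [this] with s hs
  have hd : ∀ u ∈ Set.Icc 0 s, HasDerivAt f (f1 u) u := by
    intro u hu
    apply h1
    rw [Real.dist_eq, sub_zero, abs_of_nonneg hu.1]
    exact hu.2.trans_lt (hs.2.trans_le (min_le_right _ _))
  obtain ⟨u, hu, he⟩ := exists_hasDerivAt_eq_slope f f1 hs.1
    (fun u hu => (hd u hu).continuousAt.continuousWithinAt)
    (fun u hu => hd u ⟨hu.1.le, hu.2.le⟩)
  have hp : 0 < f1 u := by
    apply h5
    refine ⟨?_, hu.1⟩
    rw [mem_ball, Real.dist_eq, sub_zero, abs_of_nonneg hu.1.le]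
    exact hu.2.trans (hs.2.trans_le (min_le_left _ _))
  rw [he, h0, sub_zero] at hp
  have := mul_pos hp hs.1
  rw [div_mul_cancel₀ _ hs.1.ne'] at this
  linarith

lemma max (hf : Jet2 f a b c) (hm : ∀ᶠ s in nhds 0, f s ≤ a) : b = 0 ∧ c ≤ 0 := by
  have hb : b = 0 := by
    have : IsLocalMax f 0 := by
      filter_upwards [hm] with s hs
      rw [hf.1]; exact hs
    exact this.hasDerivAt_eq_zero hf.hasDerivAt
  refine ⟨hb, ?_⟩
  by_contra hc
  push Not at hc
  subst hb
  have h1 := hf.gt hc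
  have h2 : ∀ᶠ s in nhdsWithin (0:ℝ) (Set.Ioi 0), f s ≤ a := hm.filter_mono nhdsWithin_le_nhds
  obtain ⟨s, hs, hs'⟩ := (h1.and h2).exists
  linarith

end Jet2

/-! ### Great circles -/

/-- The great circle through `x` in direction `v`. -/
def circ {n : ℕ} (x v : Esp n) (s : ℝ) : Esp n := Real.cos s • x + Real.sin s • v

lemma circ_zero {n : ℕ} (x v : Esp n) : circ x v 0 = x := by simp [circ]

lemma hasDerivAt_circ {n : ℕ} (x v : Esp n) (s : ℝ) :
    HasDerivAt (circ x v) (circ v (-x) s) s := by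
  have := ((Real.hasDerivAt_cos s).smul_const x).add ((Real.hasDerivAt_sin s).smul_const v)
  refine HasDerivAt.congr_deriv this ?_
  unfold circ; rw [smul_neg, neg_smul]; abel

lemma cont_circ {n : ℕ} (x v : Esp n) : Continuous (circ x v) :=
  continuous_iff_continuousAt.2 fun s => (hasDerivAt_circ x v s).continuousAt

lemma norm_circ {n : ℕ} {x v : Esp n} (hx : ‖x‖ = 1) (hv : ‖v‖ = 1) (h : ⟪v, x⟫ = 0) (s : ℝ) :
    ‖circ x v s‖ = 1 := by
  have : ‖circ x v s‖ ^ 2 = 1 := by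
    unfold circ
    rw [norm_add_sq_real, norm_smul, norm_smul, inner_smul_left, inner_smul_right,
      real_inner_comm, h, hx, hv, mul_one, mul_one, Real.norm_eq_abs, Real.norm_eq_abs,
      sq_abs, sq_abs]
    simp
  nlinarith [norm_nonneg (circ x v s)]

lemma inner_circ {n : ℕ} (x v a : Esp n) (s : ℝ) :
    ⟪circ x v s, a⟫ = ⟪x, a⟫ * Real.cos s + ⟪v, a⟫ * Real.sin s := by
  unfold circ; rw [inner_add_left, inner_smul_left, inner_smul_left]; simp; ring

lemma jet_inner_circ {n : ℕ} (x v a : Esp n) :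
    Jet2 (fun s => ⟪circ x v s, a⟫) ⟪x, a⟫ ⟪v, a⟫ (-⟪x, a⟫) :=
  ((Jet2.cos.smul ⟪x, a⟫).add (Jet2.sin.smul ⟪v, a⟫)).congr (fun s => (inner_circ x v a s).symm)
    (by ring) (by ring) (by ring)

lemma HData.jet_circ {n : ℕ} {h : Esp n → ℝ} (H : HData n h) {x v : Esp n} (hx : ‖x‖ = 1)
    (hv : ‖v‖ = 1) (hxv : ⟪v, x⟫ = 0) :
    Jet2 (fun s => h (circ x v s)) (h x) (fderiv ℝ h x v) (D2 n h x v v - h x) := by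
  have hne : ∀ s, circ x v s ≠ 0 := fun s => ne_zero_of_unit (norm_circ hx hv hxv s)
  refine ⟨by simp only [circ_zero], fun s => fderiv ℝ h (circ x v s) (circ v (-x) s), ?_,
    by simp only [circ_zero], ?_⟩
  · exact Filter.Eventually.of_forall fun s =>
      (H.diff (hne s)).comp_hasDerivAt s (hasDerivAt_circ x v s)
  · have h1 := (H.difff (hne 0)).comp_hasDerivAt 0 (hasDerivAt_circ x v 0)
    have h2 := h1.clm_apply (hasDerivAt_circ v (-x) 0)
    simp only [circ_zero, Function.comp_def] at h2
    refine HasDerivAt.congr_deriv h2 ?_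
    rw [map_neg, H.euler (ne_zero_of_unit hx)]; ring

/-! ### Reflections -/

/-- The unit vector in direction `x - y`. -/
def wv {n : ℕ} (x y : Esp n) : Esp n := ‖x - y‖⁻¹ • (x - y)

/-- The reflection exchanging `x` and `y`. -/
def Rf {n : ℕ} (x y : Esp n) : Esp n ≃ₗᵢ[ℝ] Esp n := (Submodule.span ℝ {x - y})ᗮ.reflection

section refl
variable {n : ℕ} {x y : Esp n}

lemma inner_self_unit (hx : ‖x‖ = 1) : ⟪x, x⟫ = 1 := by
  rw [real_inner_self_eq_norm_sq, hx]; norm_num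

lemma Rf_x (hx : ‖x‖ = 1) (hy : ‖y‖ = 1) : Rf x y x = y :=
  Submodule.reflection_sub (by rw [hx, hy])

lemma norm_sub_pos (hxy : x ≠ y) : 0 < ‖x - y‖ := norm_pos_iff.2 (sub_ne_zero.2 hxy)

lemma norm_wv (hxy : x ≠ y) : ‖wv x y‖ = 1 := by
  unfold wv
  rw [norm_smul, norm_inv, norm_norm, inv_mul_cancel₀ (norm_sub_pos hxy).ne']

lemma norm_sub_sq_unit (hx : ‖x‖ = 1) (hy : ‖y‖ = 1) : ‖x - y‖ ^ 2 = 2 - 2 * ⟪x, y⟫ := by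
  rw [norm_sub_sq_real, hx, hy]; ring

lemma norm_add_sq_unit (hx : ‖x‖ = 1) (hy : ‖y‖ = 1) : ‖x + y‖ ^ 2 = 2 + 2 * ⟪x, y⟫ := by
  rw [norm_add_sq_real, hx, hy]; ring

lemma inner_x_wv (hx : ‖x‖ = 1) (hy : ‖y‖ = 1) (hxy : x ≠ y) : ⟪x, wv x y⟫ = ‖x - y‖ / 2 := by
  have h0 := norm_sub_pos hxy
  unfold wv
  rw [inner_smul_right, inner_sub_right, inner_self_unit hx]
  have := norm_sub_sq_unit hx hy
  field_simp
  linarith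

lemma Rf_apply (hxy : x ≠ y) (z : Esp n) : Rf x y z = z - (2 * ⟪z, wv x y⟫) • wv x y := by
  have h0 := norm_sub_pos hxy
  unfold Rf
  rw [Submodule.reflection_orthogonal_apply, Submodule.reflection_singleton_apply]
  unfold wv
  rw [inner_smul_right, smul_smul, real_inner_comm]
  simp only [RCLike.ofReal_real_eq_id, id, two_smul]
  rw [neg_sub, ← add_smul]
  congr 2
  rw [real_inner_comm]
  field_simp
  ring

lemma sub_Rf (hxy : x ≠ y) (z : Esp n) : ‖z - Rf x y z‖ = 2 * |⟪z, wv x y⟫| := by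
  rw [Rf_apply hxy, sub_sub_cancel, norm_smul, norm_wv hxy, Real.norm_eq_abs, abs_mul]; simp

lemma norm_Rf (z : Esp n) : ‖Rf x y z‖ = ‖z‖ := (Rf x y).norm_map z

lemma Rf_perp (hx : ‖x‖ = 1) (hy : ‖y‖ = 1) {v : Esp n} (hv : ⟪v, x⟫ = 0) : ⟪Rf x y v, y⟫ = 0 := by
  have : ⟪Rf x y v, Rf x y x⟫ = 0 := by rw [LinearIsometryEquiv.inner_map_map, hv]
  rwa [Rf_x hx hy] at this

lemma Rf_circ (hx : ‖x‖ = 1) (hy : ‖y‖ = 1) (v : Esp n) (s : ℝ) :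
    Rf x y (circ x v s) = circ y (Rf x y v) s := by
  unfold circ; rw [map_add, map_smul, map_smul, Rf_x hx hy]

lemma wv_proj (hx : ‖x‖ = 1) (hy : ‖y‖ = 1) (hxy : x ≠ y) :
    ‖wv x y - ⟪wv x y, x⟫ • x‖ ^ 2 = 1 - ‖x - y‖ ^ 2 / 4 := by
  rw [norm_sub_sq_real, norm_wv hxy, norm_smul, inner_smul_right, hx, Real.norm_eq_abs, mul_one,
    sq_abs, real_inner_comm, inner_x_wv hx hy hxy]
  ring

/-- Moving along the reflected circles, the distance is controlled near `0`. -/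
lemma ev_inner_pos (hx : ‖x‖ = 1) (hy : ‖y‖ = 1) (hxy : x ≠ y) (v : Esp n) {d0 : ℝ}
    (hd : d0 < ‖x - y‖) : ∀ᶠ s in nhds (0:ℝ), d0 < 2 * ⟪circ x v s, wv x y⟫ := by
  have : ContinuousAt (fun s => 2 * ⟪circ x v s, wv x y⟫) 0 :=
    (continuous_const.mul ((cont_circ x v).inner continuous_const)).continuousAt
  apply this.eventually_const_lt
  simp only [circ_zero]; rw [inner_x_wv hx hy hxy]; linarith

lemma ev_inner_lt (hx : ‖x‖ = 1) (hy : ‖y‖ = 1) (hxy : x ≠ y) (v : Esp n) {d0 : ℝ}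
    (hd : ‖x - y‖ < d0) : ∀ᶠ s in nhds (0:ℝ), 2 * ⟪circ x v s, wv x y⟫ < d0 := by
  have : ContinuousAt (fun s => 2 * ⟪circ x v s, wv x y⟫) 0 :=
    (continuous_const.mul ((cont_circ x v).inner continuous_const)).continuousAt
  apply this.eventually_lt_const
  simp only [circ_zero]; rw [inner_x_wv hx hy hxy]; linarith

lemma ev_norm_lt (v : Esp n) {d0 : ℝ} (hd : ‖x - y‖ < d0) :
    ∀ᶠ s in nhds (0:ℝ), ‖circ x v s - y‖ < d0 := by
  have : ContinuousAt (fun s => ‖circ x v s - y‖) 0 :=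
    (((cont_circ x v).sub continuous_const).norm).continuousAt
  apply this.eventually_lt_const
  simp only [circ_zero]; exact hd

lemma ev_norm_gt (v : Esp n) {d0 : ℝ} (hd : d0 < ‖x - y‖) :
    ∀ᶠ s in nhds (0:ℝ), d0 < ‖circ x v s - y‖ := by
  have : ContinuousAt (fun s => ‖circ x v s - y‖) 0 :=
    (((cont_circ x v).sub continuous_const).norm).continuousAt
  apply this.eventually_const_lt
  simp only [circ_zero]; exact hd

lemma exists_perp (hn : 1 ≤ n) (x : Esp n) : ∃ v : Esp n, ‖v‖ = 1 ∧ ⟪v, x⟫ = 0 := by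
  have hfr : Module.finrank ℝ (Submodule.span ℝ {x}) ≤ 1 := by
    simpa using finrank_span_le_card (R := ℝ) ({x} : Set (Esp n))
  have h2 := Submodule.finrank_add_finrank_orthogonal (Submodule.span ℝ {x})
  have h3 : Module.finrank ℝ (Esp n) = n + 1 := by simp
  have h4 : 0 < Module.finrank ℝ (Submodule.span ℝ {x})ᗮ := by omega
  have := Module.finrank_pos_iff.1 h4
  obtain ⟨⟨u, hu⟩, hu0⟩ := exists_ne (0 : (Submodule.span ℝ {x})ᗮ)
  have hu0' : u ≠ 0 := fun h => hu0 (by ext1; exact h)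
  refine ⟨‖u‖⁻¹ • u, ?_, ?_⟩
  · rw [norm_smul, norm_inv, norm_norm, inv_mul_cancel₀ (norm_ne_zero_iff.2 hu0')]
  · rw [inner_smul_left, real_inner_comm, Submodule.mem_orthogonal_singleton_iff_inner_right.1 hu]
    simp

lemma norm_le_maj {d a : ℝ} (hd : 0 < d) : a ≤ (a ^ 2 / d + d) / 2 := by
  rw [div_add' _ _ _ hd.ne', div_div, le_div_iff₀ (by positivity)]
  nlinarith [sq_nonneg (a - d)]

end refl

/-! ### The full setup -/

/-- All assumptions of the theorem, reorganised. -/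
structure Setup (n : ℕ) (φ : ℝ → ℝ → ℝ) (h : Esp n → ℝ) : Prop extends HData n h where
  hn : 1 ≤ n
  C1 : ContDiffOn ℝ 1 (fun p : ℝ × ℝ => φ p.1 p.2) (Set.Ioi 0 ×ˢ Set.Ioi 0)
  d1 : ∀ x y : ℝ, 0 < x → 0 < y → 0 ≤ deriv (fun t => φ t y) x
  d2 : ∀ x y : ℝ, 0 < x → 0 < y → 0 ≤ deriv (fun s => φ x s) y
  sig : ∀ x, ‖x‖ = 1 → sigmaElem n n h x = φ (h x) ‖sphGrad n h x‖

namespace Setup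

variable {n : ℕ} {φ : ℝ → ℝ → ℝ} {h : Esp n → ℝ}

lemma cdaφ (S : Setup n φ h) {a p : ℝ} (ha : 0 < a) (hp : 0 < p) :
    ContDiffAt ℝ 1 (fun p : ℝ × ℝ => φ p.1 p.2) (a, p) :=
  S.C1.contDiffAt ((isOpen_Ioi.prod isOpen_Ioi).mem_nhds ⟨ha, hp⟩)

lemma deriv1 (S : Setup n φ h) {a p : ℝ} (ha : 0 < a) (hp : 0 < p) :
    HasDerivAt (fun t => φ t p) (fderiv ℝ (fun p : ℝ × ℝ => φ p.1 p.2) (a, p) (1, 0)) a := by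
  have h1 := ((S.cdaφ ha hp).differentiableAt (by simp)).hasFDerivAt
  have h2 : HasDerivAt (fun t : ℝ => (t, p)) ((1:ℝ), (0:ℝ)) a :=
    (hasDerivAt_id a).prodMk (hasDerivAt_const a p)
  exact h1.comp_hasDerivAt a h2

lemma deriv2 (S : Setup n φ h) {a p : ℝ} (ha : 0 < a) (hp : 0 < p) :
    HasDerivAt (fun t => φ a t) (fderiv ℝ (fun p : ℝ × ℝ => φ p.1 p.2) (a, p) (0, 1)) p := by
  have h1 := ((S.cdaφ ha hp).differentiableAt (by simp)).hasFDerivAt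
  have h2 : HasDerivAt (fun t : ℝ => (a, t)) ((0:ℝ), (1:ℝ)) p :=
    (hasDerivAt_const p a).prodMk (hasDerivAt_id p)
  exact h1.comp_hasDerivAt p h2

lemma mono1 (S : Setup n φ h) {a a' p : ℝ} (ha : 0 < a) (hp : 0 < p) (haa : a ≤ a') :
    φ a p ≤ φ a' p := by
  have : MonotoneOn (fun t => φ t p) (Set.Ioi 0) := by
    apply monotoneOn_of_deriv_nonneg (convex_Ioi 0)
    · intro t ht; exact (S.deriv1 ht hp).continuousAt.continuousWithinAt
    · intro t ht; rw [interior_Ioi] at ht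
      exact (S.deriv1 ht hp).differentiableAt.differentiableWithinAt
    · intro t ht; rw [interior_Ioi] at ht; exact S.d1 t p ht hp
  exact this ha (ha.trans_le haa) haa

lemma mono2 (S : Setup n φ h) {a p p' : ℝ} (ha : 0 < a) (hp : 0 < p) (hpp : p ≤ p') :
    φ a p ≤ φ a p' := by
  have : MonotoneOn (fun t => φ a t) (Set.Ioi 0) := by
    apply monotoneOn_of_deriv_nonneg (convex_Ioi 0)
    · intro t ht; exact (S.deriv2 ha ht).continuousAt.continuousWithinAt
    · intro t ht; rw [interior_Ioi] at ht
      exact (S.deriv2 ha ht).differentiableAt.differentiableWithinAt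
    · intro t ht; rw [interior_Ioi] at ht; exact S.d2 a t ha ht
  exact this hp (hp.trans_le hpp) hpp

lemma smono1 (S : Setup n φ h) (hs : ∀ x y : ℝ, 0 < x → 0 < y → 0 < deriv (fun t => φ t y) x)
    {a a' p : ℝ} (ha : 0 < a) (hp : 0 < p) (haa : a < a') :
    φ a p < φ a' p := by
  have : StrictMonoOn (fun t => φ t p) (Set.Ioi 0) := by
    apply strictMonoOn_of_deriv_pos (convex_Ioi 0)
    · intro t ht; exact (S.deriv1 ht hp).continuousAt.continuousWithinAt
    · intro t ht; rw [interior_Ioi] at ht; exact hs t p ht hp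
  exact this ha (ha.trans haa) haa

lemma smono2 (S : Setup n φ h) (hs : ∀ x y : ℝ, 0 < x → 0 < y → 0 < deriv (fun s => φ x s) y)
    {a p p' : ℝ} (ha : 0 < a) (hp : 0 < p) (hpp : p < p') :
    φ a p < φ a p' := by
  have : StrictMonoOn (fun t => φ a t) (Set.Ioi 0) := by
    apply strictMonoOn_of_deriv_pos (convex_Ioi 0)
    · intro t ht; exact (S.deriv2 ha ht).continuousAt.continuousWithinAt
    · intro t ht; rw [interior_Ioi] at ht; exact hs a t ha ht
  exact this hp (hp.trans hpp) hpp

/-- Second order condition along reflected circles. -/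
lemma second_order (S : Setup n φ h) {x y v : Esp n} (hx : ‖x‖ = 1) (hy : ‖y‖ = 1)
    (hv : ‖v‖ = 1) (hvx : ⟪v, x⟫ = 0) {g : ℝ → ℝ} {a b c : ℝ} (hg : Jet2 g a b c)
    (ha : a = -(h x - h y))
    (hm : ∀ᶠ s in nhds 0, h (circ x v s) - h (Rf x y (circ x v s)) + g s ≤ 0) :
    fderiv ℝ h x v - fderiv ℝ h y (Rf x y v) + b = 0 ∧
      D2 n h x v v - D2 n h y (Rf x y v) (Rf x y v) ≤ h x - h y - c := by
  have j1 := S.toHData.jet_circ hx hv hvx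
  have j2 := S.toHData.jet_circ hy (by rw [norm_Rf, hv] : ‖Rf x y v‖ = 1) (Rf_perp hx hy hvx)
  have j := ((j1.sub j2).add hg).congr (g := fun s => h (circ x v s) - h (Rf x y (circ x v s)) + g s)
    (fun s => by rw [Rf_circ hx hy]) (a' := 0) (by rw [ha]; ring) rfl rfl
  obtain ⟨h1, h2⟩ := j.max hm
  exact ⟨h1, by linarith⟩

lemma first_order (S : Setup n φ h) {x v : Esp n} (hx : ‖x‖ = 1)
    (hv : ‖v‖ = 1) (hvx : ⟪v, x⟫ = 0) (k : ℝ) {g : ℝ → ℝ} {a b c : ℝ} (hg : Jet2 g a b c)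
    (ha : a = - (k * h x))
    (hm : ∀ᶠ s in nhds 0, k * h (circ x v s) + g s ≤ 0) :
    k * fderiv ℝ h x v + b = 0 := by
  have j1 := S.toHData.jet_circ hx hv hvx
  have j := ((j1.smul k).add hg).congr (fun s => rfl) (a' := 0) (by rw [ha]; ring) rfl rfl
  exact (j.max hm).1

/-- The basic contradiction. -/
lemma contra (S : Setup n φ h) {x y : Esp n} (hx : ‖x‖ = 1) (hy : ‖y‖ = 1) (hxy : x ≠ y)
    (hpp : ‖sphGrad n h x‖ = ‖sphGrad n h y‖) (hp : 0 < ‖sphGrad n h x‖) (hh : h y ≤ h x)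
    {l L : ℝ} (hl : 0 < l) (hL : 0 < L)
    (hb : ∀ x v : Esp n, ‖x‖ = 1 → ‖v‖ = 1 → l ≤ qf n h x v ∧ qf n h x v ≤ L)
    {K1 K2 : ℝ} (hK1 : 0 ≤ K1) (hK2 : 0 ≤ K2)
    (hAB : ∀ v, ‖v‖ = 1 → ⟪v, x⟫ = 0 →
      D2 n h x v v - D2 n h y (Rf x y v) (Rf x y v) ≤ K2 - K1 * ⟪v, wv x y⟫ ^ 2)
    (hlt : n * K2 / l < K1 * (1 - ‖x - y‖ ^ 2 / 4) / L) : False := by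
  obtain ⟨h1, h2⟩ := S.toHData.compare hx hy (Rf x y) (Rf_x hx hy) (wv x y) hl hL hb hK1 hK2 hAB
  rw [wv_proj hx hy hxy] at h1
  have h3 : sigmaElem n n h y ≤ sigmaElem n n h x := by
    rw [S.sig x hx, S.sig y hy, ← hpp]
    exact S.mono1 (S.pos y (by simpa using hy)) hp hh
  have h4 : Real.exp (n * K2 / l - K1 * (1 - ‖x - y‖ ^ 2 / 4) / L) < 1 := by
    rw [Real.exp_lt_one_iff]; linarith
  nlinarith

end Setup

/-! ### Compactness and the arc bound -/

/-- Pairs of unit vectors with distance in `[d1, d2]`. -/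
def Kset (n : ℕ) (d1 d2 : ℝ) : Set (Esp n × Esp n) :=
  {p | ‖p.1‖ = 1 ∧ ‖p.2‖ = 1 ∧ d1 ≤ ‖p.1 - p.2‖ ∧ ‖p.1 - p.2‖ ≤ d2}

lemma isCompact_Kset (n : ℕ) (d1 d2 : ℝ) : IsCompact (Kset n d1 d2) := by
  have hK : IsCompact (sphere (0 : Esp n) 1 ×ˢ sphere (0 : Esp n) 1) :=
    (isCompact_sphere 0 1).prod (isCompact_sphere 0 1)
  apply hK.of_isClosed_subset
  · have c : Continuous fun p : Esp n × Esp n => ‖p.1 - p.2‖ := by fun_prop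
    exact (isClosed_eq (by fun_prop) (by fun_prop)).inter
      ((isClosed_eq (by fun_prop) (by fun_prop)).inter
      ((isClosed_le (by fun_prop) c).inter (isClosed_le c (by fun_prop))))
  · rintro p ⟨h1, h2, -⟩
    exact ⟨by simpa using h1, by simpa using h2⟩

lemma circ_sub_circ {n : ℕ} (x v : Esp n) (s : ℝ) :
    circ x v s - circ x v (-s) = (2 * Real.sin s) • v := by
  unfold circ; rw [Real.cos_neg, Real.sin_neg]; module

lemma norm_le_two {n : ℕ} {x y : Esp n} (hx : ‖x‖ = 1) (hy : ‖y‖ = 1) : ‖x - y‖ ≤ 2 := by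
  have := norm_sub_le x y; rw [hx, hy] at this; linarith

lemma eq_neg_of_norm_two {n : ℕ} {x y : Esp n} (hx : ‖x‖ = 1) (hy : ‖y‖ = 1)
    (h : ‖x - y‖ = 2) : y = -x := by
  have h1 := norm_sub_sq_unit hx hy
  have h2 := norm_add_sq_unit hx hy
  rw [h] at h1
  have h3 : ‖x + y‖ ^ 2 = 0 := by linarith
  have h4 : x + y = 0 := by simpa using h3
  exact (neg_eq_of_add_eq_zero_right h4).symm

lemma exists_pair {n : ℕ} (hn : 1 ≤ n) {d0 : ℝ} (h0 : 0 ≤ d0) (h2 : d0 ≤ 2) :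
    ∃ x y : Esp n, ‖x‖ = 1 ∧ ‖y‖ = 1 ∧ ‖x - y‖ = d0 := by
  obtain ⟨x, hx⟩ := HData.exists_unit n
  obtain ⟨v, hv, hvx⟩ := exists_perp hn x
  refine ⟨circ x v (Real.arcsin (d0 / 2)), circ x v (-Real.arcsin (d0 / 2)),
    norm_circ hx hv hvx _, norm_circ hx hv hvx _, ?_⟩
  rw [circ_sub_circ, Real.sin_arcsin (by linarith) (by linarith), norm_smul, hv, mul_one,
    Real.norm_eq_abs, mul_div_cancel₀ _ (by norm_num), abs_of_nonneg h0]

lemma arc_repr {n : ℕ} {x y : Esp n} (hx : ‖x‖ = 1) (hy : ‖y‖ = 1) (hxy : x ≠ y)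
    (hxy' : x + y ≠ 0) : ∃ f w : Esp n, ‖f‖ = 1 ∧ ‖w‖ = 1 ∧ ⟪w, f⟫ = 0 ∧
      x = circ f w (Real.arcsin (‖x - y‖ / 2)) ∧ y = circ f w (-Real.arcsin (‖x - y‖ / 2)) := by
  have h0 : 0 < ‖x + y‖ := norm_pos_iff.2 hxy'
  have h1 := norm_sub_pos hxy
  have hd2 := norm_le_two hx hy
  have e1 := norm_sub_sq_unit hx hy
  have e2 := norm_add_sq_unit hx hy
  have hr : Real.cos (Real.arcsin (‖x - y‖ / 2)) = ‖x + y‖ / 2 := by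
    rw [Real.cos_arcsin]
    have : 1 - (‖x - y‖ / 2) ^ 2 = (‖x + y‖ / 2) ^ 2 := by nlinarith
    rw [this, Real.sqrt_sq (by positivity)]
  have hs : Real.sin (Real.arcsin (‖x - y‖ / 2)) = ‖x - y‖ / 2 :=
    Real.sin_arcsin (by linarith) (by linarith)
  have k1 : (‖x + y‖ / 2) • (‖x + y‖⁻¹ • (x + y)) = (1 / 2 : ℝ) • (x + y) := by
    rw [smul_smul]; congr 1; field_simp
  have k2 : (‖x - y‖ / 2) • wv x y = (1 / 2 : ℝ) • (x - y) := by
    unfold wv; rw [smul_smul]; congr 1; field_simp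
  refine ⟨‖x + y‖⁻¹ • (x + y), wv x y, ?_, norm_wv hxy, ?_, ?_, ?_⟩
  · rw [norm_smul, norm_inv, norm_norm, inv_mul_cancel₀ h0.ne']
  · unfold wv
    rw [inner_smul_left, inner_smul_right, inner_sub_left, inner_add_right, inner_add_right,
      inner_self_unit hx, inner_self_unit hy, real_inner_comm]; ring
  · unfold circ; rw [hr, hs, k1, k2]; module
  · unfold circ; rw [Real.cos_neg, Real.sin_neg, hr, hs, neg_smul, k1, k2]; module

namespace Setup

variable {n : ℕ} {φ : ℝ → ℝ → ℝ} {h : Esp n → ℝ}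

lemma cont1 (S : Setup n φ h) (d1 d2 : ℝ) : ContinuousOn (fun p : Esp n × Esp n => h p.1)
    (Kset n d1 d2) := by
  rintro p ⟨h1, -⟩
  exact ((S.contAt (ne_zero_of_unit h1)).comp (f := Prod.fst) continuousAt_fst).continuousWithinAt

lemma cont2 (S : Setup n φ h) (d1 d2 : ℝ) : ContinuousOn (fun p : Esp n × Esp n => h p.2)
    (Kset n d1 d2) := by
  rintro p ⟨-, h1, -⟩
  exact ((S.contAt (ne_zero_of_unit h1)).comp (f := Prod.snd) continuousAt_snd).continuousWithinAt

lemma exists_G (S : Setup n φ h) : ∃ x0 : Esp n, ‖x0‖ = 1 ∧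
    ∀ x, ‖x‖ = 1 → ‖sphGrad n h x‖ ≤ ‖sphGrad n h x0‖ := by
  obtain ⟨x0, hx0⟩ := HData.exists_unit n
  obtain ⟨p, hp, hm⟩ := (isCompact_sphere (0 : Esp n) 1).exists_isMaxOn ⟨x0, by simpa using hx0⟩
    (f := fun x => ‖sphGrad n h x‖) (by
      intro x hx
      exact (S.contAt_sphGrad (ne_zero_of_unit (by simpa using hx))).norm.continuousWithinAt)
  exact ⟨p, by simpa using hp, fun x hx => hm (by simpa using hx)⟩

lemma fderiv_le (S : Setup n φ h) {x v : Esp n} (hv : ‖v‖ = 1) (hvx : ⟪v, x⟫ = 0) :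
    fderiv ℝ h x v ≤ ‖sphGrad n h x‖ := by
  have h1 := S.toHData.inner_sphGrad (x := x) v
  rw [real_inner_comm v x, hvx, mul_zero, sub_zero] at h1
  rw [← h1]
  have := real_inner_le_norm (sphGrad n h x) v
  rwa [hv, mul_one] at this

lemma arc_bound (S : Setup n φ h) {G : ℝ} (hG : ∀ x, ‖x‖ = 1 → ‖sphGrad n h x‖ ≤ G)
    {x y : Esp n} (hx : ‖x‖ = 1) (hy : ‖y‖ = 1) (hxy : x ≠ y) (hxy' : x + y ≠ 0) :
    h x - h y ≤ 2 * G * Real.arcsin (‖x - y‖ / 2) := by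
  obtain ⟨f, w, hf, hw, hwf, ex, ey⟩ := arc_repr hx hy hxy hxy'
  set a := Real.arcsin (‖x - y‖ / 2)
  have ha : 0 ≤ a := Real.arcsin_nonneg.2 (by positivity)
  have hd : ∀ s, HasDerivAt (fun s => h (circ f w s)) (fderiv ℝ h (circ f w s) (circ w (-f) s)) s :=
    fun s => (S.diff (ne_zero_of_unit (norm_circ hf hw hwf s))).comp_hasDerivAt s
      (hasDerivAt_circ f w s)
  have := Convex.image_sub_le_mul_sub_of_deriv_le (convex_univ (𝕜 := ℝ) (E := ℝ))
    (f := fun s => h (circ f w s)) (C := G)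
    (fun s _ => (hd s).continuousAt.continuousWithinAt)
    (fun s _ => (hd s).differentiableAt.differentiableWithinAt)
    (fun s _ => by
      rw [(hd s).deriv]
      refine (S.fderiv_le ?_ ?_).trans (hG _ (norm_circ hf hw hwf s))
      · exact norm_circ hw (by rw [norm_neg, hf]) (by rw [inner_neg_left, real_inner_comm, hwf, neg_zero]) s
      · rw [inner_circ]
        rw [inner_neg_left, real_inner_comm, real_inner_comm (circ f w s) f, inner_circ, inner_circ, hwf, real_inner_comm w f, hwf, inner_self_unit hf,
          inner_self_unit hw]; ring)
    (-a) (Set.mem_univ _) a (Set.mem_univ _) (by linarith)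
  rw [← ex, ← ey] at this
  linarith

lemma near_diag (S : Setup n φ h) {G : ℝ} (hG : ∀ x, ‖x‖ = 1 → ‖sphGrad n h x‖ ≤ G)
    {lam : ℝ} (hlam : G < lam) : ∃ δ, 0 < δ ∧ ∀ x y : Esp n, ‖x‖ = 1 → ‖y‖ = 1 →
      ‖x - y‖ < δ → h x - h y ≤ lam * ‖x - y‖ := by
  have h1 : HasDerivAt (fun t => lam * t - G * Real.arcsin t) (lam - G) 0 := by
    have h2 := (Real.hasDerivAt_arcsin (x := 0) (by norm_num) (by norm_num)).const_mul G
    have h3 := ((hasDerivAt_id (0:ℝ)).const_mul lam).sub h2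
    exact h3.congr_deriv (by simp)
  rw [hasDerivAt_iff_tendsto_slope] at h1
  have h4 := h1.eventually (lt_mem_nhds (sub_pos.2 hlam))
  rw [Filter.Eventually, Metric.mem_nhdsWithin_iff] at h4
  obtain ⟨δ, hδ, h5⟩ := h4
  refine ⟨min 1 δ, lt_min one_pos hδ, ?_⟩
  intro x y hx hy hd
  by_cases hxy : x = y
  · subst hxy; simp
  have hpos := norm_sub_pos hxy
  have hxy' : x + y ≠ 0 := by
    intro h0
    have e1 := norm_sub_sq_unit hx hy
    have e2 := norm_add_sq_unit hx hy
    rw [h0, norm_zero] at e2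
    have : ‖x - y‖ < 1 := hd.trans_le (min_le_left _ _)
    nlinarith
  have hb := S.arc_bound hG hx hy hxy hxy'
  have h6 := h5 (a := ‖x - y‖ / 2) ⟨by
    rw [mem_ball, Real.dist_eq, sub_zero, abs_of_pos (by positivity)]
    have := hd.trans_le (min_le_right _ _)
    linarith, by simp; exact sub_ne_zero.2 hxy⟩
  simp only [Set.mem_ofPred_eq, slope_def_field, Real.arcsin_zero, mul_zero, sub_zero] at h6
  have h7 := mul_pos h6 (half_pos hpos)
  rw [div_mul_cancel₀ _ (half_pos hpos).ne'] at h7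
  linarith

lemma const_of_G (S : Setup n φ h) (hG : ∀ x, ‖x‖ = 1 → ‖sphGrad n h x‖ ≤ 0)
    {x y : Esp n} (hx : ‖x‖ = 1) (hy : ‖y‖ = 1) : h x ≤ h y := by
  have key : ∀ x y : Esp n, ‖x‖ = 1 → ‖y‖ = 1 → x + y ≠ 0 → h x ≤ h y := by
    intro x y hx hy hxy'
    by_cases hxy : x = y
    · rw [hxy]
    have := S.arc_bound hG hx hy hxy hxy'
    simp at this; linarith
  by_cases hxy' : x + y = 0
  · obtain ⟨v, hv, hvx⟩ := exists_perp S.hn x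
    have hne : ∀ a : ℝ, a • x + v ≠ 0 := by
      intro a h0
      have := congrArg (fun u => ⟪v, u⟫) h0
      simp only [inner_add_right, inner_smul_right, hvx, inner_self_unit hv, inner_zero_right] at this
      norm_num at this
    have hyx : y = -x := (neg_eq_of_add_eq_zero_right hxy').symm
    refine (key x v hx hv (by simpa using hne 1)).trans (key v y hv hy ?_)
    rw [hyx, add_comm]; simpa using hne (-1)
  · exact key x y hx hy hxy'

end Setup

/-! ### Step B: the maximum over small distances is attained at the boundary -/

namespace Setup

variable {n : ℕ} {φ : ℝ → ℝ → ℝ} {h : Esp n → ℝ}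

lemma exceed (S : Setup n φ h) {x0 : Esp n} (hx0 : ‖x0‖ = 1) {G : ℝ} (hGx : ‖sphGrad n h x0‖ = G)
    (hG0 : 0 < G) {ε α d0 : ℝ} (hε : 0 < ε) (hα : 0 < α) (hd0 : 0 < d0) :
    ∃ x y : Esp n, ‖x‖ = 1 ∧ ‖y‖ = 1 ∧ 0 < ‖x - y‖ ∧ ‖x - y‖ ≤ d0 ∧
      G * ‖x - y‖ < h x - h y + ε * (Real.exp (α * ‖x - y‖ ^ 2) - 1) := by
  set e := G⁻¹ • sphGrad n h x0 with he
  have hen : ‖e‖ = 1 := by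
    rw [he, norm_smul, hGx, norm_inv, Real.norm_eq_abs, abs_of_pos hG0, inv_mul_cancel₀ hG0.ne']
  have hex : ⟪e, x0⟫ = 0 := by
    rw [he, inner_smul_left, S.sphGrad_perp hx0]; simp
  have hDe : fderiv ℝ h x0 e = G := by
    have h1 := S.toHData.inner_sphGrad (x := x0) e
    rw [real_inner_comm e x0, hex, mul_zero, sub_zero] at h1
    rw [← h1, he, inner_smul_right, real_inner_self_eq_norm_sq, hGx]; field_simp
  have j := S.toHData.jet_circ hx0 hen hex
  rw [hDe] at j
  have jE := ((((Jet2.sin.smul 2).mul (Jet2.sin.smul 2)).smul α).exp.sub (Jet2.const 1)).smul ε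
  have J := ((j.sub (j.comp_mul (-1))).add jE).sub ((Jet2.sin.smul 2).smul G)
  have J' := J.congr (a' := 0) (b' := 0) (c' := 8 * ε * α) (fun s => rfl) (by simp) (by simp; ring)
    (by simp; ring)
  have h1 := J'.gt (by positivity)
  have h2 : Set.Ioo (0:ℝ) (min 1 (d0 / 2)) ∈ nhdsWithin 0 (Set.Ioi 0) :=
    Ioo_mem_nhdsGT (lt_min one_pos (by positivity))
  obtain ⟨s, hs, hs1, hs2⟩ := (h1.and h2).exists
  have hs2a : s < 1 := hs2.trans_le (min_le_left _ _)
  have hs2b : s < d0 / 2 := hs2.trans_le (min_le_right _ _)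
  have hsin : 0 < Real.sin s := Real.sin_pos_of_pos_of_lt_pi hs1 (by linarith [Real.pi_gt_three])
  have hsl : Real.sin s < s := Real.sin_lt hs1
  have hd : ‖circ x0 e s - circ x0 e (-s)‖ = 2 * Real.sin s := by
    rw [circ_sub_circ, norm_smul, hen, mul_one, Real.norm_eq_abs, abs_of_pos (by positivity)]
  refine ⟨circ x0 e s, circ x0 e (-s), norm_circ hx0 hen hex _, norm_circ hx0 hen hex _, ?_, ?_, ?_⟩
  · rw [hd]; positivity
  · rw [hd]; linarith
  · rw [hd]
    have e1 : (2 * Real.sin s) ^ 2 = 2 * Real.sin s * (2 * Real.sin s) := by ring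
    rw [e1]
    have e2 : -1 * s = -s := by ring
    simp only [e2] at hs
    linarith

set_option maxHeartbeats 1000000 in
lemma stepB_contra (S : Setup n φ h) {G : ℝ} (hG0 : 0 < G) {l L : ℝ} (hl : 0 < l) (hL : 0 < L)
    (hb : ∀ x v : Esp n, ‖x‖ = 1 → ‖v‖ = 1 → l ≤ qf n h x v ∧ qf n h x v ≤ L)
    {ε α d0 lam : ℝ} (hε : 0 < ε) (hα : 0 < α) (hd0 : d0 < 2) (hlam : G < lam)
    (hεα : 4 * α * ε * Real.exp (4 * α) ≤ G)
    (hα2 : n / l ≤ 8 * α * (1 - d0 ^ 2 / 4) / L)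
    {x y : Esp n} (hx : ‖x‖ = 1) (hy : ‖y‖ = 1) (hxy : x ≠ y) (hd : ‖x - y‖ < d0)
    (hmax : ∀ x' y' : Esp n, ‖x'‖ = 1 → ‖y'‖ = 1 → ‖x' - y'‖ ≤ d0 →
      h x' - h y' + ε * (Real.exp (α * ‖x' - y'‖ ^ 2) - 1) ≤ lam * ‖x' - y'‖)
    (heq : h x - h y + ε * (Real.exp (α * ‖x - y‖ ^ 2) - 1) = lam * ‖x - y‖) : False := by
  have hdp := norm_sub_pos hxy
  set d := ‖x - y‖ with hdd
  set E := Real.exp (α * d ^ 2) with hE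
  have hE1 : 1 ≤ E := Real.one_le_exp (by positivity)
  have hE4 : E ≤ Real.exp (4 * α) := by
    apply Real.exp_le_exp.2
    have hd4 : d ^ 2 ≤ 4 := by nlinarith
    have := mul_le_mul_of_nonneg_left hd4 hα.le
    linarith
  have hεE : 4 * α * ε * E ≤ G := le_trans (by gcongr) hεα
  have hxyi : d ^ 2 = 2 - 2 * ⟪x, y⟫ := norm_sub_sq_unit hx hy
  set κ := lam / d - 2 * ε * α * E with hκ
  have hκpos : 0 < κ := by
    rw [hκ, sub_pos, lt_div_iff₀ hdp]
    nlinarith [mul_pos (mul_pos hε hα) (lt_of_lt_of_le one_pos hE1)]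
  -- first order in general form
  have FO : ∀ (x y : Esp n) (k : ℝ), ‖x‖ = 1 → ‖y‖ = 1 → ‖x - y‖ = d →
      (∀ z : Esp n, ‖z‖ = 1 → ‖z - y‖ ≤ d0 →
        k * h z - k * h y + ε * (Real.exp (α * ‖z - y‖ ^ 2) - 1) ≤ lam * ‖z - y‖) →
      k * h x - k * h y + ε * (E - 1) = lam * d →
      ∀ v, ‖v‖ = 1 → ⟪v, x⟫ = 0 → k * fderiv ℝ h x v = -κ * ⟪v, y⟫ := by
    intro x y k hx hy hdxy hm he v hv hvx
    have hxyi : d ^ 2 = 2 - 2 * ⟪x, y⟫ := by rw [← hdxy]; exact norm_sub_sq_unit hx hy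
    have ji := jet_inner_circ x v y
    have ju := (Jet2.const 2).sub (ji.smul 2)
    have jg := ((((ju.smul α).exp.sub (Jet2.const 1)).smul ε).sub (ju.smul (lam / (2 * d)))).sub
      (Jet2.const (lam * d / 2 + k * h y))
    have := S.first_order hx hv hvx k jg (by
      rw [← hxyi, ← hE]
      have : lam / (2 * d) * d ^ 2 = lam * d / 2 := by field_simp
      rw [this]; linarith) (by
      filter_upwards [ev_norm_lt v (by rw [hdxy]; exact hd : ‖x - y‖ < d0)] with s hs
      have hz := norm_circ hx hv hvx s
      have h1 := hm _ hz hs.le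
      rw [norm_sub_sq_unit hz hy] at h1
      have h2 := norm_le_maj (a := ‖circ x v s - y‖) hdp
      rw [norm_sub_sq_unit hz hy] at h2
      have h3 : lam * ‖circ x v s - y‖ ≤
        lam / (2 * d) * (2 - 2 * ⟪circ x v s, y⟫) + lam * d / 2 := by
        calc _ ≤ lam * (((2 - 2 * ⟪circ x v s, y⟫) / d + d) / 2) :=
              mul_le_mul_of_nonneg_left h2 (hG0.trans hlam).le
          _ = _ := by field_simp
      linarith)
    rw [← hxyi, ← hE] at this
    rw [hκ]
    have e : lam / (2 * d) * (0 - 2 * ⟪v, y⟫) = - (lam / d) * ⟪v, y⟫ := by field_simp; ring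
    rw [e] at this
    linear_combination this
  have fx := FO x y 1 hx hy rfl (fun z hz hzd => by
    have := hmax z y hz hy hzd; linarith) (by linarith)
  have fy := FO y x (-1) hy hx (by rw [norm_sub_rev]) (fun z hz hzd => by
    rw [norm_sub_rev] at hzd ⊢
    have := hmax x z hx hz hzd
    linarith) (by linarith)
  have px := S.toHData.norm_grad hx hy (-κ) (fun v hv hvx => by
    have := fx v hv hvx; linarith)
  have py := S.toHData.norm_grad hy hx κ (fun v hv hvx => by
    have := fy v hv hvx; linarith)
  have hip : 0 < 1 - ⟪x, y⟫ ^ 2 := by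
    have : ⟪x, y⟫ = 1 - d ^ 2 / 2 := by linarith
    rw [this]
    have hd4 : d ^ 2 < 4 := by nlinarith
    have hd5 : 0 < d ^ 2 := by positivity
    nlinarith
  rw [abs_neg] at px
  rw [real_inner_comm] at py
  have hh : h y ≤ h x := by
    have h1 : E - 1 ≤ α * d ^ 2 * E := by
      have := Real.add_one_le_exp (-(α * d ^ 2))
      have h2 : Real.exp (-(α * d ^ 2)) * E = 1 := by rw [hE, ← Real.exp_add]; simp
      nlinarith
    have h3 : ε * (E - 1) ≤ ε * (α * d ^ 2 * E) := mul_le_mul_of_nonneg_left h1 hε.le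
    have h4 : ε * (α * d ^ 2 * E) = (4 * α * ε * E) * (d * (d / 4)) := by ring
    have h5 : (4 * α * ε * E) * (d * (d / 4)) ≤ G * (d * (d / 4)) := by gcongr
    have h6 : G * (d * (d / 4)) ≤ G * (d * 1) := by gcongr; linarith
    nlinarith
  set t := d / 2 with ht
  have htw : ⟪x, wv x y⟫ = t := inner_x_wv hx hy hxy
  have hEt : Real.exp (4 * α * (t * t)) = E := by rw [hE, ht]; congr 1; ring
  refine S.contra hx hy hxy (by rw [px, py]) (by rw [px]; positivity) hh hl hL hb
    (K1 := 8 * α * ε * E * (1 + 8 * α * t ^ 2)) (K2 := 8 * α * ε * E * t ^ 2) (by positivity)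
    (by positivity) ?_ ?_
  · intro v hv hvx
    have jD := jet_inner_circ x v (wv x y)
    rw [htw] at jD
    have jg := (((((jD.mul jD).smul (4 * α)).exp.sub (Jet2.const 1)).smul ε)).sub (jD.smul (2 * lam))
    have := (S.second_order hx hy hv hvx jg (by
      rw [hEt]; rw [ht]; linarith) (by
      filter_upwards [ev_inner_pos hx hy hxy v hdp, ev_inner_lt hx hy hxy v hd] with s hs1 hs2
      have hz := norm_circ hx hv hvx s
      have hdist := sub_Rf hxy (circ x v s)
      rw [abs_of_pos (by linarith)] at hdist
      have := hmax (circ x v s) (Rf x y (circ x v s)) hz (by rw [norm_Rf, hz])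
        (by rw [hdist]; exact hs2.le)
      rw [hdist] at this
      have e : α * (2 * ⟪circ x v s, wv x y⟫) ^ 2
        = 4 * α * (⟪circ x v s, wv x y⟫ * ⟪circ x v s, wv x y⟫) := by ring
      rw [e] at this
      linarith)).2
    rw [hEt] at this
    refine this.trans ?_
    have e0 : h x - h y = 2 * lam * t - ε * (E - 1) := by rw [ht]; linarith
    rw [e0]
    have h0 : 0 ≤ ε * (E - 1) := mul_nonneg hε.le (by linarith)
    rw [← sub_nonneg]
    refine le_of_le_of_eq h0 ?_
    ring
  · rw [div_lt_div_iff₀ hl hL]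
    rw [div_le_div_iff₀ hl hL] at hα2
    have ht2 : d ^ 2 / 4 = t ^ 2 := by rw [ht]; ring
    have hd02 : d ^ 2 ≤ d0 ^ 2 := by gcongr
    rw [ht2]
    have ht2' : t ^ 2 ≤ d0 ^ 2 / 4 := by linarith
    have hr : 0 < 1 - d0 ^ 2 / 4 := by nlinarith
    have hc : 0 < 8 * α * ε * E := by positivity
    have key : n * t ^ 2 * L < (1 + 8 * α * t ^ 2) * (1 - t ^ 2) * l := by
      have a1 : n * L * t ^ 2 ≤ 8 * α * (1 - d0 ^ 2 / 4) * l * t ^ 2 := by gcongr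
      have a2 : 8 * α * (1 - d0 ^ 2 / 4) * l * t ^ 2 ≤ 8 * α * (1 - t ^ 2) * l * t ^ 2 := by gcongr
      have a3 : 0 < (1 - t ^ 2) * l := mul_pos (by linarith) hl
      nlinarith
    nlinarith [mul_lt_mul_of_pos_left key hc]

end Setup

namespace Setup

variable {n : ℕ} {φ : ℝ → ℝ → ℝ} {h : Esp n → ℝ}

lemma exp_sub_one_le {α d : ℝ} (hα : 0 < α) (hd : 0 ≤ d) (hd2 : d ≤ 2) :
    Real.exp (α * d ^ 2) - 1 ≤ α * d ^ 2 * Real.exp (4 * α) := by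
  have h1 := Real.add_one_le_exp (-(α * d ^ 2))
  have h2 : Real.exp (-(α * d ^ 2)) * Real.exp (α * d ^ 2) = 1 := by rw [← Real.exp_add]; simp
  have h3 : Real.exp (α * d ^ 2) ≤ Real.exp (4 * α) := by
    apply Real.exp_le_exp.2
    have hd4 : d ^ 2 ≤ 4 := by nlinarith
    have := mul_le_mul_of_nonneg_left hd4 hα.le
    linarith
  have h4 : α * d ^ 2 * Real.exp (α * d ^ 2) ≤ α * d ^ 2 * Real.exp (4 * α) := by gcongr
  nlinarith [Real.exp_pos (α * d ^ 2)]

lemma stepB_eps (S : Setup n φ h) {x0 : Esp n} (hx0 : ‖x0‖ = 1) {G : ℝ}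
    (hGx : ‖sphGrad n h x0‖ = G) (hG : ∀ x, ‖x‖ = 1 → ‖sphGrad n h x‖ ≤ G)
    (hG0 : 0 < G) {l L : ℝ} (hl : 0 < l) (hL : 0 < L)
    (hb : ∀ x v : Esp n, ‖x‖ = 1 → ‖v‖ = 1 → l ≤ qf n h x v ∧ qf n h x v ≤ L)
    {ε α d0 : ℝ} (hε : 0 < ε) (hα : 0 < α) (hd0 : 0 < d0) (hd02 : d0 < 2)
    (hεα : 4 * α * ε * Real.exp (4 * α) ≤ G)
    (hα2 : n / l ≤ 8 * α * (1 - d0 ^ 2 / 4) / L) :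
    ∃ p q : Esp n, ‖p‖ = 1 ∧ ‖q‖ = 1 ∧ ‖p - q‖ = d0 ∧
      ∀ x y : Esp n, ‖x‖ = 1 → ‖y‖ = 1 → ‖x - y‖ ≤ d0 →
        h x - h y + ε * (Real.exp (α * ‖x - y‖ ^ 2) - 1) ≤
          (h p - h q + ε * (Real.exp (α * d0 ^ 2) - 1)) / d0 * ‖x - y‖ := by
  obtain ⟨a, b, ha, hb', hab, habd, hF⟩ := S.exceed hx0 hGx hG0 hε hα hd0
  set lam1 := (h a - h b + ε * (Real.exp (α * ‖a - b‖ ^ 2) - 1)) / ‖a - b‖ with hlam1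
  have hl1 : G < lam1 := by rw [hlam1, lt_div_iff₀ hab]; exact hF
  obtain ⟨δ1, hδ1, hnd⟩ := S.near_diag hG (lam := (G + lam1) / 2) (by linarith)
  set C := ε * (α * Real.exp (4 * α)) with hC
  have hCp : 0 < C := by positivity
  set δ := min δ1 (min ((lam1 - G) / 2 / C) ‖a - b‖) with hδ
  have hδp : 0 < δ := by
    apply lt_min hδ1 (lt_min _ hab); apply div_pos _ hCp; linarith
  have hsmall : ∀ x y : Esp n, ‖x‖ = 1 → ‖y‖ = 1 → ‖x - y‖ < δ →
      h x - h y + ε * (Real.exp (α * ‖x - y‖ ^ 2) - 1) ≤ lam1 * ‖x - y‖ := by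
    intro x y hx hy hxy
    have h1 := hnd x y hx hy (hxy.trans_le (min_le_left _ _))
    have h2 : ‖x - y‖ ≤ (lam1 - G) / 2 / C :=
      hxy.le.trans ((min_le_right _ _).trans (min_le_left _ _))
    rw [le_div_iff₀ hCp] at h2
    have h3 := mul_le_mul_of_nonneg_left
      (exp_sub_one_le hα (norm_nonneg (x - y)) (norm_le_two hx hy)) hε.le
    have h4 := mul_le_mul_of_nonneg_right h2 (norm_nonneg (x - y))
    rw [hC] at h4
    nlinarith
  have hcont : ContinuousOn (fun p : Esp n × Esp n =>
      (h p.1 - h p.2 + ε * (Real.exp (α * ‖p.1 - p.2‖ ^ 2) - 1)) / ‖p.1 - p.2‖) (Kset n δ d0) := by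
    apply ContinuousOn.div
    · apply ContinuousOn.add ((S.cont1 δ d0).sub (S.cont2 δ d0))
      apply Continuous.continuousOn; fun_prop
    · apply Continuous.continuousOn; fun_prop
    · rintro p ⟨-, -, h3, -⟩; linarith
  have hmem : (a, b) ∈ Kset n δ d0 :=
    ⟨ha, hb', (min_le_right _ _).trans (min_le_right _ _), habd⟩
  obtain ⟨⟨p, q⟩, ⟨hp, hq, hpq1, hpq2⟩, hmax⟩ :=
    (isCompact_Kset n δ d0).exists_isMaxOn ⟨_, hmem⟩ hcont
  simp only at hp hq hpq1 hpq2
  have hpqp : 0 < ‖p - q‖ := hδp.trans_le hpq1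
  set lam := (h p - h q + ε * (Real.exp (α * ‖p - q‖ ^ 2) - 1)) / ‖p - q‖ with hlam
  have hll : lam1 ≤ lam := hmax hmem
  have hall : ∀ x y : Esp n, ‖x‖ = 1 → ‖y‖ = 1 → ‖x - y‖ ≤ d0 →
      h x - h y + ε * (Real.exp (α * ‖x - y‖ ^ 2) - 1) ≤ lam * ‖x - y‖ := by
    intro x y hx hy hxy
    by_cases hs : ‖x - y‖ < δ
    · exact (hsmall x y hx hy hs).trans (mul_le_mul_of_nonneg_right hll (norm_nonneg _))
    · push Not at hs
      have := hmax (show (x, y) ∈ Kset n δ d0 from ⟨hx, hy, hs, hxy⟩)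
      exact (div_le_iff₀ (hδp.trans_le hs)).1 this
  have hd : ‖p - q‖ = d0 := by
    by_contra hne
    exact S.stepB_contra hG0 hl hL hb hε hα hd02 (hl1.trans_le hll) hεα hα2 hp hq
      (by intro e; rw [e] at hpqp; simp at hpqp) (lt_of_le_of_ne hpq2 hne) hall
      (by rw [hlam]; field_simp)
  refine ⟨p, q, hp, hq, hd, ?_⟩
  rw [hlam, hd] at hall
  exact hall

lemma stepB (S : Setup n φ h) {x0 : Esp n} (hx0 : ‖x0‖ = 1) {G : ℝ}
    (hGx : ‖sphGrad n h x0‖ = G) (hG : ∀ x, ‖x‖ = 1 → ‖sphGrad n h x‖ ≤ G)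
    (hG0 : 0 < G) {d0 : ℝ} (hd0 : 0 < d0) (hd02 : d0 < 2) :
    ∃ p q : Esp n, ‖p‖ = 1 ∧ ‖q‖ = 1 ∧ ‖p - q‖ = d0 ∧
      ∀ x y : Esp n, ‖x‖ = 1 → ‖y‖ = 1 → ‖x - y‖ ≤ d0 →
        h x - h y ≤ (h p - h q) / d0 * ‖x - y‖ := by
  obtain ⟨l, L, hl, hL, hb⟩ := S.toHData.exists_bounds
  obtain ⟨a, b, ha, hb', hab⟩ := exists_pair S.hn hd0.le hd02.le
  obtain ⟨⟨p, q⟩, ⟨hp, hq, hpq1, hpq2⟩, hmax⟩ :=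
    (isCompact_Kset n d0 d0).exists_isMaxOn (f := fun p => h p.1 - h p.2)
      ⟨(a, b), ⟨ha, hb', hab.ge, hab.le⟩⟩ ((S.cont1 d0 d0).sub (S.cont2 d0 d0))
  simp only at hp hq hpq1 hpq2
  refine ⟨p, q, hp, hq, le_antisymm hpq2 hpq1, ?_⟩
  intro x y hx hy hxy
  have hr : 0 < 1 - d0 ^ 2 / 4 := by nlinarith
  have hnp : (0:ℝ) < n := by exact_mod_cast S.hn
  set α := n * L / (8 * l * (1 - d0 ^ 2 / 4)) with hα
  have hαp : 0 < α := by positivity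
  have hα2 : n / l ≤ 8 * α * (1 - d0 ^ 2 / 4) / L := by
    rw [hα]; apply le_of_eq
    generalize 1 - d0 ^ 2 / 4 = r at hr
    field_simp
  set ε0 := G / (4 * α * Real.exp (4 * α)) with hε0
  have hε0p : 0 < ε0 := by positivity
  have key : ∀ ε ∈ Set.Ioo 0 ε0, h x - h y ≤
      (h p - h q + ε * (Real.exp (α * d0 ^ 2) - 1)) / d0 * ‖x - y‖ := by
    rintro ε ⟨he1, he2⟩
    obtain ⟨p', q', hp', hq', hpq', hm⟩ := S.stepB_eps hx0 hGx hG hG0 hl hL hb he1 hαp hd0 hd02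
      (by rw [hε0, lt_div_iff₀ (by positivity)] at he2; linarith) hα2
    have h1 := hm x y hx hy hxy
    have h2 : h p' - h q' ≤ h p - h q :=
      hmax (show (p', q') ∈ Kset n d0 d0 from ⟨hp', hq', hpq'.ge, hpq'.le⟩)
    have h3 : 0 ≤ ε * (Real.exp (α * ‖x - y‖ ^ 2) - 1) :=
      mul_nonneg he1.le (by linarith [Real.one_le_exp (show 0 ≤ α * ‖x - y‖ ^ 2 by positivity)])
    have h4 : (h p' - h q' + ε * (Real.exp (α * d0 ^ 2) - 1)) / d0 * ‖x - y‖ ≤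
      (h p - h q + ε * (Real.exp (α * d0 ^ 2) - 1)) / d0 * ‖x - y‖ := by gcongr
    linarith
  have ht : Filter.Tendsto (fun ε => (h p - h q + ε * (Real.exp (α * d0 ^ 2) - 1)) / d0 * ‖x - y‖)
      (nhdsWithin 0 (Set.Ioi 0)) (nhds ((h p - h q + 0 * (Real.exp (α * d0 ^ 2) - 1)) / d0 * ‖x - y‖)) := by
    apply Filter.Tendsto.mono_left _ nhdsWithin_le_nhds
    exact Continuous.tendsto (f := fun ε : ℝ => (h p - h q + ε * (Real.exp (α * d0 ^ 2) - 1)) / d0 * ‖x - y‖) (by fun_prop) 0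
  rw [zero_mul, add_zero] at ht
  refine ge_of_tendsto ht ?_
  filter_upwards [Ioo_mem_nhdsGT hε0p] with ε hε using key ε hε

/-- The maximal antipodal ratio. -/
lemma stepBinf (S : Setup n φ h) {x0 : Esp n} (hx0 : ‖x0‖ = 1) {G : ℝ}
    (hGx : ‖sphGrad n h x0‖ = G) (hG : ∀ x, ‖x‖ = 1 → ‖sphGrad n h x‖ ≤ G)
    (hG0 : 0 < G) : ∃ m : ℝ, 0 < m ∧ (∃ x : Esp n, ‖x‖ = 1 ∧ h x - h (-x) = 2 * m) ∧
      ∀ x y : Esp n, ‖x‖ = 1 → ‖y‖ = 1 → h x - h y ≤ m * ‖x - y‖ := by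
  have hcn : ContinuousOn (fun x => h x - h (-x)) (sphere (0 : Esp n) 1) := by
    intro x hx
    have hx1 : ‖x‖ = 1 := by simpa using hx
    exact ((S.contAt (ne_zero_of_unit hx1)).sub
      (ContinuousAt.comp (f := fun x : Esp n => -x) (S.contAt (neg_ne_zero.2 (ne_zero_of_unit hx1)))
        continuous_neg.continuousAt)).continuousWithinAt
  obtain ⟨z, hz, hmax⟩ := (isCompact_sphere (0 : Esp n) 1).exists_isMaxOn ⟨x0, by simpa using hx0⟩ hcn
  have hz1 : ‖z‖ = 1 := by simpa using hz
  set m := (h z - h (-z)) / 2 with hm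
  have hanti : ∀ x : Esp n, ‖x‖ = 1 → h x - h (-x) ≤ 2 * m := by
    intro x hx
    have h1 : h x - h (-x) ≤ h z - h (-z) := hmax (show x ∈ sphere (0 : Esp n) 1 by simpa using hx)
    linarith
  obtain ⟨δ, hδ, hnd⟩ := S.near_diag hG (lam := G + 1) (by linarith)
  have key : ∀ x y : Esp n, ‖x‖ = 1 → ‖y‖ = 1 → ‖x - y‖ < 2 → h x - h y ≤ m * ‖x - y‖ := by
    intro x y hx hy hxy
    have hev : ∀ᶠ d0 in nhdsWithin (2:ℝ) (Set.Iio 2),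
        h x - h y ≤ (2 * m + (G + 1) * √(4 - d0 ^ 2)) / d0 * ‖x - y‖ := by
      have c1 : ∀ᶠ d0 in nhdsWithin (2:ℝ) (Set.Iio 2), d0 ∈ Set.Ioo (max 1 ‖x - y‖) 2 :=
        Ioo_mem_nhdsLT (max_lt (by norm_num) hxy)
      have c2 : ∀ᶠ d0 in nhdsWithin (2:ℝ) (Set.Iio 2), √(4 - d0 ^ 2) < δ := by
        apply Filter.Eventually.filter_mono nhdsWithin_le_nhds
        have : ContinuousAt (fun d0 : ℝ => √(4 - d0 ^ 2)) 2 := by fun_prop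
        apply this.eventually_lt_const
        norm_num [hδ]
      filter_upwards [c1, c2] with d0 ⟨hd1, hd2⟩ hd3
      have hd1a := (le_max_left _ _).trans_lt hd1
      have hd1b := (le_max_right _ _).trans_lt hd1
      obtain ⟨p, q, hp, hq, hpq, hB⟩ := S.stepB hx0 hGx hG hG0 (by linarith) hd2
      have h1 := hB x y hx hy hd1b.le
      have e1 := norm_sub_sq_unit hp hq
      have e2 := norm_add_sq_unit hp hq
      have e3 : ‖p + q‖ = √(4 - d0 ^ 2) := by
        rw [← Real.sqrt_sq (norm_nonneg (p + q))]
        congr 1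
        rw [hpq] at e1; linarith
      have h3 := hnd p (-q) hp (by simpa using hq) (by rw [sub_neg_eq_add, e3]; exact hd3)
      rw [sub_neg_eq_add, e3] at h3
      have h4 := hanti (-q) (by simpa using hq)
      rw [neg_neg] at h4
      refine h1.trans ?_
      have : 0 < d0 := by linarith
      gcongr
      linarith
    have ht : Filter.Tendsto (fun d0 : ℝ => (2 * m + (G + 1) * √(4 - d0 ^ 2)) / d0 * ‖x - y‖)
        (nhdsWithin (2:ℝ) (Set.Iio 2)) (nhds ((2 * m + (G + 1) * √(4 - 2 ^ 2)) / 2 * ‖x - y‖)) := by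
      apply Filter.Tendsto.mono_left _ nhdsWithin_le_nhds
      have : ContinuousAt (fun d0 : ℝ => (2 * m + (G + 1) * √(4 - d0 ^ 2)) / d0 * ‖x - y‖) 2 := by
        apply ContinuousAt.mul _ continuousAt_const
        apply ContinuousAt.div _ continuousAt_id (by norm_num)
        fun_prop
      exact this
    have h5 := ge_of_tendsto ht hev
    have e : (2 * m + (G + 1) * √(4 - 2 ^ 2)) / 2 * ‖x - y‖ = m * ‖x - y‖ := by
      norm_num
    rwa [e] at h5
  have hall : ∀ x y : Esp n, ‖x‖ = 1 → ‖y‖ = 1 → h x - h y ≤ m * ‖x - y‖ := by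
    intro x y hx hy
    rcases lt_or_eq_of_le (norm_le_two hx hy) with h1 | h1
    · exact key x y hx hy h1
    · rw [h1, eq_neg_of_norm_two hx hy h1]; linarith [hanti x hx]
  refine ⟨m, ?_, ⟨z, hz1, by rw [hm]; ring⟩, hall⟩
  obtain ⟨p, q, hp, hq, hpq, hF⟩ := S.exceed hx0 hGx hG0 (d0 := 1) (ε := G / 4 * Real.exp (-4)) (α := 1) (by positivity)
    one_pos one_pos
  have h1 := hall p q hp hq
  have h2 := exp_sub_one_le (α := 1) one_pos (norm_nonneg (p - q)) (norm_le_two hp hq)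
  have h3 : G / 4 * Real.exp (-4) * (Real.exp (1 * ‖p - q‖ ^ 2) - 1)
      ≤ G / 4 * Real.exp (-4) * (1 * ‖p - q‖ ^ 2 * Real.exp (4 * 1)) := by gcongr
  have h4 : Real.exp (-4) * Real.exp (4 * 1) = 1 := by rw [← Real.exp_add]; norm_num
  have h5 : G / 4 * Real.exp (-4) * (1 * ‖p - q‖ ^ 2 * Real.exp (4 * 1)) = G / 4 * ‖p - q‖ ^ 2 := by
    linear_combination (G / 4 * ‖p - q‖ ^ 2) * h4
  have h6 : G / 4 * ‖p - q‖ ^ 2 ≤ G / 4 * ‖p - q‖ := by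
    gcongr; nlinarith
  have h7 : 0 < (m - 3 / 4 * G) * ‖p - q‖ := by nlinarith
  have h8 := pos_of_mul_pos_left h7 hpq.le
  linarith

end Setup

/-! ### Step A -/

/-- The unit vector in direction `x + y`. -/
def fv {n : ℕ} (x y : Esp n) : Esp n := ‖x + y‖⁻¹ • (x + y)

section fvsec
variable {n : ℕ} {x y : Esp n}

lemma norm_fv (hxy : x + y ≠ 0) : ‖fv x y‖ = 1 := by
  unfold fv
  rw [norm_smul, norm_inv, norm_norm, inv_mul_cancel₀ (norm_ne_zero_iff.2 hxy)]

lemma inner_wv_fv (hx : ‖x‖ = 1) (hy : ‖y‖ = 1) : ⟪wv x y, fv x y⟫ = 0 := by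
  unfold wv fv
  rw [inner_smul_left, inner_smul_right, inner_add_right, inner_sub_left, inner_sub_left,
    inner_self_unit hx, inner_self_unit hy, real_inner_comm]
  ring

lemma inner_x_fv (hx : ‖x‖ = 1) (hy : ‖y‖ = 1) (hxy : x + y ≠ 0) :
    ⟪x, fv x y⟫ = ‖x + y‖ / 2 := by
  have h0 : 0 < ‖x + y‖ := norm_pos_iff.2 hxy
  unfold fv
  rw [inner_smul_right, inner_add_right, inner_self_unit hx]
  have := norm_add_sq_unit hx hy
  field_simp
  linarith

lemma fv_comm (x y : Esp n) : fv x y = fv y x := by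
  unfold fv; rw [add_comm x y]

lemma inner_v_fv {v : Esp n} (hvx : ⟪v, x⟫ = 0) : ⟪v, fv x y⟫ = ⟪v, y⟫ / ‖x + y‖ := by
  unfold fv; rw [inner_smul_right, inner_add_right, hvx]; ring

lemma add_Rf_inner (hx : ‖x‖ = 1) (hy : ‖y‖ = 1) (hxy : x ≠ y) (z : Esp n) :
    ⟪z + Rf x y z, fv x y⟫ = 2 * ⟪z, fv x y⟫ := by
  rw [Rf_apply hxy, inner_add_left, inner_sub_left, inner_smul_left, inner_wv_fv hx hy]; simp; ring

lemma inner_fv_le (hxy : x + y ≠ 0) (z : Esp n) : ⟪z, fv x y⟫ ≤ ‖z‖ := by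
  have := real_inner_le_norm z (fv x y)
  rwa [norm_fv hxy, mul_one] at this

end fvsec

namespace Setup

variable {n : ℕ} {φ : ℝ → ℝ → ℝ} {h : Esp n → ℝ}

set_option maxHeartbeats 1000000 in
lemma stepA_contra (S : Setup n φ h) {l L : ℝ} (hl : 0 < l) (hL : 0 < L)
    (hb : ∀ x v : Esp n, ‖x‖ = 1 → ‖v‖ = 1 → l ≤ qf n h x v ∧ qf n h x v ≤ L)
    {ε d0 lam : ℝ} (hε : 0 < ε) (hd0 : 0 < d0) (hlam : 0 < lam) (hεl : 3 * ε ≤ lam * d0)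
    {x y : Esp n} (hx : ‖x‖ = 1) (hy : ‖y‖ = 1) (hd : d0 < ‖x - y‖)
    (hmax : ∀ x' y' : Esp n, ‖x'‖ = 1 → ‖y'‖ = 1 → d0 ≤ ‖x' - y'‖ →
      h x' - h y' + ε * (1 + ‖x' + y'‖) ≤ lam * ‖x' - y'‖)
    (heq : h x - h y + ε * (1 + ‖x + y‖) = lam * ‖x - y‖) : False := by
  have hdp : 0 < ‖x - y‖ := hd0.trans hd
  have hxy : x ≠ y := by intro e; rw [e] at hdp; simp at hdp
  have hdle := norm_le_two hx hy
  have hS := norm_sub_sq_unit hx hy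
  have hA := norm_add_sq_unit hx hy
  by_cases hz : x + y = 0
  · -- antipodal case
    have hyx : y = -x := (neg_eq_of_add_eq_zero_right hz).symm
    obtain ⟨ξ, hξ, hξx⟩ := exists_perp S.hn x
    have hd2 : ‖x - y‖ = 2 := by
      rw [hyx, sub_neg_eq_add, ← two_smul ℝ x, norm_smul, hx]; norm_num
    have main : ∀ ξ : Esp n, ‖ξ‖ = 1 → ⟪ξ, x⟫ = 0 →
        fderiv ℝ h x ξ - fderiv ℝ h y ξ + 2 * ε = 0 := by
      intro ξ hξ hξx
      have hξy : ⟪ξ, y⟫ = 0 := by rw [hyx, inner_neg_right, hξx, neg_zero]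
      have j1 := S.toHData.jet_circ hx hξ hξx
      have j2 := S.toHData.jet_circ hy hξ hξy
      have J := (((j1.sub j2).add (((Jet2.const 1).add (Jet2.sin.smul 2)).smul ε))).sub
        (Jet2.cos.smul (2 * lam))
      have J' := J.congr (fun s => rfl) (a' := 0) (by
        rw [hz, norm_zero, hd2] at heq; linarith) rfl rfl
      have := (J'.max (by
        have hc : ∀ᶠ s in nhds (0:ℝ), d0 / 2 < Real.cos s := by
          apply Real.continuous_cos.continuousAt.eventually_const_lt
          rw [Real.cos_zero]; linarith
        filter_upwards [hc] with s hs
        have e1 : circ x ξ s - circ y ξ s = (2 * Real.cos s) • x := by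
          unfold circ; rw [hyx]; module
        have e2 : circ x ξ s + circ y ξ s = (2 * Real.sin s) • ξ := by
          unfold circ; rw [hyx]; module
        have n1 : ‖circ x ξ s - circ y ξ s‖ = 2 * Real.cos s := by
          rw [e1, norm_smul, hx, mul_one, Real.norm_eq_abs, abs_of_pos (by linarith)]
        have n2 : 2 * Real.sin s ≤ ‖circ x ξ s + circ y ξ s‖ := by
          rw [e2, norm_smul, hξ, mul_one]; exact le_abs_self _
        have := hmax _ _ (norm_circ hx hξ hξx s) (norm_circ hy hξ hξy s) (by rw [n1]; linarith)
        rw [n1] at this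
        have := mul_le_mul_of_nonneg_left n2 hε.le
        linarith)).1
      linarith
    have a1 := main ξ hξ hξx
    have a2 := main (-ξ) (by rw [norm_neg, hξ]) (by rw [inner_neg_left, hξx, neg_zero])
    rw [map_neg, map_neg] at a2
    linarith
  have hρ : 0 < ‖x + y‖ := norm_pos_iff.2 hz
  set d := ‖x - y‖ with hdd
  set ρ := ‖x + y‖ with hρρ
  set κ := lam / d + ε / ρ with hκ
  have hκpos : 0 < κ := by positivity
  have FO : ∀ (x y : Esp n) (k : ℝ), ‖x‖ = 1 → ‖y‖ = 1 → ‖x - y‖ = d → ‖x + y‖ = ρ →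
      (∀ z : Esp n, ‖z‖ = 1 → d0 ≤ ‖z - y‖ →
        k * h z - k * h y + ε * (1 + ‖z + y‖) ≤ lam * ‖z - y‖) →
      k * h x - k * h y + ε * (1 + ρ) = lam * d →
      ∀ v, ‖v‖ = 1 → ⟪v, x⟫ = 0 → k * fderiv ℝ h x v = -κ * ⟪v, y⟫ := by
    intro x y k hx hy hdxy hρxy hm he v hv hvx
    have hz : x + y ≠ 0 := by rw [← norm_pos_iff, hρxy]; exact hρ
    have hxyi : d ^ 2 = 2 - 2 * ⟪x, y⟫ := by rw [← hdxy]; exact norm_sub_sq_unit hx hy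
    have ji := jet_inner_circ x v y
    have jf := jet_inner_circ x v (fv x y)
    have ju := (Jet2.const 2).sub (ji.smul 2)
    have yf : ⟪y, fv x y⟫ = ρ / 2 := by
      rw [fv_comm, inner_x_fv hy hx (by rwa [add_comm y x]), add_comm y x, hρxy]
    have xf : ⟪x, fv x y⟫ = ρ / 2 := by rw [inner_x_fv hx hy hz, hρxy]
    have jg := ((((jf.add (Jet2.const (1 + ρ / 2))).smul ε).sub (ju.smul (lam / (2 * d)))).sub
      (Jet2.const (lam * d / 2 + k * h y)))
    have := S.first_order hx hv hvx k jg (by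
      rw [← hxyi, xf]
      have : lam / (2 * d) * d ^ 2 = lam * d / 2 := by field_simp
      rw [this]; linarith) (by
      filter_upwards [ev_norm_gt v (by rw [hdxy]; exact hd : d0 < ‖x - y‖)] with s hs
      have hzn := norm_circ hx hv hvx s
      have h1 := hm _ hzn hs.le
      have h2 := norm_le_maj (a := ‖circ x v s - y‖) hdp
      rw [norm_sub_sq_unit hzn hy] at h2
      have h3 : lam * ‖circ x v s - y‖ ≤
        lam / (2 * d) * (2 - 2 * ⟪circ x v s, y⟫) + lam * d / 2 := by
        calc _ ≤ lam * (((2 - 2 * ⟪circ x v s, y⟫) / d + d) / 2) :=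
              mul_le_mul_of_nonneg_left h2 hlam.le
          _ = _ := by field_simp
      have h4 := inner_fv_le hz (circ x v s + y)
      rw [inner_add_left, yf] at h4
      have h5 := mul_le_mul_of_nonneg_left h4 hε.le
      linarith)
    rw [inner_v_fv hvx, hρxy] at this
    rw [hκ]
    have e : lam / (2 * d) * (0 - 2 * ⟪v, y⟫) = - (lam / d) * ⟪v, y⟫ := by field_simp; ring
    rw [e] at this
    linear_combination this
  have fx := FO x y 1 hx hy rfl rfl (fun z hz hzd => by
    have := hmax z y hz hy hzd; linarith) (by linarith)
  have fy := FO y x (-1) hy hx (by rw [norm_sub_rev]) (by rw [add_comm y x]) (fun z hz hzd => by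
    rw [norm_sub_rev] at hzd ⊢
    have := hmax x z hx hz hzd
    rw [add_comm z x]
    linarith) (by linarith)
  have px := S.toHData.norm_grad hx hy (-κ) (fun v hv hvx => by
    have := fx v hv hvx; linarith)
  have py := S.toHData.norm_grad hy hx κ (fun v hv hvx => by
    have := fy v hv hvx; linarith)
  have hip : 0 < 1 - ⟪x, y⟫ ^ 2 := by
    have e : 1 - ⟪x, y⟫ ^ 2 = d ^ 2 * ρ ^ 2 / 4 := by rw [hS, hA]; ring
    rw [e]; positivity
  rw [abs_neg] at px
  rw [real_inner_comm] at py
  have hρ2 : ρ ≤ 2 := by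
    have := norm_add_le x y; rw [hx, hy] at this; linarith
  have hh : h y ≤ h x := by
    have h1 : lam * d0 ≤ lam * d := by gcongr
    have h2 : ε * (1 + ρ) ≤ ε * 3 := by gcongr; linarith
    linarith
  have hd4 : d ^ 2 < 4 := by nlinarith [pow_pos hρ 2]
  refine S.contra hx hy hxy (by rw [px, py]) (by rw [px]; positivity) hh hl hL hb
    (K1 := ε) (K2 := 0) hε.le le_rfl ?_ ?_
  · intro v hv hvx
    have jD := jet_inner_circ x v (wv x y)
    have jf := jet_inner_circ x v (fv x y)
    rw [inner_x_wv hx hy hxy] at jD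
    rw [inner_x_fv hx hy hz] at jf
    have jg := (((jf.smul 2).add (Jet2.const 1)).smul ε).sub (jD.smul (2 * lam))
    have := (S.second_order hx hy hv hvx jg (by linarith) (by
      filter_upwards [ev_inner_pos hx hy hxy v hd] with s hs1
      have hzn := norm_circ hx hv hvx s
      have hdist := sub_Rf hxy (circ x v s)
      rw [abs_of_pos (by linarith)] at hdist
      have := hmax (circ x v s) (Rf x y (circ x v s)) hzn (by rw [norm_Rf, hzn])
        (by rw [hdist]; exact hs1.le)
      rw [hdist] at this
      have h4 := inner_fv_le hz (circ x v s + Rf x y (circ x v s))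
      rw [add_Rf_inner hx hy hxy] at h4
      have h5 := mul_le_mul_of_nonneg_left h4 hε.le
      linarith)).2
    have hw : ⟪v, wv x y⟫ ^ 2 ≤ 1 := by
      have := abs_real_inner_le_norm v (wv x y)
      rw [hv, norm_wv hxy, mul_one] at this
      exact (sq_le_one_iff_abs_le_one _).2 this
    have hw2 := mul_le_mul_of_nonneg_left hw hε.le
    rw [← hdd, ← hρρ] at this
    linarith
  · rw [mul_zero, zero_div]
    apply div_pos _ hL
    apply mul_pos hε; linarith

/-- For every distance there is a pair achieving the maximal ratio. -/
lemma stepA (S : Setup n φ h) {m : ℝ} (hm0 : 0 < m)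
    {z : Esp n} (hz : ‖z‖ = 1) (hzm : h z - h (-z) = 2 * m)
    (hall : ∀ x y : Esp n, ‖x‖ = 1 → ‖y‖ = 1 → h x - h y ≤ m * ‖x - y‖)
    {d0 : ℝ} (hd0 : 0 < d0) (hd02 : d0 ≤ 2) :
    ∃ x y : Esp n, ‖x‖ = 1 ∧ ‖y‖ = 1 ∧ ‖x - y‖ = d0 ∧ h x - h y = m * d0 := by
  obtain ⟨l, L, hl, hL, hb⟩ := S.toHData.exists_bounds
  obtain ⟨a, b, ha, hb', hab⟩ := exists_pair S.hn hd0.le hd02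
  obtain ⟨⟨p, q⟩, ⟨hp, hq, hpq1, hpq2⟩, hmax⟩ :=
    (isCompact_Kset n d0 d0).exists_isMaxOn (f := fun p => h p.1 - h p.2)
      ⟨(a, b), ⟨ha, hb', hab.ge, hab.le⟩⟩ ((S.cont1 d0 d0).sub (S.cont2 d0 d0))
  simp only at hp hq hpq1 hpq2
  have hpq : ‖p - q‖ = d0 := le_antisymm hpq2 hpq1
  have hle := hall p q hp hq
  rw [hpq] at hle
  refine ⟨p, q, hp, hq, hpq, ?_⟩
  by_contra hne
  have hlt : h p - h q < m * d0 := lt_of_le_of_ne hle hne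
  set ε := (m * d0 - (h p - h q)) / 6 with hε
  have hεp : 0 < ε := by rw [hε]; apply div_pos _ (by norm_num); linarith
  -- smaller epsilon
  set η := min ε (m * d0 / 3) with hη
  have hηp : 0 < η := lt_min hεp (by positivity)
  have hη1 : η ≤ ε := min_le_left _ _
  have hη2 : η ≤ m * d0 / 3 := min_le_right _ _
  have hcont : ContinuousOn (fun p : Esp n × Esp n =>
      (h p.1 - h p.2 + η * (1 + ‖p.1 + p.2‖)) / ‖p.1 - p.2‖) (Kset n d0 2) := by
    apply ContinuousOn.div
    · apply ContinuousOn.add ((S.cont1 d0 2).sub (S.cont2 d0 2))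
      apply Continuous.continuousOn; fun_prop
    · apply Continuous.continuousOn; fun_prop
    · rintro p ⟨-, -, h3, -⟩; linarith
  have hzz : ‖z - -z‖ = 2 := by
    rw [sub_neg_eq_add, ← two_smul ℝ z, norm_smul, hz]; norm_num
  have hmem : (z, -z) ∈ Kset n d0 2 := ⟨hz, by simpa using hz, by simp only; rw [hzz]; exact hd02, hzz.le⟩
  obtain ⟨⟨x, y⟩, ⟨hx, hy, hxy1, hxy2⟩, hmx⟩ :=
    (isCompact_Kset n d0 2).exists_isMaxOn ⟨_, hmem⟩ hcont
  simp only at hx hy hxy1 hxy2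
  have hxyp : 0 < ‖x - y‖ := hd0.trans_le hxy1
  set lam := (h x - h y + η * (1 + ‖x + y‖)) / ‖x - y‖ with hlam
  have hlm : m + η / 2 ≤ lam := by
    have h1 : (h z - h (-z) + η * (1 + ‖z + -z‖)) / ‖z - -z‖ ≤ lam := hmx hmem
    rw [hzz, hzm, add_neg_cancel, norm_zero] at h1
    linarith
  have hal : ∀ x' y' : Esp n, ‖x'‖ = 1 → ‖y'‖ = 1 → d0 ≤ ‖x' - y'‖ →
      h x' - h y' + η * (1 + ‖x' + y'‖) ≤ lam * ‖x' - y'‖ := by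
    intro x' y' hx' hy' hd
    have := hmx (show (x', y') ∈ Kset n d0 2 from ⟨hx', hy', hd, norm_le_two hx' hy'⟩)
    exact (div_le_iff₀ (hd0.trans_le hd)).1 this
  have heq : h x - h y + η * (1 + ‖x + y‖) = lam * ‖x - y‖ := by rw [hlam]; field_simp
  have hd : d0 < ‖x - y‖ := by
    rcases lt_or_eq_of_le hxy1 with h1 | h1
    · exact h1
    exfalso
    rw [← h1] at heq
    have h2 : h x - h y ≤ h p - h q :=
      hmax (show (x, y) ∈ Kset n d0 d0 from ⟨hx, hy, hxy1, h1.ge⟩)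
    have h3 : ‖x + y‖ ≤ 2 := by
      have := norm_add_le x y; rw [hx, hy] at this; linarith
    have h4 : η * (1 + ‖x + y‖) ≤ ε * 3 := by gcongr; linarith
    have h5 : (m + η / 2) * d0 ≤ lam * d0 := by gcongr
    have h6 : 0 < η / 2 * d0 := by positivity
    linarith
  have hlm' : m * d0 ≤ lam * d0 := by
    gcongr; linarith
  exact S.stepA_contra hl hL hb hηp hd0 (by linarith) (by linarith) hx hy hd hal heq

end Setup

/-! ### Extremal pairs -/

lemma norm_grad_aux {n : ℕ} {x y : Esp n} (hx : ‖x‖ = 1) (hy : ‖y‖ = 1) :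
    √(1 - ⟪x, y⟫ ^ 2) = ‖x - y‖ * ‖x + y‖ / 2 := by
  have e : 1 - ⟪x, y⟫ ^ 2 = (‖x - y‖ * ‖x + y‖ / 2) ^ 2 := by
    rw [div_pow, mul_pow, norm_sub_sq_unit hx hy, norm_add_sq_unit hx hy]; ring
  rw [e, Real.sqrt_sq (by positivity)]

lemma Rf_Rf {n : ℕ} (x y z : Esp n) : Rf x y (Rf x y z) = z := by
  unfold Rf; exact Submodule.reflection_reflection _ _

lemma Rf_y {n : ℕ} {x y : Esp n} (hx : ‖x‖ = 1) (hy : ‖y‖ = 1) : Rf x y y = x := by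
  have h1 := Rf_Rf x y x
  rwa [Rf_x hx hy] at h1

lemma tau_aux {e M : ℝ} (H : ∀ τ : ℝ, e * (1 - (1 + τ) ^ 2) ≤ M * τ ^ 2) : e = 0 := by
  by_contra he
  set s := 1 / (|M + e| + 1) with hs
  have hsp : 0 < s := by positivity
  have h1 := H (-(e * s))
  have h2 : e ^ 2 * s * 2 ≤ e ^ 2 * s * ((M + e) * s) := by nlinarith
  have h3 : 0 < e ^ 2 * s := by positivity
  have h4 := le_of_mul_le_mul_left h2 h3
  have h5 : (M + e) * s ≤ 1 := by
    rw [hs, mul_one_div, div_le_one (by positivity)]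
    linarith [le_abs_self (M + e)]
  linarith

namespace Setup

variable {n : ℕ} {φ : ℝ → ℝ → ℝ} {h : Esp n → ℝ}

lemma M_first (S : Setup n φ h) {m : ℝ} (hm0 : 0 < m)
    (hall : ∀ x y : Esp n, ‖x‖ = 1 → ‖y‖ = 1 → h x - h y ≤ m * ‖x - y‖)
    {x y : Esp n} (hx : ‖x‖ = 1) (hy : ‖y‖ = 1) (hxy : x ≠ y)
    (heq : h x - h y = m * ‖x - y‖) :
    (∀ v, ‖v‖ = 1 → ⟪v, x⟫ = 0 → fderiv ℝ h x v = -(m / ‖x - y‖) * ⟪v, y⟫) ∧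
    (∀ v, ‖v‖ = 1 → ⟪v, y⟫ = 0 → fderiv ℝ h y v = (m / ‖x - y‖) * ⟪v, x⟫) := by
  have hdp := norm_sub_pos hxy
  set d := ‖x - y‖ with hdd
  have FO : ∀ (x y : Esp n) (k : ℝ), ‖x‖ = 1 → ‖y‖ = 1 → ‖x - y‖ = d →
      (∀ z : Esp n, ‖z‖ = 1 →
        k * h z - k * h y ≤ m * ‖z - y‖) →
      k * h x - k * h y = m * d →
      ∀ v, ‖v‖ = 1 → ⟪v, x⟫ = 0 → k * fderiv ℝ h x v = -(m / d) * ⟪v, y⟫ := by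
    intro x y k hx hy hdxy hm he v hv hvx
    have hxyi : d ^ 2 = 2 - 2 * ⟪x, y⟫ := by rw [← hdxy]; exact norm_sub_sq_unit hx hy
    have ji := jet_inner_circ x v y
    have ju := (Jet2.const 2).sub (ji.smul 2)
    have jg := ((ju.smul (-m / (2 * d))).sub
      (Jet2.const (m * d / 2 + k * h y)))
    have := S.first_order hx hv hvx k jg (by
      rw [← hxyi]
      have : -m / (2 * d) * d ^ 2 = -(m * d / 2) := by field_simp
      rw [this]; linarith) (by
      filter_upwards with s
      have hzn := norm_circ hx hv hvx s
      have h1 := hm _ hzn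
      have h2 := norm_le_maj (a := ‖circ x v s - y‖) hdp
      rw [norm_sub_sq_unit hzn hy] at h2
      have h3 : m * ‖circ x v s - y‖ ≤
        - (-m / (2 * d) * (2 - 2 * ⟪circ x v s, y⟫)) + m * d / 2 := by
        calc _ ≤ m * (((2 - 2 * ⟪circ x v s, y⟫) / d + d) / 2) :=
              mul_le_mul_of_nonneg_left h2 hm0.le
          _ = _ := by field_simp
      linarith)
    have e : -m / (2 * d) * (0 - 2 * ⟪v, y⟫) = (m / d) * ⟪v, y⟫ := by field_simp; ring
    rw [e] at this
    linear_combination this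
  constructor
  · intro v hv hvx
    have := FO x y 1 hx hy rfl (fun z hz => by
      have := hall z y hz hy; linarith) (by linarith) v hv hvx
    linarith
  · intro v hv hvx
    have := FO y x (-1) hy hx (by rw [norm_sub_rev]) (fun z hz => by
      rw [norm_sub_rev]
      have := hall x z hx hz
      linarith) (by linarith) v hv hvx
    linarith

lemma M_grad (S : Setup n φ h) {m : ℝ} (hm0 : 0 < m)
    (hall : ∀ x y : Esp n, ‖x‖ = 1 → ‖y‖ = 1 → h x - h y ≤ m * ‖x - y‖)
    {x y : Esp n} (hx : ‖x‖ = 1) (hy : ‖y‖ = 1) (hxy : x ≠ y)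
    (heq : h x - h y = m * ‖x - y‖) :
    ‖sphGrad n h x‖ = m * ‖x + y‖ / 2 ∧ ‖sphGrad n h y‖ = m * ‖x + y‖ / 2 := by
  obtain ⟨f1, f2⟩ := S.M_first hm0 hall hx hy hxy heq
  have hdp := norm_sub_pos hxy
  have p1 := S.toHData.norm_grad hx hy _ f1
  have p2 := S.toHData.norm_grad hy hx _ f2
  rw [abs_neg, abs_of_pos (by positivity), norm_grad_aux hx hy] at p1
  rw [real_inner_comm, abs_of_pos (by positivity), norm_grad_aux hx hy] at p2
  constructor
  · rw [p1]; field_simp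
  · rw [p2]; field_simp

set_option maxHeartbeats 1000000 in
lemma M_tau (S : Setup n φ h) {m : ℝ} (hm0 : 0 < m)
    (hall : ∀ x y : Esp n, ‖x‖ = 1 → ‖y‖ = 1 → h x - h y ≤ m * ‖x - y‖)
    {x y : Esp n} (hx : ‖x‖ = 1) (hy : ‖y‖ = 1) (hxy : x ≠ y)
    (heq : h x - h y = m * ‖x - y‖) {v : Esp n} (hv : ‖v‖ = 1) (hvx : ⟪v, x⟫ = 0) (τ : ℝ) :
    (D2 n h x v v - (h x + h y) / 2)
      - (1 + τ) ^ 2 * (D2 n h y (Rf x y v) (Rf x y v) - (h x + h y) / 2)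
      ≤ m / ‖x - y‖ * τ ^ 2 := by
  obtain ⟨f1, f2⟩ := S.M_first hm0 hall hx hy hxy heq
  have hdp := norm_sub_pos hxy
  have hRv : ‖Rf x y v‖ = 1 := by rw [norm_Rf, hv]
  have hRy : ⟪Rf x y v, y⟫ = 0 := Rf_perp hx hy hvx
  have hyv : Rf x y y = x := Rf_y hx hy
  have hRw : ∀ z, ⟪Rf x y z, wv x y⟫ = - ⟪z, wv x y⟫ := by
    intro z
    rw [Rf_apply hxy, inner_sub_left, inner_smul_left, inner_self_unit (norm_wv hxy)]; simp; ring
  set d := ‖x - y‖ with hdd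
  set ω := ⟪v, wv x y⟫ with hω
  have g1 : fderiv ℝ h x v = m * ω := by
    rw [f1 v hv hvx, hω]; unfold wv; rw [inner_smul_right, inner_sub_right, hvx, ← hdd]; ring
  have g2 : fderiv ℝ h y (Rf x y v) = -(m * ω) := by
    rw [f2 _ hRv hRy]
    have : ⟪Rf x y v, x⟫ = ⟪v, y⟫ := by
      calc ⟪Rf x y v, x⟫ = ⟪Rf x y v, Rf x y y⟫ := by rw [hyv]
        _ = _ := LinearIsometryEquiv.inner_map_map _ _ _
    rw [this, hω]; unfold wv; rw [inner_smul_right, inner_sub_right, hvx, ← hdd]; ring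
  have j1 := S.toHData.jet_circ hx hv hvx
  have j2 := (S.toHData.jet_circ hy hRv hRy).comp_mul (1 + τ)
  have jD := (jet_inner_circ x v (wv x y)).add ((jet_inner_circ x v (wv x y)).comp_mul (1 + τ))
  rw [inner_x_wv hx hy hxy] at jD
  rw [g1] at j1
  rw [g2] at j2
  have jc := ((Jet2.const 1).sub (Jet2.cos.comp_mul τ)).smul m
  have J := ((jD.mul (j1.sub j2)).sub ((jD.mul jD).smul m)).sub jc
  have J' := J.congr (fun s => rfl) (a' := 0) (by
    rw [← hdd, heq]; ring) rfl rfl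
  have := (J'.max (by
    have hc : ∀ᶠ s in nhds (0:ℝ), 0 < ⟪circ x v s, wv x y⟫ + ⟪circ x v ((1 + τ) * s), wv x y⟫ := by
      have : ContinuousAt (fun s => ⟪circ x v s, wv x y⟫ + ⟪circ x v ((1 + τ) * s), wv x y⟫) 0 := by
        have c1 := cont_circ x v
        have c2 : Continuous fun s : ℝ => circ x v ((1 + τ) * s) := c1.comp (by fun_prop)
        exact ((c1.inner continuous_const).add (c2.inner continuous_const)).continuousAt
      apply this.eventually_const_lt
      simp only [mul_zero, circ_zero]; rw [inner_x_wv hx hy hxy]; linarith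
    filter_upwards [hc] with s hs
    set z := circ x v s with hz
    set z1 := circ x v ((1 + τ) * s) with hz1
    set D := ⟪z, wv x y⟫ + ⟪z1, wv x y⟫ with hD
    have hzn : ‖z‖ = 1 := norm_circ hx hv hvx s
    have hz1n : ‖z1‖ = 1 := norm_circ hx hv hvx _
    rw [← Rf_circ hx hy, ← hz1]
    have h1 := hall z (Rf x y z1) hzn (by rw [norm_Rf, hz1n])
    have h2 : ‖z - Rf x y z1‖ ^ 2 ≤ D ^ 2 + (2 - 2 * Real.cos (τ * s)) := by
      have e1 : ⟪z, Rf x y z1⟫ = ⟪z, z1⟫ - 2 * ⟪z1, wv x y⟫ * ⟪z, wv x y⟫ := by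
        rw [Rf_apply hxy, inner_sub_right, inner_smul_right]
      have e2 : ⟪z, z1⟫ = Real.cos (τ * s) := by
        have e3 : τ * s = (1 + τ) * s - s := by ring
        rw [hz, hz1, e3, Real.cos_sub]; unfold circ
        simp only [inner_add_left, inner_add_right, inner_smul_left, inner_smul_right,
          inner_self_unit hx, inner_self_unit hv, hvx, real_inner_comm v x]
        simp only [conj_trivial]; ring
      rw [norm_sub_sq_unit hzn (by rw [norm_Rf, hz1n]), e1, e2, hD]
      nlinarith [sq_nonneg (⟪z, wv x y⟫ - ⟪z1, wv x y⟫)]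
    have h3 : D * ‖z - Rf x y z1‖ ≤ D ^ 2 + (1 - Real.cos (τ * s)) := by
      nlinarith [sq_nonneg (‖z - Rf x y z1‖ - D)]
    have h4 := mul_le_mul_of_nonneg_left h1 hs.le
    have h5 := mul_le_mul_of_nonneg_left h3 hm0.le
    nlinarith)).2
  rw [← hdd] at this
  have e : d * (D2 n h x v v - h x - (1 + τ) ^ 2 * (D2 n h y (Rf x y v) (Rf x y v) - h y))
     + m * d * (d / 2 + (1 + τ) ^ 2 * (d / 2)) - m * τ ^ 2 ≤ 0 := by
    refine le_of_eq_of_le ?_ this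
    have hh : h x - h y = m * d := heq
    have hh' : h x = h y + m * d := by linarith
    rw [hh']
    ring
  rw [div_mul_eq_mul_div, le_div_iff₀ hdp]
  have hh' : h x = h y + m * d := by linarith
  rw [hh'] at e ⊢
  nlinarith
end Setup

namespace Setup

variable {n : ℕ} {φ : ℝ → ℝ → ℝ} {h : Esp n → ℝ}

lemma add_ne_of_lt {x y : Esp n} (hx : ‖x‖ = 1) (hd2 : ‖x - y‖ < 2) : x + y ≠ 0 := by
  intro hz
  have hyx : y = -x := (neg_eq_of_add_eq_zero_right hz).symm
  rw [hyx, sub_neg_eq_add, ← two_smul ℝ x, norm_smul, hx] at hd2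
  norm_num at hd2

/-- At an extremal pair the first strictness alternative is contradictory, and the Hessians
agree under reflection. -/
lemma M_eq (S : Setup n φ h) {m : ℝ} (hm0 : 0 < m)
    (hall : ∀ x y : Esp n, ‖x‖ = 1 → ‖y‖ = 1 → h x - h y ≤ m * ‖x - y‖)
    {x y : Esp n} (hx : ‖x‖ = 1) (hy : ‖y‖ = 1) (hxy : x ≠ y) (hd2 : ‖x - y‖ < 2)
    (heq : h x - h y = m * ‖x - y‖) :
    (¬ (∀ x y : ℝ, 0 < x → 0 < y → 0 < deriv (fun t => φ t y) x)) ∧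
    ∀ v : Esp n, ‖v‖ = 1 → ⟪v, x⟫ = 0 → D2 n h x v v = D2 n h y (Rf x y v) (Rf x y v) := by
  obtain ⟨l, L, hl, hL, hb⟩ := S.toHData.exists_bounds
  obtain ⟨px, py⟩ := S.M_grad hm0 hall hx hy hxy heq
  have hz := add_ne_of_lt hx hd2
  have hρ : 0 < ‖x + y‖ := norm_pos_iff.2 hz
  have hdp := norm_sub_pos hxy
  have hyp : 0 < h y := S.pos y (by simpa using hy)
  have hh : h y < h x := by nlinarith [mul_pos hm0 hdp]
  have hpp : 0 < m * ‖x + y‖ / 2 := by positivity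
  have hle : ∀ v : Esp n, ‖v‖ = 1 → ⟪v, x⟫ = 0 →
      D2 n h x v v - D2 n h y (Rf x y v) (Rf x y v) ≤ 0 := by
    intro v hv hvx
    have := S.M_tau hm0 hall hx hy hxy heq hv hvx 0
    simp at this; linarith
  have hsig : sigmaElem n n h y ≤ sigmaElem n n h x := by
    rw [S.sig x hx, S.sig y hy, px, py]; exact S.mono1 hyp hpp hh.le
  constructor
  · intro hs
    obtain ⟨h1, h2⟩ := S.toHData.compare hx hy (Rf x y) (Rf_x hx hy) 0 hl hL hb
      (K1 := 0) (K2 := 0) le_rfl le_rfl (fun v hv hvx => by simpa using hle v hv hvx)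
    simp only [mul_zero, zero_div, zero_mul, sub_zero, Real.exp_zero, mul_one] at h1
    rw [S.sig x hx, S.sig y hy, px, py] at h1
    have := S.smono1 hs hyp hpp hh
    linarith
  · intro v0 hv0 hv0x
    by_contra hne
    have hx0 := ne_zero_of_unit hx
    have hy0 := ne_zero_of_unit hy
    set N : Esp n → Esp n → ℝ := fun u v => D2 n h y (Rf x y u) (Rf x y v) - D2 n h x u v with hN
    have hsymm : ∀ u v, N u v = N v u := by
      intro u v; simp only [hN]; rw [S.toHData.symm2 hy0, S.toHData.symm2 hx0]
    have hpos : ∀ v, ⟪v, x⟫ = 0 → 0 ≤ N v v := by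
      intro v hvx
      by_cases hv : v = 0
      · simp [hN, hv]
      have hvn : 0 < ‖v‖ := norm_pos_iff.2 hv
      have h1 := hle (‖v‖⁻¹ • v) (by rw [norm_smul, norm_inv, norm_norm, inv_mul_cancel₀ hvn.ne'])
        (by rw [inner_smul_left, hvx]; simp)
      simp only [map_smul, ContinuousLinearMap.smul_apply, smul_eq_mul] at h1
      have h2 : -(‖v‖⁻¹ * ‖v‖⁻¹) * N v v ≤ 0 := by
        refine le_of_eq_of_le ?_ h1
        simp only [hN]; ring
      have h3 : 0 < ‖v‖⁻¹ * ‖v‖⁻¹ := by positivity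
      nlinarith
    have hN0 : 0 < N v0 v0 := by
      apply lt_of_le_of_ne (hpos v0 hv0x)
      intro e; apply hne; simp only [hN] at e; linarith
    have hCS : ∀ v, ⟪v, x⟫ = 0 → N v v0 ^ 2 / N v0 v0 ≤ N v v := by
      intro v hvx
      have h1 := hpos (v - (N v v0 / N v0 v0) • v0) (by
        rw [inner_sub_left, inner_smul_left, hvx, hv0x]; simp)
      have h2 : ∀ k : ℝ, N (v - k • v0) (v - k • v0) = N v v - 2 * k * N v v0 + k ^ 2 * N v0 v0 := by
        intro k
        have e : N (v - k • v0) (v - k • v0) = N v v - k * N v v0 - k * N v0 v + k ^ 2 * N v0 v0 := by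
          simp only [hN, map_sub, map_smul, ContinuousLinearMap.sub_apply,
            ContinuousLinearMap.smul_apply, smul_eq_mul]
          ring
        rw [e, hsymm v0 v]; ring
      rw [h2] at h1
      have h3 : N v v - 2 * (N v v0 / N v0 v0) * N v v0 + (N v v0 / N v0 v0) ^ 2 * N v0 v0
        = N v v - N v v0 ^ 2 / N v0 v0 := by field_simp; ring
      rw [h3] at h1
      linarith
    let ℓ : Esp n →L[ℝ] ℝ :=
      (D2 n h y (Rf x y v0)).comp ((Rf x y).toContinuousLinearEquiv : Esp n →L[ℝ] Esp n) - D2 n h x v0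
    set u := (InnerProductSpace.toDual ℝ (Esp n)).symm ℓ with hu
    have hui : ∀ v, ⟪v, u⟫ = N v v0 := by
      intro v
      rw [real_inner_comm, hu, InnerProductSpace.toDual_symm_apply, hsymm]
      rfl
    obtain ⟨h1, h2⟩ := S.toHData.compare hx hy (Rf x y) (Rf_x hx hy) u hl hL hb
      (K1 := 1 / N v0 v0) (K2 := 0) (by positivity) le_rfl (fun v hv hvx => by
        have h3 := hCS v hvx
        have h4 : D2 n h x v v - D2 n h y (Rf x y v) (Rf x y v) = - N v v := by simp only [hN]; ring
        rw [h4, hui, one_div_mul_eq_div]; linarith)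
    have hne0 : u - ⟪u, x⟫ • x ≠ 0 := by
      intro e
      have h3 : ⟪v0, u - ⟪u, x⟫ • x⟫ = N v0 v0 := by
        rw [inner_sub_right, inner_smul_right, hv0x, hui]; ring
      rw [e, inner_zero_right] at h3; linarith
    have h5 : 0 < ‖u - ⟪u, x⟫ • x‖ := norm_pos_iff.2 hne0
    have h6 : Real.exp (n * 0 / l - 1 / N v0 v0 * ‖u - ⟪u, x⟫ • x‖ ^ 2 / L) < 1 := by
      rw [Real.exp_lt_one_iff, mul_zero, zero_div]
      have : 0 < 1 / N v0 v0 * ‖u - ⟪u, x⟫ • x‖ ^ 2 / L := by positivity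
      linarith
    nlinarith

lemma M_hess (S : Setup n φ h) {m : ℝ} (hm0 : 0 < m)
    (hall : ∀ x y : Esp n, ‖x‖ = 1 → ‖y‖ = 1 → h x - h y ≤ m * ‖x - y‖)
    {x y : Esp n} (hx : ‖x‖ = 1) (hy : ‖y‖ = 1) (hxy : x ≠ y) (hd2 : ‖x - y‖ < 2)
    (heq : h x - h y = m * ‖x - y‖) :
    (∀ v : Esp n, ‖v‖ = 1 → ⟪v, x⟫ = 0 → D2 n h x v v = (h x + h y) / 2) ∧
    (∀ v : Esp n, ‖v‖ = 1 → ⟪v, y⟫ = 0 → D2 n h y v v = (h x + h y) / 2) := by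
  have hE := (S.M_eq hm0 hall hx hy hxy hd2 heq).2
  have h1 : ∀ v : Esp n, ‖v‖ = 1 → ⟪v, x⟫ = 0 → D2 n h x v v = (h x + h y) / 2 := by
    intro v hv hvx
    have := tau_aux (e := D2 n h x v v - (h x + h y) / 2) (M := m / ‖x - y‖) (fun τ => by
      have := S.M_tau hm0 hall hx hy hxy heq hv hvx τ
      rw [← hE v hv hvx] at this
      linarith)
    linarith
  refine ⟨h1, ?_⟩
  intro v hv hvy
  have hp : ⟪Rf x y v, x⟫ = 0 := by
    calc ⟪Rf x y v, x⟫ = ⟪Rf x y v, Rf x y y⟫ := by rw [Rf_y hx hy]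
      _ = ⟪v, y⟫ := LinearIsometryEquiv.inner_map_map _ _ _
      _ = 0 := hvy
  have h2 := hE (Rf x y v) (by rw [norm_Rf, hv]) hp
  rw [Rf_Rf] at h2
  rw [← h2]
  exact h1 _ (by rw [norm_Rf, hv]) hp

/-- Ordering of the mean values of extremal pairs. -/
lemma M_order (S : Setup n φ h) {m : ℝ} (hm0 : 0 < m)
    (hall : ∀ x y : Esp n, ‖x‖ = 1 → ‖y‖ = 1 → h x - h y ≤ m * ‖x - y‖)
    (hs2 : ∀ x y : ℝ, 0 < x → 0 < y → 0 < deriv (fun s => φ x s) y)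
    {x y x' y' : Esp n} (hx : ‖x‖ = 1) (hy : ‖y‖ = 1) (hx' : ‖x'‖ = 1) (hy' : ‖y'‖ = 1)
    (h1 : 1 ≤ ‖x - y‖) (h12 : ‖x - y‖ < ‖x' - y'‖) (h2 : ‖x' - y'‖ < 2)
    (heq : h x - h y = m * ‖x - y‖) (heq' : h x' - h y' = m * ‖x' - y'‖) :
    h x' + h y' < h x + h y := by
  obtain ⟨l, L, hl, hL, hb⟩ := S.toHData.exists_bounds
  have hxy : x ≠ y := by rintro rfl; simp at h1; linarith
  have hxy' : x' ≠ y' := by rintro rfl; simp at h12; linarith [norm_nonneg (x - y)]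
  have p := (S.M_grad hm0 hall hx hy hxy heq).1
  have p' := (S.M_grad hm0 hall hx' hy' hxy' heq').2
  have H := (S.M_hess hm0 hall hx hy hxy (h12.trans h2) heq).1
  have H' := (S.M_hess hm0 hall hx' hy' hxy' h2 heq').2
  have hρ' : 0 < ‖x' + y'‖ := norm_pos_iff.2 (add_ne_of_lt hx' h2)
  have hρ : ‖x' + y'‖ < ‖x + y‖ := by
    have e1 := norm_sub_sq_unit hx hy
    have e2 := norm_add_sq_unit hx hy
    have e3 := norm_sub_sq_unit hx' hy'
    have e4 := norm_add_sq_unit hx' hy'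
    apply lt_of_pow_lt_pow_left₀ 2 (norm_nonneg _)
    have : ‖x - y‖ ^ 2 < ‖x' - y'‖ ^ 2 := by gcongr
    linarith
  by_contra hcon
  push Not at hcon
  -- `h y' ≤ h x`
  have hosc : h y' ≤ h x := by
    have := hall x' y hx' hy
    have := mul_le_mul_of_nonneg_left (norm_le_two hx' hy) hm0.le
    have := mul_le_mul_of_nonneg_left h1 hm0.le
    have := mul_le_mul_of_nonneg_left h12.le hm0.le
    linarith
  have hy'p : 0 < h y' := S.pos y' (by simpa using hy')
  have hxp : 0 < h x := S.pos x (by simpa using hx)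
  have hlt : sigmaElem n n h y' < sigmaElem n n h x := by
    rw [S.sig x hx, S.sig y' hy', p, p']
    calc φ (h y') (m * ‖x' + y'‖ / 2) ≤ φ (h x) (m * ‖x' + y'‖ / 2) :=
          S.mono1 hy'p (by positivity) hosc
      _ < _ := S.smono2 hs2 hxp (by positivity) (by gcongr)
  obtain ⟨h3, -⟩ := S.toHData.compare hx hy' (Rf x y') (Rf_x hx hy') 0 hl hL hb
      (K1 := 0) (K2 := 0) le_rfl le_rfl (fun v hv hvx => by
        rw [H v hv hvx, H' (Rf x y' v) (by rw [norm_Rf, hv]) (Rf_perp hx hy' hvx)]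
        linarith)
  simp only [mul_zero, zero_div, zero_mul, sub_zero, Real.exp_zero, mul_one] at h3
  linarith

end Setup

/-! ### Step F: the perturbed functional -/

/-- The quadratic error term. -/
def Qf (n : ℕ) (h : Esp n → ℝ) (x y v : Esp n) : ℝ :=
  2 * ⟪v, wv x y⟫ * (fderiv ℝ h x v + fderiv ℝ h y (Rf x y v)) +
    ‖x - y‖ / 2 * (D2 n h x v v + D2 n h y (Rf x y v) (Rf x y v) - (h x + h y))

namespace Setup

variable {n : ℕ} {φ : ℝ → ℝ → ℝ} {h : Esp n → ℝ}

set_option maxHeartbeats 1000000 in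
lemma F_local (S : Setup n φ h) {ε Λ lam : ℝ} (hε : 0 < ε) (hε1 : ε < 1) (hΛ : 0 < Λ)
    (hlam : 0 < lam) {x y : Esp n} (hx : ‖x‖ = 1) (hy : ‖y‖ = 1) (hd : 1 < ‖x - y‖)
    (hd2 : ‖x - y‖ < 2)
    (hmax : ∀ x' y' : Esp n, ‖x'‖ = 1 → ‖y'‖ = 1 → 1 ≤ ‖x' - y'‖ →
      h x' - h y' + ε * (Λ * ‖x' + y'‖) ≤ ‖x' - y'‖ * (lam + ε / 2 * (h x' + h y')))
    (heq : h x - h y + ε * (Λ * ‖x + y‖) = ‖x - y‖ * (lam + ε / 2 * (h x + h y))) :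
    ‖sphGrad n h x‖ * (1 - ε * (‖x - y‖ / 2)) = ‖sphGrad n h y‖ * (1 + ε * (‖x - y‖ / 2)) ∧
    ∀ v : Esp n, ‖v‖ = 1 → ⟪v, x⟫ = 0 →
      D2 n h x v v - D2 n h y (Rf x y v) (Rf x y v) ≤ ε * Qf n h x y v := by
  have hdp : 0 < ‖x - y‖ := by linarith
  have hxy : x ≠ y := by intro e; rw [e] at hdp; simp at hdp
  have hz : x + y ≠ 0 := add_ne_of_lt hx hd2
  have hρ : 0 < ‖x + y‖ := norm_pos_iff.2 hz
  have hhx : 0 < h x := S.pos x (by simpa using hx)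
  have hhy : 0 < h y := S.pos y (by simpa using hy)
  set μ := lam + ε / 2 * (h x + h y) with hμ
  have hμp : 0 < μ := by positivity
  constructor
  · set d := ‖x - y‖ with hdd
    set ρ := ‖x + y‖ with hρρ
    set κ := μ / d + ε * Λ / ρ with hκ
    have hκpos : 0 < κ := by positivity
    have FO : ∀ (x y : Esp n) (k : ℝ), ‖x‖ = 1 → ‖y‖ = 1 → ‖x - y‖ = d → ‖x + y‖ = ρ →
        μ = lam + ε / 2 * (h x + h y) →
        (∀ z : Esp n, ‖z‖ = 1 → 1 ≤ ‖z - y‖ →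
          k * h z - k * h y + ε * (Λ * ‖z + y‖) ≤ ‖z - y‖ * (lam + ε / 2 * (h z + h y))) →
        k * h x - k * h y + ε * (Λ * ρ) = d * μ →
        ∀ v, ‖v‖ = 1 → ⟪v, x⟫ = 0 → (k - ε * (d / 2)) * fderiv ℝ h x v = -κ * ⟪v, y⟫ := by
      intro x y k hx hy hdxy hρxy hμ hm he v hv hvx
      have hz : x + y ≠ 0 := by rw [← norm_pos_iff, hρxy]; exact hρ
      have hhy : 0 < h y := S.pos y (by simpa using hy)
      have hxyi : d ^ 2 = 2 - 2 * ⟪x, y⟫ := by rw [← hdxy]; exact norm_sub_sq_unit hx hy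
      have jh := S.toHData.jet_circ hx hv hvx
      have ji := jet_inner_circ x v y
      have jf := jet_inner_circ x v (fv x y)
      have ju := ((((Jet2.const 2).sub (ji.smul 2)).smul (1 / d)).add (Jet2.const d)).smul (1 / 2)
      have yf : ⟪y, fv x y⟫ = ρ / 2 := by
        rw [fv_comm, inner_x_fv hy hx (by rwa [add_comm y x]), add_comm y x, hρxy]
      have xf : ⟪x, fv x y⟫ = ρ / 2 := by rw [inner_x_fv hx hy hz, hρxy]
      have jg := ((jh.add (Jet2.const (h y))).smul (ε / 2)).add (Jet2.const lam)
      have J := (((jh.smul k).add (Jet2.const (-(k * h y)))).add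
        ((jf.add (Jet2.const (ρ / 2))).smul (ε * Λ))).sub (ju.mul jg)
      have e0 : 1 / 2 * (1 / d * (2 - 2 * ⟪x, y⟫) + d) = d := by
        rw [← hxyi]; field_simp; norm_num
      have J' := J.congr (fun s => rfl) (a' := 0) (by
        rw [e0, xf, add_comm _ lam, ← hμ]; linarith) rfl rfl
      have := (J'.max (by
        filter_upwards [ev_norm_gt v (by rw [hdxy]; exact hd : 1 < ‖x - y‖)] with s hs
        have hzn := norm_circ hx hv hvx s
        have hhz : 0 < h (circ x v s) := S.pos _ (by simpa using hzn)
        have h1 := hm _ hzn hs.le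
        have h2 := norm_le_maj (a := ‖circ x v s - y‖) hdp
        rw [norm_sub_sq_unit hzn hy] at h2
        have h3 : ‖circ x v s - y‖ * (lam + ε / 2 * (h (circ x v s) + h y)) ≤
          ((2 - 2 * ⟪circ x v s, y⟫) / d + d) / 2 * (lam + ε / 2 * (h (circ x v s) + h y)) := by
          gcongr
        have h4 := inner_fv_le hz (circ x v s + y)
        rw [inner_add_left, yf] at h4
        have h5 := mul_le_mul_of_nonneg_left h4 (mul_pos hε hΛ).le
        have h6 : ((2 - 2 * ⟪circ x v s, y⟫) / d + d) / 2 * (lam + ε / 2 * (h (circ x v s) + h y))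
          = 1 / 2 * (1 / d * (2 - 2 * ⟪circ x v s, y⟫) + d) * (ε / 2 * (h (circ x v s) + h y) + lam) := by
          ring
        linarith)).1
      rw [e0, inner_v_fv hvx, hρxy, add_comm _ lam, ← hμ] at this
      rw [hκ]
      have e : 1 / 2 * (1 / d * (0 - 2 * ⟪v, y⟫) + 0) * μ = - (μ / d) * ⟪v, y⟫ := by
        field_simp; ring
      rw [e] at this
      linear_combination this
    have ht1 : 0 < 1 - ε * (d / 2) := by nlinarith
    have ht2 : 0 < 1 + ε * (d / 2) := by positivity
    have fx := FO x y 1 hx hy rfl rfl rfl (fun z hz hzd => by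
      have := hmax z y hz hy hzd; linarith) (by linarith)
    have fy := FO y x (-1) hy hx (by rw [norm_sub_rev]) (by rw [add_comm y x])
      (by rw [add_comm (h y)]) (fun z hz hzd => by
      rw [norm_sub_rev] at hzd ⊢
      have := hmax x z hx hz hzd
      rw [add_comm z x, add_comm (h z)]
      linarith) (by linarith)
    have px := S.toHData.norm_grad hx hy (-κ / (1 - ε * (d / 2))) (fun v hv hvx => by
      have := fx v hv hvx
      rw [div_mul_eq_mul_div, eq_div_iff ht1.ne']; linarith)
    have py := S.toHData.norm_grad hy hx (κ / (1 + ε * (d / 2))) (fun v hv hvx => by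
      have := fy v hv hvx
      rw [div_mul_eq_mul_div, eq_div_iff ht2.ne']; linarith)
    rw [neg_div, abs_neg, abs_of_pos (by positivity)] at px
    rw [real_inner_comm, abs_of_pos (by positivity)] at py
    rw [px, py]
    generalize 1 - ε * (d / 2) = A at ht1 ⊢
    generalize 1 + ε * (d / 2) = B at ht2 ⊢
    field_simp
  · intro v hv hvx
    have hRv : ‖Rf x y v‖ = 1 := by rw [norm_Rf, hv]
    have hRy : ⟪Rf x y v, y⟫ = 0 := Rf_perp hx hy hvx
    have j1 := S.toHData.jet_circ hx hv hvx
    have j2 := S.toHData.jet_circ hy hRv hRy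
    have jD := jet_inner_circ x v (wv x y)
    have jf := jet_inner_circ x v (fv x y)
    rw [inner_x_wv hx hy hxy] at jD
    rw [inner_x_fv hx hy hz] at jf
    have J := ((j1.sub j2).add (jf.smul (2 * (ε * Λ)))).sub
      ((jD.smul 2).mul (((j1.add j2).smul (ε / 2)).add (Jet2.const lam)))
    have J' := J.congr (fun s => rfl) (a' := 0) (by
      rw [add_comm _ lam, ← hμ]; linarith) rfl rfl
    have := (J'.max (by
      filter_upwards [ev_inner_pos hx hy hxy v hd] with s hs1
      have hzn := norm_circ hx hv hvx s
      have hdist := sub_Rf hxy (circ x v s)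
      rw [abs_of_pos (by linarith)] at hdist
      have := hmax (circ x v s) (Rf x y (circ x v s)) hzn (by rw [norm_Rf, hzn])
        (by rw [hdist]; exact hs1.le)
      rw [hdist] at this
      have h4 := inner_fv_le hz (circ x v s + Rf x y (circ x v s))
      rw [add_Rf_inner hx hy hxy] at h4
      have h5 := mul_le_mul_of_nonneg_left h4 (mul_pos hε hΛ).le
      rw [← Rf_circ hx hy]
      linarith)).2
    rw [add_comm _ lam, ← hμ] at this
    unfold Qf
    linarith

end Setup

/-! ### Step F: limits of maximisers -/

open Filter Topology in
lemma abs_limit {X : Type*} [MetricSpace X] {K : Set X} (hK : IsCompact K) {Z Ψ : X → ℝ}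
    (hZ : ContinuousOn Z K) (hΨ : ContinuousOn Ψ K) {m : ℝ} (hZm : ∀ q ∈ K, Z q ≤ m)
    {q0 : X} (hq0 : q0 ∈ K) (hq0m : Z q0 = m) :
    ∃ (e : ℕ → ℝ) (P : ℕ → X) (p : X), Tendsto e atTop (𝓝 0) ∧ (∀ k, 0 < e k) ∧
      (∀ k, e k < 1) ∧ Tendsto P atTop (𝓝 p) ∧ (∀ k, P k ∈ K) ∧ p ∈ K ∧ Z p = m ∧
      (∀ q ∈ K, Z q = m → Ψ q ≤ Ψ p) ∧
      ∀ k, ∀ q ∈ K, Z q + e k * Ψ q ≤ Z (P k) + e k * Ψ (P k) := by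
  have hex : ∀ k : ℕ, ∃ p ∈ K, ∀ q ∈ K, Z q + 1 / ((k : ℝ) + 2) * Ψ q
      ≤ Z p + 1 / ((k : ℝ) + 2) * Ψ p := by
    intro k
    obtain ⟨p, hp, hm⟩ := hK.exists_isMaxOn ⟨q0, hq0⟩
      (f := fun p => Z p + 1 / ((k : ℝ) + 2) * Ψ p) (hZ.add (continuousOn_const.mul hΨ))
    exact ⟨p, hp, fun q hq => hm hq⟩
  choose P0 hP0 hmax using hex
  obtain ⟨p, hp, g, hg, hlim⟩ := hK.tendsto_subseq hP0
  have he0 : Tendsto (fun k : ℕ => 1 / ((k : ℝ) + 2)) atTop (𝓝 0) := by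
    simp_rw [one_div]
    exact tendsto_inv_atTop_zero.comp
      (tendsto_atTop_add_const_right _ _ tendsto_natCast_atTop_atTop)
  have he := he0.comp hg.tendsto_atTop
  have hepos : ∀ k : ℕ, 0 < 1 / (((g k : ℕ) : ℝ) + 2) := fun k => by positivity
  have hw : Tendsto (P0 ∘ g) atTop (𝓝[K] p) :=
    tendsto_nhdsWithin_iff.2 ⟨hlim, Eventually.of_forall fun k => hP0 _⟩
  have hZl : Tendsto (fun k => Z (P0 (g k))) atTop (𝓝 (Z p)) := (hZ p hp).tendsto.comp hw
  have hΨl : Tendsto (fun k => Ψ (P0 (g k))) atTop (𝓝 (Ψ p)) := (hΨ p hp).tendsto.comp hw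
  refine ⟨fun k => 1 / (((g k : ℕ) : ℝ) + 2), P0 ∘ g, p, he, hepos, ?_, hlim,
    fun k => hP0 _, hp, ?_, ?_, fun k q hq => hmax _ q hq⟩
  · intro k
    rw [div_lt_one (by positivity)]
    have : (0:ℝ) ≤ (g k : ℕ) := by positivity
    linarith
  · apply le_antisymm (hZm p hp)
    have h1 : Tendsto (fun k => Z q0 + 1 / (((g k : ℕ) : ℝ) + 2) * Ψ q0) atTop
        (𝓝 (Z q0 + 0 * Ψ q0)) := tendsto_const_nhds.add (he.mul tendsto_const_nhds)
    have h2 : Tendsto (fun k => Z (P0 (g k)) + 1 / (((g k : ℕ) : ℝ) + 2) * Ψ (P0 (g k))) atTop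
        (𝓝 (Z p + 0 * Ψ p)) := hZl.add (he.mul hΨl)
    have := le_of_tendsto_of_tendsto' h1 h2 (fun k => hmax _ q0 hq0)
    rw [← hq0m]; linarith
  · intro q hq hqm
    refine ge_of_tendsto' hΨl (fun k => ?_)
    have h1 := hmax (g k) q hq
    have h2 := hZm _ (hP0 (g k))
    have h3 := hepos k
    rw [hqm] at h1
    exact le_of_mul_le_mul_left (by linarith) h3

/-- The perturbation functional. -/
def Psi (n : ℕ) (h : Esp n → ℝ) (Λ : ℝ) (p : Esp n × Esp n) : ℝ :=
  -((h p.1 + h p.2) / 2) + Λ * ‖p.1 + p.2‖ / ‖p.1 - p.2‖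

/-- The two-point quotient. -/
def Zf (n : ℕ) (h : Esp n → ℝ) (p : Esp n × Esp n) : ℝ :=
  (h p.1 - h p.2) / ‖p.1 - p.2‖

namespace Setup

variable {n : ℕ} {φ : ℝ → ℝ → ℝ} {h : Esp n → ℝ}

lemma cont_Zf (S : Setup n φ h) : ContinuousOn (Zf n h) (Kset n 1 2) := by
  unfold Zf
  refine ((S.cont1 1 2).sub (S.cont2 1 2)).div (by fun_prop) ?_
  rintro p ⟨-, -, h1, -⟩; linarith

lemma cont_Psi (S : Setup n φ h) (Λ : ℝ) : ContinuousOn (Psi n h Λ) (Kset n 1 2) := by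
  unfold Psi
  refine (((S.cont1 1 2).add (S.cont2 1 2)).div_const 2).neg.add ?_
  refine ContinuousOn.div (by fun_prop) (by fun_prop) ?_
  rintro p ⟨-, -, h1, -⟩; linarith

set_option maxHeartbeats 1000000 in
open Filter Topology in
/-- The limit of maximisers of the perturbed functional. -/
lemma F_limit (S : Setup n φ h) {m : ℝ} (hm0 : 0 < m)
    {z : Esp n} (hz : ‖z‖ = 1) (hzm : h z - h (-z) = 2 * m)
    (hall : ∀ x y : Esp n, ‖x‖ = 1 → ‖y‖ = 1 → h x - h y ≤ m * ‖x - y‖)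
    (hs2 : ∀ x y : ℝ, 0 < x → 0 < y → 0 < deriv (fun s => φ x s) y) :
    ∃ (Λ : ℝ) (e : ℕ → ℝ) (P : ℕ → Esp n × Esp n) (p : Esp n × Esp n), 0 < Λ ∧
      Tendsto e atTop (𝓝 0) ∧ (∀ k, 0 < e k) ∧
      (∀ k, e k < 1) ∧ Tendsto P atTop (𝓝 p) ∧ (∀ k, P k ∈ Kset n 1 2) ∧ p ∈ Kset n 1 2 ∧
      Zf n h p = m ∧ 1 < ‖p.1 - p.2‖ ∧ ‖p.1 - p.2‖ < 2 ∧
      ∀ k, ∀ q ∈ Kset n 1 2,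
        Zf n h q + e k * Psi n h Λ q ≤ Zf n h (P k) + e k * Psi n h Λ (P k) := by
  obtain ⟨a2, b2, ha2, hb2, hd2, he2⟩ := S.stepA hm0 hz hzm hall (d0 := 3 / 2)
    (by norm_num) (by norm_num)
  obtain ⟨a1, b1, ha1, hb1, hd1, he1⟩ := S.stepA hm0 hz hzm hall (d0 := 1)
    (by norm_num) (by norm_num)
  have hcont : ContinuousOn (fun p : Esp n × Esp n => h p.1 - h p.2) (Kset n 1 1) :=
    (S.cont1 1 1).sub (S.cont2 1 1)
  have hcl : IsCompact (Kset n 1 1 ∩ (fun p : Esp n × Esp n => h p.1 - h p.2) ⁻¹' {m}) :=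
    (isCompact_Kset n 1 1).of_isClosed_subset
      (hcont.preimage_isClosed_of_isClosed (isCompact_Kset n 1 1).isClosed isClosed_singleton)
      Set.inter_subset_left
  obtain ⟨r, hr, hrmin⟩ := hcl.exists_isMinOn
    ⟨(a1, b1), ⟨ha1, hb1, hd1.ge, hd1.le⟩, by simpa using he1⟩
    (f := fun p => h p.1 + h p.2)
    (((S.cont1 1 1).add (S.cont2 1 1)).mono Set.inter_subset_left)
  obtain ⟨⟨hr1, hr2, hr3, hr4⟩, hrm⟩ := hr
  have hrd : ‖r.1 - r.2‖ = 1 := le_antisymm hr4 hr3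
  have hrm' : h r.1 - h r.2 = m := hrm
  have hord := S.M_order hm0 hall hs2 hr1 hr2 ha2 hb2 hr3 (by rw [hrd, hd2]; norm_num)
    (by rw [hd2]; norm_num) (by rw [hrd, hrm', mul_one]) (by rw [hd2, he2])
  set Λ := ((h r.1 + h r.2) - (h a2 + h b2)) / 4 with hΛ
  have hΛp : 0 < Λ := by rw [hΛ]; linarith
  have hP2 : (a2, b2) ∈ Kset n 1 2 := ⟨ha2, hb2, by simp only [hd2]; norm_num, by simp only [hd2]; norm_num⟩
  have hZ2 : Zf n h (a2, b2) = m := by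
    unfold Zf; simp only [hd2, he2]; field_simp
  have hZle : ∀ q ∈ Kset n 1 2, Zf n h q ≤ m := by
    rintro q ⟨q1, q2, q3, q4⟩
    unfold Zf
    rw [div_le_iff₀ (by linarith)]
    exact hall _ _ q1 q2
  obtain ⟨e, P, p, h1, h2, h3, h4, h5, h6, h7, h8, h9⟩ :=
    abs_limit (isCompact_Kset n 1 2) S.cont_Zf (S.cont_Psi Λ) hZle hP2 hZ2
  refine ⟨Λ, e, P, p, hΛp, h1, h2, h3, h4, h5, h6, h7, ?_, ?_, h9⟩
  · obtain ⟨p1, p2, p3, p4⟩ := h6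
    rcases p3.lt_or_eq with h' | h'
    · exact h'
    exfalso
    have hh := h8 _ hP2 hZ2
    have hpm : h p.1 - h p.2 = m := by
      unfold Zf at h7; rw [← h', div_one] at h7; exact h7
    have hmin : h r.1 + h r.2 ≤ h p.1 + h p.2 :=
      hrmin (show p ∈ _ from ⟨⟨p1, p2, h'.le, h'.ge⟩, hpm⟩)
    unfold Psi at hh
    simp only [hd2, ← h', div_one] at hh
    have hρ : ‖p.1 + p.2‖ < 2 := by
      have e1 := norm_sub_sq_unit p1 p2
      have e2 := norm_add_sq_unit p1 p2
      rw [← h'] at e1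
      nlinarith [norm_nonneg (p.1 + p.2)]
    have t1 : 0 ≤ Λ * ‖a2 + b2‖ / (3 / 2) := by positivity
    have t2 : Λ * ‖p.1 + p.2‖ < Λ * 2 := mul_lt_mul_of_pos_left hρ hΛp
    linarith
  · obtain ⟨p1, p2, p3, p4⟩ := h6
    rcases p4.lt_or_eq with h' | h'
    · exact h'
    exfalso
    set s := min (1 / 2) (Λ ^ 2 / m ^ 2) with hs
    have hs0 : 0 < s := lt_min (by norm_num) (by positivity)
    have hs1 : s ≤ 1 / 2 := min_le_left _ _
    have hs2 : m ^ 2 * s ≤ Λ ^ 2 := by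
      have : s ≤ Λ ^ 2 / m ^ 2 := min_le_right _ _
      rw [le_div_iff₀ (by positivity)] at this; linarith
    obtain ⟨a, b, ha, hb, hd, he⟩ := S.stepA hm0 hz hzm hall (d0 := 2 * (1 - s))
      (by linarith) (by linarith)
    have hq : (a, b) ∈ Kset n 1 2 := ⟨ha, hb, by simp only [hd]; linarith, by simp only [hd]; linarith⟩
    have hZq : Zf n h (a, b) = m := by
      unfold Zf; simp only [hd, he]
      rw [mul_div_assoc, div_self (by linarith), mul_one]
    have hh := h8 _ hq hZq
    have hpy := eq_neg_of_norm_two p1 p2 h'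
    have hpm : h p.1 - h p.2 = 2 * m := by
      unfold Zf at h7; rw [h'] at h7; linarith
    have hap : h a ≤ h p.1 := by
      have t1 := hall a p.2 ha p2
      have t2 := norm_le_two ha p2
      have t3 : m * ‖a - p.2‖ ≤ m * 2 := mul_le_mul_of_nonneg_left t2 hm0.le
      linarith
    have hρ0 : ‖p.1 + p.2‖ = 0 := by rw [hpy]; simp
    unfold Psi at hh
    simp only [hd, hρ0, h'] at hh
    have hkey : m * (2 * s) < Λ * ‖a + b‖ := by
      have e1 := norm_sub_sq_unit ha hb
      have e2 := norm_add_sq_unit ha hb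
      rw [hd] at e1
      by_contra hcon
      push Not at hcon
      have h10 : (Λ * ‖a + b‖) ^ 2 ≤ (m * (2 * s)) ^ 2 :=
        pow_le_pow_left₀ (by positivity) hcon 2
      have h11 : ‖a + b‖ ^ 2 = 4 * s * (2 - s) := by linarith
      rw [mul_pow, h11] at h10
      have h12 : (4 * s) * (Λ ^ 2 * (2 - s)) ≤ (4 * s) * (m ^ 2 * s) := by linarith
      have h13 := le_of_mul_le_mul_left h12 (by positivity)
      have h14 : 0 < Λ ^ 2 * (1 - s) := mul_pos (by positivity) (by linarith)
      linarith
    have h14 : Λ * ‖a + b‖ / 2 ≤ Λ * ‖a + b‖ / (2 * (1 - s)) := by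
      apply div_le_div_of_nonneg_left (by positivity) (by linarith) (by linarith)
    simp only [mul_zero, zero_div, add_zero] at hh
    linarith

end Setup

/-! ### Step F: the contradiction -/

namespace Setup

variable {n : ℕ} {φ : ℝ → ℝ → ℝ} {h : Esp n → ℝ}

open Filter Topology in
lemma phi_lower (S : Setup n φ h)
    (hs2 : ∀ x y : ℝ, 0 < x → 0 < y → 0 < deriv (fun s => φ x s) y)
    {a0 p0 : ℝ} (ha : 0 < a0) (hp : 0 < p0) :
    ∃ γ δ : ℝ, 0 < γ ∧ 0 < δ ∧ ∀ a t s : ℝ, |a - a0| < δ → |t - p0| < δ → |s - p0| < δ → t ≤ s →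
      φ a t + γ * (s - t) ≤ φ a s := by
  set D : ℝ × ℝ → ℝ := fun q => fderiv ℝ (fun p : ℝ × ℝ => φ p.1 p.2) q (0, 1) with hD
  have hD0 : 0 < D (a0, p0) := by
    have := hs2 a0 p0 ha hp
    rwa [(S.deriv2 ha hp).deriv] at this
  have hc : ContinuousAt D (a0, p0) := by
    have h1 := ((S.cdaφ ha hp).fderiv_right (m := 0) (by norm_num)).continuousAt
    exact h1.clm_apply continuousAt_const
  have hev : ∀ᶠ q in 𝓝 (a0, p0), (D (a0, p0) / 2 < D q ∧ 0 < q.1) ∧ 0 < q.2 :=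
    ((hc.eventually_const_lt (half_lt_self hD0)).and
      (continuousAt_fst.eventually_const_lt ha)).and (continuousAt_snd.eventually_const_lt hp)
  obtain ⟨δ, hδ, hb⟩ := Metric.eventually_nhds_iff.1 hev
  have hb' : ∀ a t, |a - a0| < δ → |t - p0| < δ → (D (a0, p0) / 2 < D (a, t) ∧ 0 < a) ∧ 0 < t := by
    intro a t h1 h2
    refine hb (y := (a, t)) ?_
    rw [Prod.dist_eq, max_lt_iff, Real.dist_eq, Real.dist_eq]
    exact ⟨h1, h2⟩
  refine ⟨D (a0, p0) / 2, δ, half_pos hD0, hδ, ?_⟩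
  intro a t s h1 h2 h3 hts
  have hder : ∀ u ∈ Metric.ball p0 δ, HasDerivAt (fun t => φ a t) (D (a, u)) u := by
    intro u hu
    rw [Metric.mem_ball, Real.dist_eq] at hu
    obtain ⟨⟨-, q1⟩, q2⟩ := hb' a u h1 hu
    exact S.deriv2 q1 q2
  have := Convex.mul_sub_le_image_sub_of_le_deriv (convex_ball p0 δ) (f := fun t => φ a t)
    (C := D (a0, p0) / 2)
    (fun u hu => (hder u hu).continuousAt.continuousWithinAt)
    (fun u hu => (hder u (interior_subset hu)).differentiableAt.differentiableWithinAt)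
    (fun u hu => by
      have hu' := interior_subset hu
      rw [(hder u hu').deriv]
      rw [Metric.mem_ball, Real.dist_eq] at hu'
      exact (hb' a u h1 hu').1.1.le) t (by rwa [Metric.mem_ball, Real.dist_eq]) s
      (by rwa [Metric.mem_ball, Real.dist_eq]) hts
  linarith

lemma Qf_zero (S : Setup n φ h) {m : ℝ} (hm0 : 0 < m)
    (hall : ∀ x y : Esp n, ‖x‖ = 1 → ‖y‖ = 1 → h x - h y ≤ m * ‖x - y‖)
    {x y : Esp n} (hx : ‖x‖ = 1) (hy : ‖y‖ = 1) (hxy : x ≠ y) (hd2 : ‖x - y‖ < 2)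
    (heq : h x - h y = m * ‖x - y‖) {v : Esp n} (hv : ‖v‖ = 1) (hvx : ⟪v, x⟫ = 0) :
    Qf n h x y v = 0 := by
  have hRv : ‖Rf x y v‖ = 1 := by rw [norm_Rf, hv]
  have hRy : ⟪Rf x y v, y⟫ = 0 := Rf_perp hx hy hvx
  obtain ⟨f1, f2⟩ := S.M_first hm0 hall hx hy hxy heq
  obtain ⟨g1, g2⟩ := S.M_hess hm0 hall hx hy hxy hd2 heq
  have hi : ⟪Rf x y v, x⟫ = ⟪v, y⟫ := by
    rw [← LinearIsometryEquiv.inner_map_map (Rf x y) v y, Rf_y hx hy]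
  unfold Qf
  rw [f1 v hv hvx, f2 _ hRv hRy, g1 v hv hvx, g2 _ hRv hRy, hi]
  ring

open Filter Topology in
lemma cont_Qf (S : Setup n φ h) {x y : Esp n} (hx : ‖x‖ = 1) (hy : ‖y‖ = 1) (hxy : x ≠ y)
    (v : Esp n) :
    ContinuousAt (fun q : (Esp n × Esp n) × Esp n => Qf n h q.1.1 q.1.2 q.2) ((x, y), v) := by
  have hx0 := ne_zero_of_unit hx
  have hy0 := ne_zero_of_unit hy
  have hX : ContinuousAt (fun q : (Esp n × Esp n) × Esp n => q.1.1) ((x, y), v) := by fun_prop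
  have hY : ContinuousAt (fun q : (Esp n × Esp n) × Esp n => q.1.2) ((x, y), v) := by fun_prop
  have hV : ContinuousAt (fun q : (Esp n × Esp n) × Esp n => q.2) ((x, y), v) := by fun_prop
  have hsub := hX.sub hY
  have hne : ‖x - y‖ ≠ 0 := (norm_sub_pos hxy).ne'
  have hW : ContinuousAt (fun q : (Esp n × Esp n) × Esp n => wv q.1.1 q.1.2) ((x, y), v) :=
    (hsub.norm.inv₀ hne).smul hsub
  have hR : ContinuousAt (fun q : (Esp n × Esp n) × Esp n => Rf q.1.1 q.1.2 q.2) ((x, y), v) := by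
    have hi : ContinuousAt (fun q : (Esp n × Esp n) × Esp n =>
        2 * ⟪q.2, wv q.1.1 q.1.2⟫) ((x, y), v) := continuousAt_const.mul (hV.inner hW)
    have h1 : ContinuousAt (fun q : (Esp n × Esp n) × Esp n =>
        q.2 - (2 * ⟪q.2, wv q.1.1 q.1.2⟫) • wv q.1.1 q.1.2) ((x, y), v) :=
      hV.sub (hi.smul hW)
    refine h1.congr ?_
    have : ∀ᶠ q : (Esp n × Esp n) × Esp n in 𝓝 ((x, y), v), q.1.1 - q.1.2 ≠ 0 :=
      hsub.eventually_ne (sub_ne_zero.2 hxy)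
    filter_upwards [this] with q hq
    rw [Rf_apply (sub_ne_zero.1 hq)]
  have hfx := (ContinuousAt.comp (g := fderiv ℝ h) (f := fun q : (Esp n × Esp n) × Esp n => q.1.1)
    (x := ((x, y), v)) (S.contAtf hx0) hX).clm_apply hV
  have hfy := (ContinuousAt.comp (g := fderiv ℝ h) (f := fun q : (Esp n × Esp n) × Esp n => q.1.2)
    (x := ((x, y), v)) (S.contAtf hy0) hY).clm_apply hR
  have h2x := ((ContinuousAt.comp (g := D2 n h) (f := fun q : (Esp n × Esp n) × Esp n => q.1.1)
    (x := ((x, y), v)) (S.contAt2 hx0) hX).clm_apply hV).clm_apply hV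
  have h2y := ((ContinuousAt.comp (g := D2 n h) (f := fun q : (Esp n × Esp n) × Esp n => q.1.2)
    (x := ((x, y), v)) (S.contAt2 hy0) hY).clm_apply hR).clm_apply hR
  have hhx := ContinuousAt.comp (g := h) (f := fun q : (Esp n × Esp n) × Esp n => q.1.1)
    (x := ((x, y), v)) (S.contAt hx0) hX
  have hhy := ContinuousAt.comp (g := h) (f := fun q : (Esp n × Esp n) × Esp n => q.1.2)
    (x := ((x, y), v)) (S.contAt hy0) hY
  unfold Qf
  exact ((continuousAt_const.mul (hV.inner hW)).mul (hfx.add hfy)).add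
    ((hsub.norm.div_const 2).mul ((h2x.add h2y).sub (hhx.add hhy)))

open Filter Topology in
lemma Qf_small (S : Setup n φ h) {m : ℝ} (hm0 : 0 < m)
    (hall : ∀ x y : Esp n, ‖x‖ = 1 → ‖y‖ = 1 → h x - h y ≤ m * ‖x - y‖)
    {x y : Esp n} (hx : ‖x‖ = 1) (hy : ‖y‖ = 1) (hxy : x ≠ y) (hd2 : ‖x - y‖ < 2)
    (heq : h x - h y = m * ‖x - y‖) {η : ℝ} (hη : 0 < η) :
    ∀ᶠ q : Esp n × Esp n in 𝓝 (x, y), ∀ v ∈ sphere (0 : Esp n) 1, ⟪v, q.1⟫ = 0 →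
      Qf n h q.1 q.2 v < η := by
  refine (isCompact_sphere (0 : Esp n) 1).eventually_forall_of_forall_eventually
    (P := fun (q : Esp n × Esp n) v => ⟪v, q.1⟫ = 0 → Qf n h q.1 q.2 v < η) ?_
  intro v hv
  have hv1 : ‖v‖ = 1 := by simpa using hv
  by_cases hvx : ⟪v, x⟫ = 0
  · have h1 := S.cont_Qf hx hy hxy v
    have h2 := h1.eventually_lt_const (u := η) (by
      simp only [S.Qf_zero hm0 hall hx hy hxy hd2 heq hv1 hvx]; exact hη)
    filter_upwards [h2] with q hq _ using hq
  · have h1 : ContinuousAt (fun q : (Esp n × Esp n) × Esp n => ⟪q.2, q.1.1⟫) ((x, y), v) := by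
      fun_prop
    have h2 := h1.eventually_ne hvx
    filter_upwards [h2] with q hq h0 using absurd h0 hq

end Setup

namespace Setup

variable {n : ℕ} {φ : ℝ → ℝ → ℝ} {h : Esp n → ℝ}

lemma Zf_Psi_mul {e Λ : ℝ} {x y : Esp n} (hd : 0 < ‖x - y‖) :
    ‖x - y‖ * (Zf n h (x, y) + e * Psi n h Λ (x, y)) =
      h x - h y + e * (Λ * ‖x + y‖) - ‖x - y‖ * (e / 2 * (h x + h y)) := by
  unfold Zf Psi
  simp only
  field_simp
  ring

set_option maxHeartbeats 1000000 in
open Filter Topology in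
lemma F_contra (S : Setup n φ h) {m : ℝ} (hm0 : 0 < m)
    {z : Esp n} (hz : ‖z‖ = 1) (hzm : h z - h (-z) = 2 * m)
    (hall : ∀ x y : Esp n, ‖x‖ = 1 → ‖y‖ = 1 → h x - h y ≤ m * ‖x - y‖)
    (hs2 : ∀ x y : ℝ, 0 < x → 0 < y → 0 < deriv (fun s => φ x s) y) : False := by
  obtain ⟨Λ, e, P, ⟨x, y⟩, hΛ, he, hepos, he1, hP, hPK, hpK, hpm, hd1, hd2, hmax⟩ :=
    S.F_limit hm0 hz hzm hall hs2
  obtain ⟨l, L, hl, hL, hb⟩ := S.toHData.exists_bounds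
  obtain ⟨hx, hy, -, -⟩ := id hpK
  simp only at hx hy hd1 hd2
  have hdp : 0 < ‖x - y‖ := by linarith
  have hxy : x ≠ y := by intro e; rw [e] at hdp; simp at hdp
  have hx0 := ne_zero_of_unit hx
  have hy0 := ne_zero_of_unit hy
  have heq : h x - h y = m * ‖x - y‖ := by
    unfold Zf at hpm; simp only at hpm; rwa [div_eq_iff hdp.ne'] at hpm
  have hρ : 0 < ‖x + y‖ := norm_pos_iff.2 (add_ne_of_lt hx hd2)
  obtain ⟨g1, g2⟩ := S.M_grad hm0 hall hx hy hxy heq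
  set pg := m * ‖x + y‖ / 2 with hpg
  have hpg0 : 0 < pg := by positivity
  have hhy : 0 < h y := S.pos y (by simpa using hy)
  obtain ⟨γ, δ, hγ, hδ, hlow⟩ := S.phi_lower hs2 hhy hpg0
  set B := |φ (h y) pg| + 1 with hB
  have hB0 : 0 < B := by positivity
  have hn0 : (0:ℝ) < n := by exact_mod_cast S.hn
  set η := γ * pg * l / (8 * B * n) with hη
  have hη0 : 0 < η := by positivity
  -- limits
  have l1 : Tendsto (fun k => (P k).1) atTop (𝓝 x) := (continuous_fst.tendsto _).comp hP
  have l2 : Tendsto (fun k => (P k).2) atTop (𝓝 y) := (continuous_snd.tendsto _).comp hP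
  have ld := (l1.sub l2).norm
  have lhx : Tendsto (fun k => h (P k).1) atTop (𝓝 (h x)) := (S.contAt hx0).tendsto.comp l1
  have lhy : Tendsto (fun k => h (P k).2) atTop (𝓝 (h y)) := (S.contAt hy0).tendsto.comp l2
  have lgx : Tendsto (fun k => ‖sphGrad n h (P k).1‖) atTop (𝓝 pg) := by
    have := ((S.contAt_sphGrad hx0).tendsto.comp l1).norm
    rwa [g1] at this
  have lgy : Tendsto (fun k => ‖sphGrad n h (P k).2‖) atTop (𝓝 pg) := by
    have := ((S.contAt_sphGrad hy0).tendsto.comp l2).norm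
    rwa [g2] at this
  have lφ : Tendsto (fun k => φ (h (P k).2) ‖sphGrad n h (P k).2‖) atTop (𝓝 (φ (h y) pg)) :=
    (S.cdaφ hhy hpg0).continuousAt.tendsto.comp (lhy.prodMk_nhds lgy)
  have llam : Tendsto (fun k => m + e k * Psi n h Λ (x, y)) atTop (𝓝 (m + 0 * Psi n h Λ (x, y))) :=
    tendsto_const_nhds.add (he.mul tendsto_const_nhds)
  have lK : Tendsto (fun k => e k * (n * η / l)) atTop (𝓝 (0 * (n * η / l))) :=
    he.mul tendsto_const_nhds
  have E1 := ld.eventually_const_lt hd1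
  have E2 := ld.eventually_lt_const hd2
  have E3 := (lhx.sub lhy).eventually_const_lt (u := 0) (by rw [heq]; positivity)
  have E4 := (tendsto_order.1 lgy).1 (pg / 2) (by linarith)
  have E5 := (Metric.tendsto_nhds.1 lgx) δ hδ
  have E6 := (Metric.tendsto_nhds.1 lgy) δ hδ
  have E7 := (Metric.tendsto_nhds.1 lhy) δ hδ
  have E8 := lφ.eventually_lt_const (u := B) (by
    have := le_abs_self (φ (h y) pg); rw [hB]; linarith)
  have E9 := llam.eventually_const_lt (u := 0) (by simpa using hm0)
  have E10 := lK.eventually_lt_const (u := 1) (by simp)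
  have E11 := hP.eventually (S.Qf_small hm0 hall hx hy hxy hd2 heq hη0)
  obtain ⟨k, h1, h2, h3, h4, h5, h6, h7, h8, h9, h10, h11⟩ :=
    (E1.and (E2.and (E3.and (E4.and (E5.and (E6.and (E7.and (E8.and (E9.and
      (E10.and E11)))))))))).exists
  have hPk := hPK k
  have hmk := hmax k
  have hε := hepos k
  have hε1 := he1 k
  generalize e k = ε at *
  generalize P k = Q at *
  obtain ⟨a, b⟩ := Q
  obtain ⟨ha, hb', -, -⟩ := hPk
  simp only at h1 h2 h3 h4 h5 h6 h7 h8 h11 ha hb'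
  rw [Real.dist_eq] at h5 h6 h7
  set lam := Zf n h (a, b) + ε * Psi n h Λ (a, b) with hlam
  have hlam0 : 0 < lam := by
    have := hmk _ hpK
    rw [hpm] at this
    linarith
  have hdab : 0 < ‖a - b‖ := by linarith
  have hab : a ≠ b := by intro e; rw [e] at hdab; simp at hdab
  obtain ⟨F1, F2⟩ := S.F_local hε hε1 hΛ hlam0 ha hb' h1 h2
    (fun x' y' hx' hy' hd' => by
      have t1 := hmk (x', y') ⟨hx', hy', hd', norm_le_two hx' hy'⟩
      have t0 : 0 < ‖x' - y'‖ := by linarith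
      have t2 := mul_le_mul_of_nonneg_left t1 t0.le
      rw [Zf_Psi_mul t0] at t2
      linarith)
    (by
      have t2 := Zf_Psi_mul (n := n) (h := h) (e := ε) (Λ := Λ) hdab
      rw [← hlam] at t2
      linarith)
  obtain ⟨C1, C2⟩ := S.toHData.compare ha hb' (Rf a b) (Rf_x ha hb') 0 hl hL hb
    (K1 := 0) (K2 := ε * η) le_rfl (by positivity) (fun v hv hva => by
      have t1 := F2 v hv hva
      have t2 := h11 v (by simpa using hv) hva
      have t3 := mul_le_mul_of_nonneg_left t2.le hε.le
      linarith)
  rw [S.sig a ha, S.sig b hb'] at C1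
  rw [S.sig b hb'] at C2
  set px := ‖sphGrad n h a‖ with hpx
  set py := ‖sphGrad n h b‖ with hpy
  have hpx0 : 0 ≤ px := norm_nonneg _
  have hpy0 : 0 ≤ py := norm_nonneg _
  have hhb : 0 < h b := S.pos b (by simpa using hb')
  have hgap : ε * py ≤ px - py := by
    have t1 : px - py = ε * (‖a - b‖ / 2) * (px + py) := by linarith
    have t2 : 0 ≤ px - py := by rw [t1]; positivity
    have t3 : ε * (1 / 2) * (py + py) ≤ ε * (‖a - b‖ / 2) * (px + py) := by
      gcongr <;> linarith
    linarith
  have hple : py ≤ px := by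
    have : 0 ≤ ε * py := by positivity
    linarith
  have hpx1 : 0 < px := by linarith
  have hlo := hlow (h b) py px h7 h6 h5 hple
  have hm1 := S.mono1 hhb hpx1 (a' := h a) (by linarith)
  have hexp : Real.exp (n * (ε * η) / l - 0 * ‖(0 : Esp n) - ⟪(0 : Esp n), a⟫ • a‖ ^ 2 / L)
      ≤ 1 + 2 * (ε * (n * η / l)) := by
    have e1 : n * (ε * η) / l - 0 * ‖(0 : Esp n) - ⟪(0 : Esp n), a⟫ • a‖ ^ 2 / L
      = ε * (n * η / l) := by ring
    rw [e1]
    have t0 : 0 ≤ ε * (n * η / l) := by positivity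
    have t1 := Real.abs_exp_sub_one_le (x := ε * (n * η / l)) (by rw [abs_of_nonneg t0]; exact h10.le)
    rw [abs_of_nonneg t0] at t1
    have := le_abs_self (Real.exp (ε * (n * η / l)) - 1)
    linarith
  have hfin : φ (h a) px ≤ φ (h b) py * (1 + 2 * (ε * (n * η / l))) :=
    C1.trans (mul_le_mul_of_nonneg_left hexp C2.le)
  have q1 : γ * (ε * (pg / 2)) ≤ γ * (px - py) := by
    apply mul_le_mul_of_nonneg_left _ hγ.le
    have : ε * (pg / 2) ≤ ε * py := mul_le_mul_of_nonneg_left h4.le hε.le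
    linarith
  have q2 : φ (h b) py * (2 * (ε * (n * η / l))) ≤ B * (2 * (ε * (n * η / l))) :=
    mul_le_mul_of_nonneg_right h8.le (by positivity)
  have q3 : B * (2 * (ε * (n * η / l))) = γ * (ε * pg) / 4 := by
    rw [hη]; clear_value B pg; field_simp; norm_num
  have q4 : 0 < γ * (ε * pg) := by positivity
  linarith

/-- Conclusion: `h` is constant on the sphere. -/
lemma main (S : Setup n φ h)
    (hstrict : (∀ x y : ℝ, 0 < x → 0 < y → 0 < deriv (fun t => φ t y) x) ∨
               (∀ x y : ℝ, 0 < x → 0 < y → 0 < deriv (fun s => φ x s) y))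
    {x y : Esp n} (hx : ‖x‖ = 1) (hy : ‖y‖ = 1) : h x = h y := by
  obtain ⟨x0, hx0, hG⟩ := S.exists_G
  have hG0 : ‖sphGrad n h x0‖ ≤ 0 := by
    by_contra hcon
    push Not at hcon
    obtain ⟨m, hm0, ⟨z, hz, hzm⟩, hall⟩ := S.stepBinf hx0 rfl hG hcon
    rcases hstrict with hs | hs
    · obtain ⟨a, b, ha, hb, hd, he⟩ := S.stepA hm0 hz hzm hall (d0 := 1) one_pos (by norm_num)
      have hab : a ≠ b := by intro e; rw [e] at hd; simp at hd
      exact (S.M_eq hm0 hall ha hb hab (by rw [hd]; norm_num) (by rw [hd, he])).1 hs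
    · exact S.F_contra hm0 hz hzm hall hs
  have hG' : ∀ x, ‖x‖ = 1 → ‖sphGrad n h x‖ ≤ 0 := fun x hx => (hG x hx).trans hG0
  exact le_antisymm (S.const_of_G hG' hx hy) (S.const_of_G hG' hy hx)

end Setup

/-- Theorem 1.2.  Let `φ : (0,∞)×(0,∞) → (0,∞)` be `C¹` with `∂₁φ ≥ 0`,
`∂₂φ ≥ 0`, one of them strict.  If `Mⁿ ⊆ ℝ^{n+1}` is a closed, smooth, strictly convex
hypersurface (encoded by its smooth, 1-homogeneous support function `h`, whose spherical
Hessian `∇̄²h + ḡh` is positive definite) with `h > 0` and Gauss curvature `𝒦` (so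
`𝒦⁻¹ = det(∇̄²h + ḡh)/det ḡ = σ_n`) satisfying `φ(h, |Dh|) 𝒦 = 1` on `𝕊ⁿ`, then `M` is an
origin-centred sphere, i.e. `h` is a positive constant. -/
theorem statement_2 (n : ℕ) (hn : 1 ≤ n)
    (φ : ℝ → ℝ → ℝ)
    (hφC1 : ContDiffOn ℝ 1 (fun p : ℝ × ℝ => φ p.1 p.2) (Set.Ioi 0 ×ˢ Set.Ioi 0))
    (hφpos : ∀ x y : ℝ, 0 < x → 0 < y → 0 < φ x y)
    (hφ1 : ∀ x y : ℝ, 0 < x → 0 < y → 0 ≤ deriv (fun t => φ t y) x)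
    (hφ2 : ∀ x y : ℝ, 0 < x → 0 < y → 0 ≤ deriv (fun s => φ x s) y)
    (hstrict : (∀ x y : ℝ, 0 < x → 0 < y → 0 < deriv (fun t => φ t y) x) ∨
               (∀ x y : ℝ, 0 < x → 0 < y → 0 < deriv (fun s => φ x s) y))
    (h 𝒦 : Esp n → ℝ)
    (hsm : ContDiffOn ℝ (⊤ : ℕ∞) h {(0 : Esp n)}ᶜ)
    (hhom : PosHom n h)
    (hconv : ∀ x ∈ sphere (0 : Esp n) 1, ∀ v : Esp n,
      ⟪v, x⟫ = 0 → v ≠ 0 → 0 < hessForm n h x v v)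
    (hpos : ∀ x ∈ sphere (0 : Esp n) 1, 0 < h x)
    (hGauss : ∀ x ∈ sphere (0 : Esp n) 1, (𝒦 x)⁻¹ = sigmaElem n n h x)
    (heq : ∀ x ∈ sphere (0 : Esp n) 1, φ (h x) ‖sphGrad n h x‖ * 𝒦 x = 1) :
    ∃ r : ℝ, 0 < r ∧ ∀ x ∈ sphere (0 : Esp n) 1, h x = r := by
  have hσ : ∀ x : Esp n, ‖x‖ = 1 → sigmaElem n n h x = φ (h x) ‖sphGrad n h x‖ := by
    intro x hx
    have hx' : x ∈ sphere (0 : Esp n) 1 := by simpa using hx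
    rw [← hGauss x hx']
    exact (eq_inv_of_mul_eq_one_left (heq x hx')).symm
  have S : Setup n φ h :=
    { sm := hsm, hom := hhom, conv := hconv, pos := hpos, hn := hn, C1 := hφC1, d1 := hφ1,
      d2 := hφ2, sig := hσ }
  obtain ⟨x0, hx0⟩ := HData.exists_unit n
  refine ⟨h x0, hpos x0 (by simpa using hx0), fun x hx => ?_⟩
  exact S.main hstrict (by simpa using hx) hx0
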